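/- Let A be a commutative unital complex Banach algebra and n ≥ 1. Let S^{2n−1} denote the unit sphere {v ∈ ℂⁿ : ‖v‖ = 1} of ℂⁿ. Then there is a homotopy equivalence between Lcₙ(A)₀, the path component of eₙ in the space of last columns Lcₙ(A), and the path component of the constant map with value (0,…,0,1) in C(Max(A), S^{2n−1}) (with the compact-open topology). -/

import Mathlib

open WeakDual
set_option linter.all false
set_option linter.deprecated false
set_option linter.unusedSectionVars false

namespace Oka

/-- Laurent series with absolutely summable coefficients. -/
def Lau (B : Type*) [NormedCommRing B] : Type _ := lp (fun _ : ℤ => B) 1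

noncomputable section
section lau
variable {B : Type*} [NormedCommRing B] [NormedAlgebra ℂ B] [CompleteSpace B]

instance : NormedAddCommGroup (Lau B) := inferInstanceAs (NormedAddCommGroup (lp (fun _ : ℤ => B) 1))
instance : NormedSpace ℂ (Lau B) := inferInstanceAs (NormedSpace ℂ (lp (fun _ : ℤ => B) 1))
instance : CompleteSpace (Lau B) := inferInstanceAs (CompleteSpace (lp (fun _ : ℤ => B) 1))

/-- coefficient -/
def coef (k : ℤ) : Lau B →L[ℂ] B := lp.evalCLM ℂ (fun _ : ℤ => B) 1 k

/-- monomials -/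
def mono (k : ℤ) : B →L[ℂ] Lau B := lp.singleContinuousLinearMap ℂ (fun _ : ℤ => B) 1 k

theorem norm_mono (k : ℤ) (c : B) : ‖mono k c‖ = ‖c‖ := lp.norm_single (E := fun _ : ℤ => B) one_pos k c

theorem coef_mono (k m : ℤ) (c : B) : coef k (mono m c) = if k = m then c else 0 := by
  change (lp.single (E := fun _ : ℤ => B) 1 m c : ∀ _ : ℤ, B) k = _
  rw [lp.coeFn_single]
  simp [Pi.single_apply]

theorem hasSum_mono (l : Lau B) : HasSum (fun k => mono k (coef k l)) l :=
  lp.hasSum_single (E := fun _ : ℤ => B) ENNReal.one_ne_top l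

theorem lau_ext {l m : Lau B} (h : ∀ k, coef k l = coef k m) : l = m :=
  lp.ext (funext h)

theorem hasSum_norm (l : Lau B) : HasSum (fun k => ‖coef k l‖) ‖l‖ := by
  have := lp.hasSum_norm (E := fun _ : ℤ => B) (p := 1) (by simp) l
  simp only [ENNReal.toReal_one, Real.rpow_one] at this
  exact this

variable {E : Type*} [NormedAddCommGroup E] [NormedSpace ℂ E] [CompleteSpace E]

theorem summable_lift (f : ℤ → (B →L[ℂ] E)) (C : ℝ) (hf : ∀ k, ‖f k‖ ≤ C) (l : Lau B) :
    Summable (fun k => ‖f k (coef k l)‖) :=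
  Summable.of_nonneg_of_le (fun _ => norm_nonneg _) (fun k => (f k).le_of_opNorm_le (hf k) _)
    ((hasSum_norm l).summable.mul_left C)

/-- universal property -/
def lift (f : ℤ → (B →L[ℂ] E)) (C : ℝ) (hf : ∀ k, ‖f k‖ ≤ C) : Lau B →L[ℂ] E :=
  LinearMap.mkContinuous
    { toFun := fun l => ∑' k, f k (coef k l)
      map_add' := fun x y => by
        simp only [map_add]
        exact (summable_lift f C hf x).of_norm.tsum_add (summable_lift f C hf y).of_norm
      map_smul' := fun c x => by
        simp only [map_smul, RingHom.id_apply]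
        exact (summable_lift f C hf x).of_norm.tsum_const_smul c } C (fun l => by
      refine (norm_tsum_le_tsum_norm (summable_lift f C hf l)).trans ?_
      rw [← (hasSum_norm l).tsum_eq, ← tsum_mul_left]
      exact (summable_lift f C hf l).tsum_le_tsum (fun k => (f k).le_of_opNorm_le (hf k) _)
        ((hasSum_norm l).summable.mul_left C))

theorem norm_lift_le (f : ℤ → (B →L[ℂ] E)) (C : ℝ) (hf : ∀ k, ‖f k‖ ≤ C) : ‖lift f C hf‖ ≤ C :=
  LinearMap.mkContinuous_norm_le _ ((norm_nonneg _).trans (hf 0)) _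

theorem lift_apply (f : ℤ → (B →L[ℂ] E)) (C : ℝ) (hf : ∀ k, ‖f k‖ ≤ C) (l : Lau B) :
    lift f C hf l = ∑' k, f k (coef k l) := rfl

attribute [irreducible] lift

theorem lift_mono (f : ℤ → (B →L[ℂ] E)) (C : ℝ) (hf : ∀ k, ‖f k‖ ≤ C) (k : ℤ) (c : B) :
    lift f C hf (mono k c) = f k c := by
  rw [lift_apply, tsum_eq_single k]
  · simp [coef_mono]
  · intro m hm; simp [coef_mono, hm]

theorem clm_ext {f g : Lau B →L[ℂ] E} (h : ∀ k c, f (mono k c) = g (mono k c)) : f = g := by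
  ext l
  have h1 := (hasSum_mono l).mapL f
  have h2 := (hasSum_mono l).mapL g
  simp only [h] at h1
  exact h1.unique h2

/-- multiplication by `c T^k` -/
def mulMono (k : ℤ) (c : B) : Lau B →L[ℂ] Lau B :=
  lift (fun m => (mono (k + m)).comp (ContinuousLinearMap.mul ℂ B c)) ‖c‖ (fun m => by
    refine ContinuousLinearMap.opNorm_le_bound _ (norm_nonneg _) (fun x => ?_)
    simp only [ContinuousLinearMap.comp_apply, norm_mono, ContinuousLinearMap.mul_apply']
    exact norm_mul_le _ _)

theorem norm_mulMono_le (k : ℤ) (c : B) : ‖mulMono k c‖ ≤ ‖c‖ := norm_lift_le _ _ _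

theorem mulMono_mono (k : ℤ) (c : B) (m : ℤ) (x : B) :
    mulMono k c (mono m x) = mono (k + m) (c * x) := by
  rw [mulMono, lift_mono]; rfl

/-- multiplication by `c T^k`, as a function of `c` -/
def mulMonoL (k : ℤ) : B →L[ℂ] (Lau B →L[ℂ] Lau B) :=
  LinearMap.mkContinuous
    { toFun := mulMono k
      map_add' := fun x y => clm_ext fun m c => by simp [mulMono_mono, add_mul]
      map_smul' := fun x y => clm_ext fun m c => by simp [mulMono_mono] } 1 (fun c => by
      rw [one_mul]; exact norm_mulMono_le k c)

theorem norm_mulMonoL_le (k : ℤ) : ‖mulMonoL (B := B) k‖ ≤ 1 :=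
  LinearMap.mkContinuous_norm_le _ zero_le_one _

/-- multiplication of Laurent series -/
def mulL : Lau B →L[ℂ] (Lau B →L[ℂ] Lau B) :=
  lift mulMonoL 1 norm_mulMonoL_le

theorem mulL_mono (k : ℤ) (c : B) (m : ℤ) (x : B) :
    mulL (mono k c) (mono m x) = mono (k + m) (c * x) := by
  rw [mulL, lift_mono]; exact mulMono_mono k c m x

theorem norm_mulL_le (x y : Lau B) : ‖mulL x y‖ ≤ ‖x‖ * ‖y‖ := by
  have h : ‖mulL (B := B)‖ ≤ 1 := by
    unfold mulL; apply norm_lift_le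
  have h2 := (mulL (B := B)).le_opNorm₂ x y
  have h3 : ‖mulL (B := B)‖ * ‖x‖ * ‖y‖ ≤ 1 * ‖x‖ * ‖y‖ := by gcongr
  rw [one_mul] at h3
  exact h2.trans h3

attribute [irreducible] mulL

theorem mulL_comm (x y : Lau B) : mulL x y = mulL y x := by
  have : (mulL : Lau B →L[ℂ] (Lau B →L[ℂ] Lau B)) = (mulL).flip :=
    clm_ext fun k c => clm_ext fun m d => by
      simp only [ContinuousLinearMap.flip_apply, mulL_mono, add_comm, mul_comm]
  exact congrArg (fun f => f x y) this

theorem mulL_assoc (x y z : Lau B) : mulL (mulL x y) z = mulL x (mulL y z) := by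
  have h1 : ∀ k c m d, mulL (mulL (mono k c) (mono m d)) z
      = mulL (mono k c) (mulL (mono m d) z) := fun k c m d => by
    have : mulL (mulL (mono k c) (mono m d))
      = (mulL (mono k c)).comp (mulL (mono m d)) :=
      clm_ext fun m d => by
        simp only [ContinuousLinearMap.comp_apply, mulL_mono, add_assoc, mul_assoc]
    exact congrArg (fun f => f z) this
  have h2 : ∀ k c, mulL (mulL (mono k c) y) z = mulL (mono k c) (mulL y z) := fun k c => by
    have : (mulL.flip z).comp (mulL (mono k c)) = (mulL (mono k c)).comp (mulL.flip z) :=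
      clm_ext fun m d => h1 k c m d
    exact congrArg (fun f => f y) this
  have : (mulL.flip z).comp (mulL.flip y) = mulL.flip (mulL y z) := clm_ext fun m d => h2 m d
  exact congrArg (fun f => f x) this

theorem one_mulL (x : Lau B) : mulL (mono 0 1) x = x := by
  have : mulL (mono 0 1) = ContinuousLinearMap.id ℂ (Lau B) :=
    clm_ext fun m d => by simp [mulL_mono]
  exact congrArg (fun f => f x) this

instance : Mul (Lau B) := ⟨fun x y => mulL x y⟩
instance : One (Lau B) := ⟨mono 0 1⟩

theorem mul_def (x y : Lau B) : x * y = mulL x y := rfl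

instance : NormedCommRing (Lau B) :=
  { (inferInstance : NormedAddCommGroup (Lau B)), (inferInstance : Mul (Lau B)),
    (inferInstance : One (Lau B)) with
    left_distrib := fun x y z => by simp only [mul_def, map_add]
    right_distrib := fun x y z => by simp only [mul_def, map_add, _root_.add_apply]
    zero_mul := fun x => by simp only [mul_def, map_zero, _root_.zero_apply]
    mul_zero := fun x => by simp only [mul_def, map_zero]
    mul_assoc := mulL_assoc
    one_mul := one_mulL
    mul_one := fun x => by rw [mul_def, mulL_comm]; exact one_mulL x
    mul_comm := mulL_comm
    norm_mul_le := norm_mulL_le }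

instance : Algebra ℂ (Lau B) := Algebra.ofModule
  (fun r x y => by simp only [mul_def, map_smul, _root_.smul_apply])
  (fun r x y => by simp only [mul_def, map_smul])

instance : NormedAlgebra ℂ (Lau B) where
  norm_smul_le := fun r x => norm_smul_le r x

theorem mono_mul (k : ℤ) (c : B) (m : ℤ) (x : B) :
    mono k c * mono m x = mono (k + m) (c * x) := mulL_mono k c m x

/-- constants -/
def iota : B →ₐ[ℂ] Lau B :=
  AlgHom.ofLinearMap (mono 0 : B →L[ℂ] Lau B).toLinearMap rfl
    (fun x y => by
      change mono 0 (x * y) = mono 0 x * mono 0 y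
      rw [mono_mul, add_zero])

theorem iota_def (x : B) : iota x = mono 0 x := rfl

theorem norm_iota (x : B) : ‖iota x‖ = ‖x‖ := norm_mono 0 x

theorem continuous_iota : Continuous (iota : B → Lau B) := (mono 0 : B →L[ℂ] Lau B).continuous

/-- the variable -/
def TT : Lau B := mono 1 1

theorem one_def : (1 : Lau B) = mono 0 1 := rfl

theorem iota_mul_mono (c : B) (k : ℤ) (x : B) : iota c * mono k x = mono k (c * x) := by
  rw [iota_def, mono_mul, zero_add]

theorem coef_iota_mul (k : ℤ) (c : B) (l : Lau B) : coef k (iota c * l) = c * coef k l := by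
  have : (coef k).comp (ContinuousLinearMap.mul ℂ (Lau B) (iota c))
      = (ContinuousLinearMap.mul ℂ B c).comp (coef k) :=
    clm_ext fun m d => by
      simp only [ContinuousLinearMap.comp_apply, ContinuousLinearMap.mul_apply', iota_mul_mono,
        coef_mono]
      split_ifs <;> simp
  exact congrArg (fun f => f l) this

theorem coef_iota (k : ℤ) (c : B) : coef k (iota c) = if k = 0 then c else 0 := by
  rw [iota_def, coef_mono]

theorem coef_mono_mul (k m : ℤ) (c : B) (l : Lau B) :
    coef k (mono m c * l) = c * coef (k - m) l := by
  have : (coef k).comp (ContinuousLinearMap.mul ℂ (Lau B) (mono m c))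
      = (ContinuousLinearMap.mul ℂ B c).comp (coef (k - m)) :=
    clm_ext fun m d => by
      simp only [ContinuousLinearMap.comp_apply, ContinuousLinearMap.mul_apply', mono_mul,
        coef_mono]
      split_ifs <;> first | rfl | omega | simp
  exact congrArg (fun f => f l) this

open scoped Classical in
/-- mask -/
def mask (S : Set ℤ) : Lau B →L[ℂ] Lau B :=
  lift (fun k => if k ∈ S then mono k else 0) 1 (fun k => by
    split_ifs
    · exact ContinuousLinearMap.opNorm_le_bound _ zero_le_one
        (fun x => by rw [norm_mono, one_mul])
    · simp)

open scoped Classical in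
theorem mask_mono (S : Set ℤ) (k : ℤ) (c : B) :
    mask S (mono k c) = if k ∈ S then mono k c else 0 := by
  rw [mask, lift_mono]; split_ifs <;> simp

open scoped Classical in
theorem coef_mask (S : Set ℤ) (k : ℤ) (l : Lau B) :
    coef k (mask S l) = if k ∈ S then coef k l else 0 := by
  have : (coef k : Lau B →L[ℂ] B).comp (mask S)
      = if k ∈ S then (coef k : Lau B →L[ℂ] B) else 0 :=
    clm_ext fun m d => by
      rw [ContinuousLinearMap.comp_apply, mask_mono]
      split_ifs with h1 h2 h2
      · rfl
      · rw [coef_mono, if_neg]; rfl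
        rintro rfl; exact h2 h1
      · rw [coef_mono, if_neg, map_zero]
        rintro rfl; exact h1 h2
      · simp
  have h := congrArg (fun f => f l) this
  rw [ContinuousLinearMap.comp_apply] at h
  rw [h]; split_ifs <;> rfl

theorem norm_mask_le (S : Set ℤ) (l : Lau B) : ‖mask S l‖ ≤ ‖l‖ := by
  have := (mask (B := B) S).le_of_opNorm_le (norm_lift_le _ 1 _) l
  simpa using this

theorem mask_iota_mul (S : Set ℤ) (c : B) (l : Lau B) : mask S (iota c * l) = iota c * mask S l :=
  lau_ext fun k => by
    rw [coef_mask, coef_iota_mul, coef_iota_mul, coef_mask]; split_ifs <;> simp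

/-- coefficients in an ideal -/
def coefIdeal (n : Ideal B) (hn : IsClosed (n : Set B)) : Ideal (Lau B) where
  carrier := {l | ∀ k, coef k l ∈ n}
  zero_mem' := fun k => by simp
  add_mem' := fun hx hy k => by rw [map_add]; exact n.add_mem (hx k) (hy k)
  smul_mem' := fun c x hx k => by
    rw [smul_eq_mul]
    have h1 : HasSum (fun m => coef k (mono m (coef m c) * x)) (coef k (c * x)) :=
      
      ((hasSum_mono c).mul_right x).mapL (coef k : Lau B →L[ℂ] B)
    refine hn.mem_of_tendsto h1 (Filter.Eventually.of_forall fun s => ?_)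
    refine n.sum_mem fun m _ => ?_
    rw [coef_mono_mul]
    exact n.mul_mem_left _ (hx _)

theorem mem_coefIdeal {n : Ideal B} {hn : IsClosed (n : Set B)} {l : Lau B} :
    l ∈ coefIdeal n hn ↔ ∀ k, coef k l ∈ n := Iff.rfl

theorem isClosed_coefIdeal (n : Ideal B) (hn : IsClosed (n : Set B)) :
    IsClosed (coefIdeal n hn : Set (Lau B)) := by
  have : (coefIdeal n hn : Set (Lau B)) = ⋂ k, (coef k : Lau B →L[ℂ] B) ⁻¹' (n : Set B) := by
    ext l; simp [mem_coefIdeal]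
  rw [this]
  exact isClosed_iInter fun k => hn.preimage (coef k : Lau B →L[ℂ] B).continuous

theorem mask_mem {n : Ideal B} {hn : IsClosed (n : Set B)} {l : Lau B} (h : l ∈ coefIdeal n hn)
    (S : Set ℤ) : mask S l ∈ coefIdeal n hn := fun k => by
  rw [coef_mask]; split_ifs
  · exact h k
  · exact n.zero_mem

theorem iota_mem {n : Ideal B} {hn : IsClosed (n : Set B)} {x : B} :
    iota x ∈ coefIdeal n hn ↔ x ∈ n := by
  constructor
  · intro h; have := h 0; rwa [coef_iota, if_pos rfl] at this
  · intro h k; rw [coef_iota]; split_ifs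
    · exact h
    · exact n.zero_mem

/-! characters -/
theorem char_le (χ : characterSpace ℂ B) (a : B) : ‖χ a‖ ≤ ‖a‖ := by
  by_contra! h
  have h0 : χ a ≠ 0 := fun h' => by rw [h', norm_zero] at h; exact absurd h (not_lt.2 (norm_nonneg _))
  have h1 : ‖(χ a)⁻¹ • a‖ < 1 := by
    rw [norm_smul, norm_inv, inv_mul_lt_iff₀ (norm_pos_iff.2 h0), mul_one]; exact h
  have h2 : IsUnit (1 - (χ a)⁻¹ • a) := isUnit_one_sub_of_norm_lt_one h1
  have h3 := h2.map χ
  rw [map_sub, map_one, map_smul, smul_eq_mul, inv_mul_cancel₀ h0, sub_self] at h3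
  exact not_isUnit_zero h3

/-- functional attached to a character and weights -/
def evw (χ : characterSpace ℂ B) (g : ℤ → ℂ) (hg : ∀ k, ‖g k‖ ≤ 1) : Lau B →L[ℂ] ℂ :=
  lift (fun k => g k • CharacterSpace.toCLM χ) 1 (fun k => by
    refine ContinuousLinearMap.opNorm_le_bound _ zero_le_one (fun x => ?_)
    rw [_root_.smul_apply, norm_smul, CharacterSpace.coe_toCLM]
    exact mul_le_mul (hg k) (char_le χ x) (norm_nonneg _) zero_le_one)

theorem evw_mono (χ : characterSpace ℂ B) (g : ℤ → ℂ) (hg : ∀ k, ‖g k‖ ≤ 1) (k : ℤ) (c : B) :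
    evw χ g hg (mono k c) = g k * χ c := by
  rw [evw, lift_mono]; rfl

theorem evw_le (χ : characterSpace ℂ B) (g : ℤ → ℂ) (hg : ∀ k, ‖g k‖ ≤ 1) (l : Lau B) :
    ‖evw χ g hg l‖ ≤ ‖l‖ := by
  have := (evw χ g hg).le_of_opNorm_le (norm_lift_le _ 1 _) l
  simpa using this

theorem evw_iota_mul (χ : characterSpace ℂ B) (g : ℤ → ℂ) (hg : ∀ k, ‖g k‖ ≤ 1) (c : B)
    (l : Lau B) : evw χ g hg (iota c * l) = χ c * evw χ g hg l := by
  have : (evw χ g hg).comp (ContinuousLinearMap.mul ℂ (Lau B) (iota c))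
      = χ c • evw χ g hg :=
    clm_ext fun m d => by
      simp only [ContinuousLinearMap.comp_apply, ContinuousLinearMap.mul_apply', iota_mul_mono,
        evw_mono, _root_.smul_apply, map_mul, smul_eq_mul]
      ring
  exact congrArg (fun f => f l) this

theorem evw_T_mul (χ : characterSpace ℂ B) (g : ℤ → ℂ) (hg : ∀ k, ‖g k‖ ≤ 1) (S : Set ℤ) (τ : ℂ)
    (hS : ∀ k ∈ S, g (1 + k) = τ * g k)
    (l : Lau B) : evw χ g hg (TT * mask S l) = τ * evw χ g hg (mask S l) := by
  have : ((evw χ g hg).comp (ContinuousLinearMap.mul ℂ (Lau B) TT)).comp (mask S)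
      = τ • (evw χ g hg).comp (mask S) :=
    clm_ext fun m d => by
      simp only [ContinuousLinearMap.comp_apply, mask_mono]
      split_ifs with h
      · simp only [ContinuousLinearMap.comp_apply, ContinuousLinearMap.mul_apply', TT, mono_mul,
          evw_mono, _root_.smul_apply, smul_eq_mul, mask_mono, if_pos h, hS m h,
          one_mul]
        ring
      · simp [mask_mono, h]
  exact congrArg (fun f => f l) this

/-- extension of a character -/
theorem exists_char_ext (χ : characterSpace ℂ B) (τ : ℂ) (hτ : ‖τ‖ = 1) :
    ∃ ψ : characterSpace ℂ (Lau B), (∀ c, ψ (iota c) = χ c) ∧ ψ TT = τ := by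
  have hτ0 : τ ≠ 0 := fun h => by simp [h] at hτ
  have hg : ∀ k : ℤ, ‖τ ^ k‖ ≤ 1 := fun k => by rw [norm_zpow, hτ, one_zpow]
  set e := evw χ (fun k => τ ^ k) hg with he
  have h1 : e 1 = 1 := by rw [one_def, he, evw_mono]; simp
  have hm : ∀ x y, e (x * y) = e x * e y := by
    have a1 : ∀ k c y, e (mono k c * y) = e (mono k c) * e y := fun k c y => by
      have : e.comp (ContinuousLinearMap.mul ℂ (Lau B) (mono k c)) = e (mono k c) • e :=
        clm_ext fun m d => by
          simp only [ContinuousLinearMap.comp_apply, ContinuousLinearMap.mul_apply', mono_mul,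
            _root_.smul_apply, smul_eq_mul, he, evw_mono, map_mul, zpow_add₀ hτ0]
          ring
      exact congrArg (fun f => f y) this
    intro x y
    have : e.comp ((ContinuousLinearMap.mul ℂ (Lau B)).flip y) = e y • e :=
      clm_ext fun m d => by
        simp only [ContinuousLinearMap.comp_apply, ContinuousLinearMap.flip_apply,
          ContinuousLinearMap.mul_apply', _root_.smul_apply, smul_eq_mul, a1]
        ring
    rw [mul_comm]
    have := congrArg (fun f => f x) this
    simpa [mul_comm] using this
  refine ⟨CharacterSpace.equivAlgHom.symm (AlgHom.ofLinearMap e.toLinearMap h1 hm), ?_, ?_⟩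
  · intro c
    change e (iota c) = _
    rw [iota_def, he, evw_mono]; simp
  · change e TT = _
    rw [TT, he, evw_mono]; simp

/-- comap of characters -/
def comapChar {C D : Type*} [NormedCommRing C] [NormedAlgebra ℂ C] [CompleteSpace C]
    [NormedCommRing D] [NormedAlgebra ℂ D] [CompleteSpace D] (f : C →ₐ[ℂ] D)
    (χ : characterSpace ℂ D) : characterSpace ℂ C :=
  CharacterSpace.equivAlgHom.symm ((CharacterSpace.equivAlgHom χ).comp f)

@[simp] theorem comapChar_apply {C D : Type*} [NormedCommRing C] [NormedAlgebra ℂ C]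
    [CompleteSpace C] [NormedCommRing D] [NormedAlgebra ℂ D] [CompleteSpace D] (f : C →ₐ[ℂ] D)
    (χ : characterSpace ℂ D) (x : C) : comapChar f χ x = χ (f x) := rfl

theorem continuous_char_iff {X : Type*} [TopologicalSpace X] {f : X → characterSpace ℂ B} :
    Continuous f ↔ ∀ b, Continuous fun x => f x b := by
  rw [continuous_induced_rng]
  constructor
  · intro h b; exact (WeakDual.eval_continuous b).comp h
  · intro h; exact WeakDual.continuous_of_continuous_eval h

theorem continuous_char_eval (b : B) : Continuous fun χ : characterSpace ℂ B => χ b :=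
  continuous_char_iff.1 continuous_id b

theorem continuous_comapChar {C D : Type*} [NormedCommRing C] [NormedAlgebra ℂ C]
    [CompleteSpace C] [NormedCommRing D] [NormedAlgebra ℂ D] [CompleteSpace D] (f : C →ₐ[ℂ] D) :
    Continuous (comapChar f) :=
  continuous_char_iff.2 fun b => continuous_char_eval (f b)

theorem mono_one (k : ℕ) : (mono (k : ℤ) 1 : Lau B) = TT ^ k := by
  induction k with
  | zero => rfl
  | succ k ih => rw [pow_succ, ← ih, TT, mono_mul]; simp

theorem TT_mul_inv : (TT : Lau B) * mono (-1) 1 = 1 := by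
  rw [TT, mono_mul, one_def]; simp

/-- `T` as a unit -/
def TU : (Lau B)ˣ := ⟨TT, mono (-1) 1, TT_mul_inv, by rw [mul_comm, TT_mul_inv]⟩

theorem mono_eq (k : ℤ) (c : B) : mono k c = iota c * ((TU ^ k : (Lau B)ˣ) : Lau B) := by
  have : ((TU ^ k : (Lau B)ˣ) : Lau B) = mono k 1 := by
    induction k using Int.induction_on with
    | zero => rfl
    | succ k ih => rw [zpow_add_one, Units.val_mul, ih]; change _ * mono 1 1 = _; rw [mono_mul, mul_one]
    | pred k ih => rw [zpow_sub_one, Units.val_mul, ih]; change _ * mono (-1) 1 = _; rw [mono_mul, mul_one]; rfl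
  rw [this, iota_mul_mono, mul_one]

theorem char_hasSum (ψ : characterSpace ℂ (Lau B)) (l : Lau B) :
    HasSum (fun k => ψ (iota (coef k l)) * (((Units.map (ψ : Lau B →* ℂ) TU) ^ k : ℂˣ) : ℂ)) (ψ l) := by
  have := (hasSum_mono l).mapL (CharacterSpace.toCLM ψ)
  simp only [CharacterSpace.coe_toCLM, mono_eq, map_mul] at this
  have h2 : ∀ k : ℤ, (((Units.map (ψ : Lau B →* ℂ) TU) ^ k : ℂˣ) : ℂ)
      = ψ ((TU ^ k : (Lau B)ˣ) : Lau B) := fun k => by rw [← map_zpow]; rfl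
  simp only [h2]
  exact this

theorem char_ext {ψ ψ' : characterSpace ℂ (Lau B)} (h : ∀ c, ψ (iota c) = ψ' (iota c))
    (hT : ψ TT = ψ' TT) : ψ = ψ' := by
  refine CharacterSpace.ext fun l => ?_
  have h1 := char_hasSum ψ l
  have h2 := char_hasSum ψ' l
  have : Units.map (ψ : Lau B →* ℂ) TU = Units.map (ψ' : Lau B →* ℂ) TU := Units.ext hT
  simp only [h, this] at h1
  exact h1.unique h2

theorem char_T_norm (ψ : characterSpace ℂ (Lau B)) : ‖ψ TT‖ = 1 := by
  have a1 : ∀ k c, ‖ψ (mono k c)‖ ≤ ‖c‖ := fun k c => (char_le ψ _).trans (norm_mono k c).le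
  have h : ∀ z : ℂ, ∀ C : ℝ, (∀ n : ℕ, ‖z‖ ^ n ≤ C) → ‖z‖ ≤ 1 := fun z C hC => by
    by_contra! hz
    obtain ⟨n, hn⟩ := pow_unbounded_of_one_lt C hz
    exact absurd (hC n) (not_le.2 hn)
  have h1 : ‖ψ TT‖ ≤ 1 := h _ ‖(1 : B)‖ fun n => by
    rw [← norm_pow, ← map_pow, ← mono_one]; exact a1 _ _
  have hm : ∀ n : ℕ, (mono (-1) 1 : Lau B) ^ n = mono (-n) 1 := fun n => by
    induction n with
    | zero => rfl
    | succ k ih => rw [pow_succ, ih, mono_mul, mul_one, show (-(k:ℤ) + -1) = -((k+1:ℕ):ℤ) by push_cast; ring]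
  have h2 : ‖ψ (mono (-1) 1)‖ ≤ 1 := h _ ‖(1 : B)‖ fun n => by
    rw [← norm_pow, ← map_pow, hm]; exact a1 _ _
  have h3 : ‖ψ TT‖ * ‖ψ (mono (-1) 1)‖ = 1 := by
    rw [← norm_mul, ← map_mul, TT_mul_inv, map_one, norm_one]
  nlinarith [norm_nonneg (ψ TT), norm_nonneg (ψ (mono (-1) 1))]

theorem char_kill {n : Ideal B} {hn : IsClosed (n : Set B)} {l : Lau B} (h : l ∈ coefIdeal n hn)
    (ψ : characterSpace ℂ (Lau B)) (hψ : ∀ x ∈ n, ψ (iota x) = 0) : ψ l = 0 := by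
  have h1 := char_hasSum ψ l
  simp only [fun k => hψ _ (h k), zero_mul] at h1
  exact h1.unique hasSum_zero

end lau
end
end Oka


open WeakDual
set_option linter.all false
set_option linter.deprecated false
set_option linter.unusedSectionVars false
namespace Oka
noncomputable section
section chars
variable {B : Type*} [NormedCommRing B] [NormedAlgebra ℂ B] [CompleteSpace B]

/-- hull of a set -/
def hull (Z : Set B) : Set (characterSpace ℂ B) := {χ | ∀ z ∈ Z, χ z = 0}

theorem isClosed_hull (Z : Set B) : IsClosed (hull Z) := by
  have : hull Z = ⋂ z ∈ Z, {χ : characterSpace ℂ B | χ z = 0} := by ext; simp [hull]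
  rw [this]
  exact isClosed_biInter fun z _ => isClosed_eq (continuous_char_eval z) continuous_const

theorem nullst {ι : Type*} [Fintype ι] (Z : Set B) (w : ι → B)
    (h : ∀ χ ∈ hull Z, ∃ i, χ (w i) ≠ 0) : ∃ y : ι → B, ∑ i, y i * w i - 1 ∈ Ideal.span Z := by
  have : Ideal.span Z ⊔ Ideal.span (Set.range w) = ⊤ := by
    by_contra hne
    obtain ⟨M, hM, hle⟩ := Ideal.exists_le_maximal _ hne
    have hk : ∀ a ∈ M, (Ideal.toCharacterSpace M) a = 0 := fun a ha =>
      Ideal.toCharacterSpace_apply_eq_zero_of_mem M ha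
    obtain ⟨i, hi⟩ := h (Ideal.toCharacterSpace M) fun z hz =>
      hk z (hle (Ideal.mem_sup_left (Ideal.subset_span hz)))
    exact hi (hk _ (hle (Ideal.mem_sup_right (Ideal.subset_span ⟨i, rfl⟩))))
  have h1 : (1 : B) ∈ Ideal.span Z ⊔ Ideal.span (Set.range w) := by rw [this]; trivial
  obtain ⟨a, ha, c, hc, hac⟩ := Submodule.mem_sup.1 h1
  obtain ⟨y, hy⟩ := Ideal.mem_span_range_iff_exists_fun.1 hc
  refine ⟨y, ?_⟩
  rw [hy, ← hac]
  have : c - (a + c) = -a := by ring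
  rw [this]; exact neg_mem ha

theorem char_span {Z : Set B} {χ : characterSpace ℂ B} (hχ : χ ∈ hull Z) {x : B}
    (hx : x ∈ Ideal.span Z) : χ x = 0 := by
  have : Ideal.span Z ≤ RingHom.ker (χ : B →+* ℂ) := Ideal.span_le.2 fun z hz => hχ z hz
  exact this hx

theorem char_closure {I : Ideal B} {χ : characterSpace ℂ B} (hχ : ∀ x ∈ I, χ x = 0) {x : B}
    (hx : x ∈ closure (I : Set B)) : χ x = 0 := by
  have : closure (I : Set B) ⊆ {x | χ x = 0} :=
    closure_minimal hχ (isClosed_eq (map_continuous χ) continuous_const)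
  exact this hx

variable {P : Type*} [TopologicalSpace P] [CompactSpace P] [T2Space P]

/-- constants -/
def constAlg : B →ₐ[ℂ] C(P, B) where
  toFun := ContinuousMap.const P
  map_one' := rfl
  map_mul' _ _ := rfl
  map_zero' := rfl
  map_add' _ _ := rfl
  commutes' _ := rfl

/-- evaluation -/
def evalAlg (p : P) : C(P, B) →ₐ[ℂ] B where
  toFun f := f p
  map_one' := rfl
  map_mul' _ _ := rfl
  map_zero' := rfl
  map_add' _ _ := rfl
  commutes' _ := rfl

/-- scalars -/
def scalAlg : C(P, ℂ) →ₐ[ℂ] C(P, B) :=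
  (Algebra.ofId ℂ B).compLeftContinuous ℂ (continuous_algebraMap ℂ B)

theorem scalAlg_apply (g : C(P, ℂ)) (p : P) : (scalAlg g : C(P, B)) p = algebraMap ℂ B (g p) := rfl

theorem exists_eval (ψ : characterSpace ℂ C(P, ℂ)) : ∃ p : P, ∀ g, ψ g = g p := by
  obtain ⟨p, hp⟩ := (CharacterSpace.continuousMapEval_bijective (X := P) (𝕜 := ℂ)).2 ψ
  exact ⟨p, fun g => by rw [← hp]; rfl⟩

theorem char_CP (ψ : characterSpace ℂ C(P, B)) :
    ∃ (p : P) (χ : characterSpace ℂ B), ∀ f, ψ f = χ (f p) := by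
  obtain ⟨p, hp⟩ := exists_eval (comapChar (scalAlg (B := B)) ψ)
  have key : ∀ f : C(P, B), f p = 0 → ψ f = 0 := by
    intro f hf
    rw [← norm_le_zero_iff]
    refine le_of_forall_pos_le_add fun ε hε => ?_
    rw [zero_add]
    have hU : IsOpen {q | ‖f q‖ < ε} := isOpen_lt (by fun_prop) continuous_const
    obtain ⟨g, hg0, hg1, hg⟩ := exists_continuous_zero_one_of_isClosed (s := {q | ‖f q‖ < ε}ᶜ)
      (t := {p}) hU.isClosed_compl isClosed_singleton (by
        rw [Set.disjoint_singleton_right]; simpa [hf] using hε)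
    set G : C(P, ℂ) := ⟨fun q => (g q : ℂ), by fun_prop⟩ with hG
    have h1 : ψ (scalAlg G) = 1 := by
      rw [← comapChar_apply, hp]; simp [hG, hg1 rfl]
    have h2 : ψ f = ψ (scalAlg G * f) := by rw [map_mul, h1, one_mul]
    rw [h2]
    refine (char_le ψ _).trans ((ContinuousMap.norm_le _ hε.le).2 fun q => ?_)
    rw [ContinuousMap.mul_apply, scalAlg_apply, ← Algebra.smul_def, norm_smul]
    have hgn : ‖G q‖ ≤ 1 := by
      simp only [hG, ContinuousMap.coe_mk, Complex.norm_real, Real.norm_eq_abs]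
      rw [abs_of_nonneg (hg q).1]; exact (hg q).2
    by_cases hq : ‖f q‖ < ε
    · nlinarith [norm_nonneg (G q), norm_nonneg (f q)]
    · have : G q = 0 := by simp [hG, hg0 (x := q) hq]
      rw [this]; simpa using hε.le
  refine ⟨p, comapChar constAlg ψ, fun f => ?_⟩
  have := key (f - constAlg (f p)) (by
    change f p - f p = 0; exact sub_self _)
  rw [map_sub, sub_eq_zero] at this
  exact this

end chars
end
end Oka


open WeakDual
set_option linter.all false
set_option linter.deprecated false
set_option linter.unusedSectionVars false
namespace Oka
noncomputable section
section absexp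
variable {R : Type*} [NormedRing R] [NormedAlgebra ℂ R] [CompleteSpace R]

theorem exp_sub_mem {V : Submodule ℂ R} (hC : IsClosed (V : Set R))
    (hl : ∀ x ∈ V, ∀ a, a * x ∈ V) (hr : ∀ x ∈ V, ∀ a, x * a ∈ V) {x y : R}
    (h : x - y ∈ V) : NormedSpace.exp x - NormedSpace.exp y ∈ V := by
  have h1 := (NormedSpace.exp_series_hasSum_exp' (𝕂 := ℂ) x).sub
    (NormedSpace.exp_series_hasSum_exp' (𝕂 := ℂ) y)
  refine hC.mem_of_tendsto h1 (Filter.Eventually.of_forall fun s => ?_)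
  refine Submodule.sum_mem _ fun n _ => ?_
  rw [← smul_sub]
  refine Submodule.smul_mem _ _ ?_
  clear * - hl hr h
  induction n with
  | zero => simp
  | succ n ih =>
    have : x ^ (n + 1) - y ^ (n + 1) = x ^ n * (x - y) + (x ^ n - y ^ n) * y := by
      rw [pow_succ, pow_succ]; noncomm_ring
    rw [this]
    exact Submodule.add_mem _ (hl _ h _) (hr _ ih _)

theorem exists_log {V : Submodule ℂ R} (hC : IsClosed (V : Set R))
    (hl : ∀ x ∈ V, ∀ a, a * x ∈ V) (hr : ∀ x ∈ V, ∀ a, x * a ∈ V)  :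
    ∀ᶠ x in nhds (0 : R), x ∈ V → ∃ m ∈ V, NormedSpace.exp m = 1 + x := by
  haveI : CompleteSpace V := hC.completeSpace_coe
  let f : V → V := fun m => ⟨NormedSpace.exp (m : R) - 1, by
    have := exp_sub_mem (x := (m : R)) (y := 0) hC hl hr (by rw [sub_zero]; exact m.2)
    rwa [NormedSpace.exp_zero] at this⟩
  have hf : HasStrictFDerivAt f ((ContinuousLinearEquiv.refl ℂ V : V ≃L[ℂ] V) : V →L[ℂ] V) 0 := by
    have h1 : HasStrictFDerivAt (fun m : V => NormedSpace.exp (m : R) - 1)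
        (V.subtypeL) 0 := by
      have h0 : HasStrictFDerivAt (NormedSpace.exp : R → _)
        (1 : R →L[ℂ] R) (V.subtypeL 0) := by
        rw [map_zero]; exact hasStrictFDerivAt_exp_zero
      exact (h0.comp (0 : V) V.subtypeL.hasStrictFDerivAt).sub_const 1
    rw [hasStrictFDerivAt_iff_isLittleO] at h1 ⊢
    rw [← Asymptotics.isLittleO_norm_left] at h1 ⊢
    exact h1
  have h0 : f 0 = 0 := by
    apply Subtype.ext; simp [f, NormedSpace.exp_zero]
  have hn := hf.map_nhds_eq_of_equiv
  rw [h0] at hn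
  have h2 : Set.range f ∈ nhds (0 : V) := by
    rw [← hn, Filter.mem_map]; simp
  rw [nhds_subtype_eq_comap, Filter.mem_comap] at h2
  obtain ⟨s, hs, hs'⟩ := h2
  filter_upwards [hs] with x hx hxC
  obtain ⟨m, hm⟩ := hs' (show (⟨x, hxC⟩ : V) ∈ _ from hx)
  refine ⟨m, m.2, ?_⟩
  have := congrArg Subtype.val hm
  change NormedSpace.exp (m : R) - 1 = x at this
  rw [← this]; abel

theorem isUnit_exp' (x : R) : IsUnit (NormedSpace.exp x) := by
  let +nondep : NormedAlgebra ℚ R := .restrictScalars ℚ ℂ _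
  exact NormedSpace.isUnit_exp x

theorem continuous_exp' : Continuous (NormedSpace.exp : R → R) := by
  let +nondep : NormedAlgebra ℚ R := .restrictScalars ℚ ℂ _
  exact NormedSpace.exp_continuous

theorem map_exp' {S : Type*} [NormedRing S] [NormedAlgebra ℂ S] [CompleteSpace S]
    (f : R →+* S) (hf : Continuous f) (x : R) :
    f (NormedSpace.exp x) = NormedSpace.exp (f x) := by
  let +nondep : NormedAlgebra ℚ R := .restrictScalars ℚ ℂ _
  let +nondep : NormedAlgebra ℚ S := .restrictScalars ℚ ℂ _
  exact NormedSpace.map_exp f hf x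
end absexp

section mats
/-- square matrices with the row-sum norm -/
def Mat (d B : Type*) := Matrix d d B

variable {B : Type*} [NormedCommRing B] [NormedAlgebra ℂ B] [CompleteSpace B]
  {d : Type*} [Fintype d] [DecidableEq d]

instance : NormedRing (Mat d B) := Matrix.linftyOpNormedRing
instance : NormedAlgebra ℂ (Mat d B) := Matrix.linftyOpNormedAlgebra

theorem Mat.mul_apply (M N : Mat d B) (i j : d) : (M * N) i j = ∑ k, M i k * N k j := rfl
theorem Mat.add_apply (M N : Mat d B) (i j : d) : (M + N) i j = M i j + N i j := rfl
theorem Mat.sub_apply (M N : Mat d B) (i j : d) : (M - N) i j = M i j - N i j := rfl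
theorem Mat.neg_apply (M : Mat d B) (i j : d) : (- M) i j = - M i j := rfl
theorem Mat.smul_apply (c : ℂ) (M : Mat d B) (i j : d) : (c • M) i j = c • M i j := rfl
theorem Mat.one_apply (i j : d) : (1 : Mat d B) i j = if i = j then 1 else 0 := rfl
theorem Mat.ext {M N : Mat d B} (h : ∀ i j, M i j = N i j) : M = N := funext fun i => funext (h i)

/-- matrix times vector -/
def mv (M : Mat d B) (v : d → B) : d → B := Matrix.mulVec M v

theorem mv_apply (M : Mat d B) (v : d → B) (i : d) : mv M v i = ∑ k, M i k * v k := rfl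
theorem mv_one (v : d → B) : mv 1 v = v := Matrix.one_mulVec v
theorem mv_mul (M N : Mat d B) (v : d → B) : mv (M * N) v = mv M (mv N v) :=
  (Matrix.mulVec_mulVec v M N).symm
theorem mv_add (M : Mat d B) (v w : d → B) : mv M (v + w) = mv M v + mv M w :=
  Matrix.mulVec_add M v w
theorem mv_sub (M : Mat d B) (v w : d → B) : mv M (v - w) = mv M v - mv M w :=
  Matrix.mulVec_sub M v w
theorem add_mv (M N : Mat d B) (v : d → B) : mv (M + N) v = mv M v + mv N v :=
  Matrix.add_mulVec M N v
theorem sub_mv (M N : Mat d B) (v : d → B) : mv (M - N) v = mv M v - mv N v :=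
  Matrix.sub_mulVec M N v

theorem entry_sum_le (M : Mat d B) (i : d) : ∑ j, ‖M i j‖ ≤ ‖M‖ := by
  have h0 : ‖M‖ = _ := Matrix.linfty_opNorm_def (M : Matrix d d B)
  rw [h0]
  have := Finset.le_sup (f := fun i => ∑ j, ‖M i j‖₊) (Finset.mem_univ i)
  have := NNReal.coe_le_coe.2 this
  simpa using this

theorem mat_norm_le (M : Mat d B) (r : ℝ) (hr : 0 ≤ r) (h : ∀ i, ∑ j, ‖M i j‖ ≤ r) :
    ‖M‖ ≤ r := by
  have h0 : ‖M‖ = _ := Matrix.linfty_opNorm_def (M : Matrix d d B)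
  rw [h0]
  lift r to NNReal using hr
  refine NNReal.coe_le_coe.2 (Finset.sup_le fun i _ => ?_)
  rw [← NNReal.coe_le_coe]; simpa using h i

theorem norm_entry_le (M : Mat d B) (i j : d) : ‖M i j‖ ≤ ‖M‖ :=
  (Finset.single_le_sum (f := fun j => ‖M i j‖) (fun _ _ => norm_nonneg _) (Finset.mem_univ j)).trans
    (entry_sum_le M i)

theorem mv_norm_le (M : Mat d B) (v : d → B) (i : d) : ‖mv M v i‖ ≤ ‖M‖ * ‖v‖ := by
  refine (norm_le_pi_norm (mv M v) i).trans ?_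
  letI := @Matrix.linftyOpNormedRing d B _ _ _
  exact Matrix.linfty_opNorm_mulVec M v

/-- matrices as functions of two indices, homeomorphically -/
def matE : Mat d B ≃L[ℂ] (d → d → B) :=
  LinearEquiv.toContinuousLinearEquivOfBounds
    { toFun := fun M i j => M i j
      invFun := fun f => (Matrix.of f : Matrix d d B)
      left_inv := fun _ => rfl
      right_inv := fun _ => rfl
      map_add' := fun _ _ => rfl
      map_smul' := fun _ _ => rfl } 1 (Fintype.card d)
    (fun M => by
      rw [one_mul]
      refine (pi_norm_le_iff_of_nonneg (norm_nonneg _)).2 fun i =>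
        (pi_norm_le_iff_of_nonneg (norm_nonneg _)).2 fun j => norm_entry_le M i j)
    (fun f => by
      refine mat_norm_le _ _ (by positivity) fun i => ?_
      refine (Finset.sum_le_sum (g := fun _ => ‖f‖) fun j _ => ?_).trans (by simp)
      exact (norm_le_pi_norm (f i) j).trans (norm_le_pi_norm f i))

instance : CompleteSpace (Mat d B) :=
  (completeSpace_congr (e := (matE (d := d) (B := B)).toEquiv) (matE (d := d) (B := B)).isUniformEmbedding).2 inferInstance

theorem continuous_entry (i j : d) : Continuous fun M : Mat d B => M i j :=
  (continuous_apply j).comp ((continuous_apply i).comp (matE (d := d) (B := B)).continuous)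

theorem continuous_mat {X : Type*} [TopologicalSpace X] {f : X → Mat d B}
    (h : ∀ i j, Continuous fun x => f x i j) : Continuous f := by
  have : Continuous fun x => matE (f x) := continuous_pi fun i => continuous_pi fun j => h i j
  exact (matE (d := d) (B := B)).symm.continuous.comp this

theorem continuous_mv (i : d) : Continuous fun p : Mat d B × (d → B) => mv p.1 p.2 i := by
  simp only [mv_apply]
  exact continuous_finset_sum _ fun k _ => ((continuous_entry i k).comp continuous_fst).mul
    ((continuous_apply k).comp continuous_snd)

/-- matrices with entries in an ideal -/
def MM (C : Ideal B) : Submodule ℂ (Mat d B) where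
  carrier := {M | ∀ i j, M i j ∈ C}
  zero_mem' := fun i j => C.zero_mem
  add_mem' := fun hx hy i j => C.add_mem (hx i j) (hy i j)
  smul_mem' := fun c x hx i j => by
    rw [Mat.smul_apply, Algebra.smul_def]; exact C.mul_mem_left _ (hx i j)

theorem mem_MM {C : Ideal B} {M : Mat d B} : M ∈ MM C ↔ ∀ i j, M i j ∈ C := Iff.rfl

theorem MM_mul_left {C : Ideal B} (M : Mat d B) (hM : M ∈ MM C) (N : Mat d B) :
    N * M ∈ MM C := fun i j => by
  rw [Mat.mul_apply]; exact C.sum_mem fun k _ => C.mul_mem_left _ (hM k j)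

theorem MM_mul_right {C : Ideal B} (M : Mat d B) (hM : M ∈ MM C) (N : Mat d B) :
    M * N ∈ MM C := fun i j => by
  rw [Mat.mul_apply]; exact C.sum_mem fun k _ => C.mul_mem_right _ (hM i k)

theorem MM_mv {C : Ideal B} {M : Mat d B} (hM : M ∈ MM C) (v : d → B) (i : d) :
    (mv M v) i ∈ C := C.sum_mem fun k _ => C.mul_mem_right _ (hM i k)

theorem mv_mem {C : Ideal B} (M : Mat d B) {v : d → B} (hv : ∀ i, v i ∈ C) (i : d) :
    (mv M v) i ∈ C := C.sum_mem fun k _ => C.mul_mem_left _ (hv k)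

theorem isClosed_MM {C : Ideal B} (hC : IsClosed (C : Set B)) :
    IsClosed ((MM C : Submodule ℂ (Mat d B)) : Set (Mat d B)) := by
  have : ((MM C : Submodule ℂ (Mat d B)) : Set (Mat d B))
      = ⋂ i, ⋂ j, (fun M : Mat d B => M i j) ⁻¹' (C : Set B) := by
    ext M; simp [mem_MM]
  rw [this]
  exact isClosed_iInter fun i => isClosed_iInter fun j => hC.preimage (continuous_entry i j)

/-- entrywise algebra map -/
def mapM {B' : Type*} [NormedCommRing B'] [NormedAlgebra ℂ B'] [CompleteSpace B'] (f : B →ₐ[ℂ] B') :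
    Mat d B →ₐ[ℂ] Mat d B' := f.mapMatrix

theorem mapM_apply {B' : Type*} [NormedCommRing B'] [NormedAlgebra ℂ B'] [CompleteSpace B'] (f : B →ₐ[ℂ] B')
    (M : Mat d B) (i j : d) : mapM f M i j = f (M i j) := rfl

theorem mapM_mv {B' : Type*} [NormedCommRing B'] [NormedAlgebra ℂ B'] [CompleteSpace B'] (f : B →ₐ[ℂ] B')
    (M : Mat d B) (v : d → B) (i : d) : mv (mapM f M) (fun i => f (v i)) i = f (mv M v i) := by
  rw [mv_apply, mv_apply, map_sum]
  simp only [mapM_apply, map_mul]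

theorem continuous_mapM {B' : Type*} [NormedCommRing B'] [NormedAlgebra ℂ B'] [CompleteSpace B'] (f : B →ₐ[ℂ] B')
    (hf : Continuous f) : Continuous (mapM f : Mat d B → Mat d B') :=
  continuous_mat fun i j => by
    simp only [mapM_apply]; exact hf.comp (continuous_entry i j)

end mats
end
end Oka


open WeakDual
set_option linter.all false
set_option linter.deprecated false
set_option linter.unusedSectionVars false
namespace Oka
noncomputable section
section glue
variable {B : Type*} [NormedCommRing B] [NormedAlgebra ℂ B] [CompleteSpace B]
  {d : Type*} [Fintype d] [DecidableEq d]

/-- relations for the circle piece -/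
def ZZ (Z : Set B) (b : Bˣ) : Set (Lau B) := iota '' Z ∪ {TT - iota (b : B)}

/-- product ideal -/
def IJ (n : Ideal B) (hn : IsClosed (n : Set B)) (Z : Set B) (b : Bˣ) : Ideal (Lau B) :=
  Ideal.span (ZZ Z b) * coefIdeal n hn

/-- its closure -/
def CC (n : Ideal B) (hn : IsClosed (n : Set B)) (Z : Set B) (b : Bˣ) : Ideal (Lau B) :=
  (IJ n hn Z b).closure

variable {n : Ideal B} {hn : IsClosed (n : Set B)} {Z : Set B} {b : Bˣ}

theorem isClosed_CC : IsClosed (CC n hn Z b : Set (Lau B)) := by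
  rw [CC, Ideal.coe_closure]; exact isClosed_closure

theorem IJ_le_CC : IJ n hn Z b ≤ CC n hn Z b := fun x hx => by
  have : x ∈ (CC n hn Z b : Set (Lau B)) := by
    rw [CC, Ideal.coe_closure]; exact subset_closure hx
  exact this

theorem IJ_le_J : IJ n hn Z b ≤ coefIdeal n hn := Ideal.mul_le_right

theorem CC_le_J : CC n hn Z b ≤ coefIdeal n hn := fun x hx => by
  have hx' : x ∈ (CC n hn Z b : Set (Lau B)) := hx
  rw [CC, Ideal.coe_closure] at hx'
  exact closure_minimal (fun y hy => IJ_le_J hy) (isClosed_coefIdeal n hn) hx'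

theorem MM_mono {C D : Ideal B} (h : C ≤ D) {M : Mat d B} (hM : M ∈ MM C) : M ∈ MM D :=
  fun i j => h (hM i j)

theorem TU_zpow_sub (k : ℤ) : ((TU ^ k : (Lau B)ˣ) : Lau B) - iota ((b ^ k : Bˣ) : B)
    ∈ Ideal.span (ZZ Z b) := by
  have h1 : (TT : Lau B) - iota (b : B) ∈ Ideal.span (ZZ Z b) :=
    Ideal.subset_span (Or.inr rfl)
  set q := Ideal.Quotient.mk (Ideal.span (ZZ Z b))
  have h2 : Units.map (q : Lau B →* Lau B ⧸ Ideal.span (ZZ Z b)) TU = Units.map (q : Lau B →* Lau B ⧸ Ideal.span (ZZ Z b))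
      (Units.map ((iota : B →ₐ[ℂ] Lau B) : B →* Lau B) b) := by
    ext; exact Ideal.Quotient.eq.2 h1
  have h3 := congrArg (fun u => ((u ^ k : _ˣ) : Lau B ⧸ Ideal.span (ZZ Z b))) h2
  simp only [← map_zpow] at h3
  exact Ideal.Quotient.eq.1 h3

theorem trunc {m : Lau B} (hm : m ∈ coefIdeal n hn) {ε : ℝ} (hε : 0 < ε) :
    ∃ m' ∈ n, ∃ l, ‖m - l‖ < ε ∧ l - iota m' ∈ IJ n hn Z b := by
  have h := hasSum_mono m
  have h1 := (Metric.tendsto_nhds.1 h ε hε).exists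
  obtain ⟨s, hs⟩ := h1
  rw [dist_comm, dist_eq_norm] at hs
  refine ⟨∑ k ∈ s, coef k m * ((b ^ k : Bˣ) : B), n.sum_mem fun k _ => n.mul_mem_right _ (hm k),
    _, hs, ?_⟩
  rw [map_sum, ← Finset.sum_sub_distrib]
  refine Ideal.sum_mem _ fun k _ => ?_
  rw [mono_eq, map_mul, ← mul_sub, mul_comm]
  exact Ideal.mul_mem_mul (TU_zpow_sub k) (iota_mem.2 (hm k))

theorem truncM {m : Mat d (Lau B)} (hm : m ∈ MM (coefIdeal n hn)) :
    m ∈ closure {l : Mat d (Lau B) | ∃ m' ∈ MM n, l - mapM iota m' ∈ MM (CC n hn Z b)} := by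
  rw [Metric.mem_closure_iff]
  intro ε hε
  have hc : 0 < ε / (Fintype.card d + 1) := by positivity
  choose m' hm' l hl hl' using fun i j => trunc (Z := Z) (b := b) (hm i j) hc
  obtain ⟨L, hL⟩ : ∃ L : Mat d (Lau B), ∀ i j, L i j = l i j := ⟨fun i j => l i j, fun _ _ => rfl⟩
  refine ⟨L, ⟨fun i j => m' i j, fun i j => hm' i j,
    fun i j => IJ_le_CC (by rw [Mat.sub_apply, hL]; exact hl' i j)⟩, ?_⟩
  rw [dist_eq_norm]
  have h2 : ‖m - L‖
      ≤ Fintype.card d * (ε / (Fintype.card d + 1)) := by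
    refine mat_norm_le _ _ (by positivity) fun i => ?_
    refine (Finset.sum_le_sum (g := fun _ => ε / (Fintype.card d + 1)) fun j _ => ?_).trans (by simp)
    rw [Mat.sub_apply, hL]; exact (hl i j).le
  refine h2.trans_lt ?_
  rw [mul_div_assoc', div_lt_iff₀ (by positivity)]
  nlinarith

/-- approximable matrices -/
def HH (n : Ideal B) (hn : IsClosed (n : Set B)) (Z : Set B) (b : Bˣ) (d : Type*) [Fintype d]
    [DecidableEq d] : Set (Mat d (Lau B)) :=
  {g | ∃ h : Mat d B, IsUnit h ∧ h - 1 ∈ MM n ∧ g - mapM iota h ∈ MM (CC n hn Z b)}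

theorem HH_mul {g g' : Mat d (Lau B)} (h : g ∈ HH n hn Z b d) (h' : g' ∈ HH n hn Z b d) :
    g * g' ∈ HH n hn Z b d := by
  obtain ⟨a, ha, ha1, ha2⟩ := h
  obtain ⟨a', ha', ha1', ha2'⟩ := h'
  refine ⟨a * a', ha.mul ha', ?_, ?_⟩
  · have : a * a' - 1 = a * (a' - 1) + (a - 1) := by noncomm_ring
    rw [this]; exact Submodule.add_mem _ (MM_mul_left _ ha1' _) ha1
  · have : g * g' - mapM iota (a * a')
        = g * (g' - mapM iota a') + (g - mapM iota a) * mapM iota a' := by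
      rw [map_mul]; noncomm_ring
    rw [this]; exact Submodule.add_mem _ (MM_mul_left _ ha2' _) (MM_mul_right _ ha2 _)

theorem HH_sub {g : Mat d (Lau B)} (h : g ∈ HH n hn Z b d) : g - 1 ∈ MM (coefIdeal n hn) := by
  obtain ⟨a, ha, ha1, ha2⟩ := h
  have : g - 1 = (g - mapM iota a) + mapM iota (a - 1) := by
    rw [map_sub, map_one]; noncomm_ring
  rw [this]
  exact Submodule.add_mem _ (MM_mono CC_le_J ha2) fun i j => iota_mem.2 (ha1 i j)

/-- invertible limits -/
def App (n : Ideal B) (hn : IsClosed (n : Set B)) (Z : Set B) (b : Bˣ) (d : Type*) [Fintype d]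
    [DecidableEq d] (g : Mat d (Lau B)) : Prop := IsUnit g ∧ g ∈ closure (HH n hn Z b d)

theorem App_mul {g g' : Mat d (Lau B)} (h : App n hn Z b d g) (h' : App n hn Z b d g') :
    App n hn Z b d (g * g') :=
  ⟨h.1.mul h'.1, map_mem_closure₂ continuous_mul h.2 h'.2 fun _ ha _ hb => HH_mul ha hb⟩

theorem App_exp {m : Mat d (Lau B)} (hm : m ∈ MM (coefIdeal n hn)) :
    App n hn Z b d (NormedSpace.exp m) := by
  refine ⟨isUnit_exp' m, ?_⟩
  refine map_mem_closure continuous_exp' (truncM (Z := Z) (b := b) hm) ?_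
  rintro l ⟨m', hm', hl⟩
  refine ⟨NormedSpace.exp m', isUnit_exp' _, ?_, ?_⟩
  · have := exp_sub_mem (x := m') (y := 0) (isClosed_MM hn) MM_mul_left MM_mul_right
      (by rwa [sub_zero])
    rwa [NormedSpace.exp_zero] at this
  · have h2 : mapM iota (NormedSpace.exp m') = NormedSpace.exp (mapM iota m' : Mat d (Lau B)) :=
      map_exp' (mapM iota : Mat d B →ₐ[ℂ] Mat d (Lau B)).toRingHom
        (continuous_mapM iota continuous_iota) m'
    rw [h2]
    exact exp_sub_mem (isClosed_MM isClosed_CC) MM_mul_left MM_mul_right hl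

theorem App_small : ∀ᶠ x in nhds (0 : Mat d (Lau B)), x ∈ MM (coefIdeal n hn) →
    App n hn Z b d (1 + x) := by
  filter_upwards [exists_log (isClosed_MM (d := d) (isClosed_coefIdeal n hn)) MM_mul_left
    MM_mul_right] with x hx hxJ
  obtain ⟨m, hm, h⟩ := hx hxJ
  rw [← h]; exact App_exp hm

/-- rank one matrix -/
def r1 (w y : d → B) : Mat d B := fun i j => w i * y j

theorem r1_mv (w y v : d → B) (i : d) : mv (r1 w y) v i = w i * ∑ j, y j * v j := by
  rw [mv_apply, Finset.mul_sum]
  exact Finset.sum_congr rfl fun j _ => mul_assoc _ _ _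

theorem continuous_r1 {X : Type*} [TopologicalSpace X] {f g : X → d → B} (hf : Continuous f)
    (hg : Continuous g) : Continuous fun x => r1 (f x) (g x) :=
  continuous_mat fun i j => ((continuous_apply i).comp hf).mul ((continuous_apply j).comp hg)

theorem path_app (w : ℝ → d → Lau B) (hw : Continuous w)
    (hJ : ∀ s t i, w s i - w t i ∈ coefIdeal n hn)
    (hnv : ∀ t ∈ Set.Icc (0 : ℝ) 1, ∀ χ ∈ hull (ZZ Z b), ∃ i, χ (w t i) ≠ 0) :
    ∃ g, App n hn Z b d g ∧ ∀ i, mv g (w 0) i - w 1 i ∈ CC n hn Z b := by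
  refine (isPreconnected_Icc (a := (0 : ℝ)) (b := 1)).induction₂'
    (fun s t => ∃ g, App n hn Z b d g ∧ ∀ i, mv g (w s) i - w t i ∈ CC n hn Z b) ?_ ?_
    (by simp) (by simp)
  · intro t ht
    refine nhdsWithin_le_nhds ?_
    obtain ⟨y, hy⟩ := nullst (ZZ Z b) (w t) (hnv t ht)
    have key : ∀ (s s' : ℝ) (y : d → Lau B), (∑ i, y i * w s i - 1 ∈ Ideal.span (ZZ Z b)) →
        App n hn Z b d (1 + r1 (w s' - w s) y) →
        ∃ g, App n hn Z b d g ∧ ∀ i, mv g (w s) i - w s' i ∈ CC n hn Z b := by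
      intro s s' y hy hA
      refine ⟨_, hA, fun i => IJ_le_CC ?_⟩
      rw [add_mv, mv_one, Pi.add_apply, r1_mv]
      have : w s i + (w s' - w s) i * ∑ j, y j * w s j - w s' i
          = (∑ j, y j * w s j - 1) * (w s' i - w s i) := by
        rw [Pi.sub_apply]; ring
      rw [this]
      exact Ideal.mul_mem_mul hy (hJ _ _ _)
    have hr1 : ∀ s s' y, r1 (w s' - w s) y ∈ MM (coefIdeal n hn) := fun s s' y i j =>
      Ideal.mul_mem_right _ _ (hJ _ _ _)
    -- the unit near t
    set u : ℝ → Lau B := fun s => 1 + ∑ i, y i * (w s i - w t i) with hu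
    have huc : Continuous u := by
      refine continuous_const.add (continuous_finset_sum _ fun i _ => continuous_const.mul
        (((continuous_apply i).comp hw).sub continuous_const))
    have hut : u t = 1 := by simp [hu]
    have hinv : ContinuousAt (fun s => Ring.inverse (u s)) t := by
      have h0 : ContinuousAt Ring.inverse (u t) := by
        rw [hut]; exact NormedRing.inverse_continuousAt (1 : (Lau B)ˣ)
      exact ContinuousAt.comp h0 huc.continuousAt
    have hunit : ∀ᶠ s in nhds t, IsUnit (u s) := by
      have : {x : Lau B | IsUnit x} ∈ nhds (u t) := by
        rw [hut]; exact Units.isOpen.mem_nhds isUnit_one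
      exact huc.continuousAt this
    have hlim1 : Filter.Tendsto (fun s => r1 (w s - w t) y) (nhds t) (nhds 0) := by
      have : Continuous fun s => r1 (w s - w t) y :=
        continuous_r1 (hw.sub continuous_const) continuous_const
      have h0 := this.tendsto t
      have h1 : r1 (w t - w t) y = 0 := Mat.ext fun i j => by simp [r1]; rfl
      rwa [h1] at h0
    have hlim2 : Filter.Tendsto (fun s => r1 (w t - w s) (fun j => Ring.inverse (u s) * y j))
        (nhds t) (nhds 0) := by
      have : ContinuousAt (fun s => r1 (w t - w s) (fun j => Ring.inverse (u s) * y j)) t := by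
        have hc : Continuous fun p : ℝ × Lau B => r1 (w t - w p.1) (fun j => p.2 * y j) :=
          continuous_r1 (continuous_const.sub (hw.comp continuous_fst))
            (continuous_pi fun j => continuous_snd.mul continuous_const)
        exact ContinuousAt.comp (f := fun s => (s, Ring.inverse (u s)))
          (g := fun p : ℝ × Lau B => r1 (w t - w p.1) (fun j => p.2 * y j)) hc.continuousAt
          (continuousAt_id.prodMk hinv)
      have h0 := this.tendsto
      have h1 : r1 (w t - w t) (fun j => Ring.inverse (u t) * y j) = 0 :=
        Mat.ext fun i j => by simp [r1]; rfl
      rwa [h1] at h0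
    filter_upwards [hunit, hlim1.eventually (App_small (n := n) (hn := hn) (Z := Z) (b := b)),
      hlim2.eventually (App_small (n := n) (hn := hn) (Z := Z) (b := b))] with s hs h1 h2
    refine ⟨key t s y hy (h1 (hr1 _ _ _)), key s t _ ?_ (h2 (hr1 _ _ _))⟩
    have e1 : ∑ i, (fun j => Ring.inverse (u s) * y j) i * w s i
        = Ring.inverse (u s) * ((∑ i, y i * w t i - 1) + u s) := by
      have : (∑ i, y i * w t i - 1) + u s = ∑ i, y i * w s i := by
        simp only [hu, mul_sub, Finset.sum_sub_distrib]; ring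
      rw [this, Finset.mul_sum]
      exact Finset.sum_congr rfl fun j _ => mul_assoc _ _ _
    rw [e1, mul_add, Ring.inverse_mul_cancel _ hs, add_sub_cancel_right]
    exact Ideal.mul_mem_left _ _ hy
  · rintro s t r _ _ _ ⟨g, hg, h⟩ ⟨g', hg', h'⟩
    refine ⟨g' * g, App_mul hg' hg, fun i => ?_⟩
    have : mv (g' * g) (w s) i - w r i = mv g' (mv g (w s) - w t) i + (mv g' (w t) i - w r i) := by
      rw [mv_mul, mv_sub, Pi.sub_apply]; ring
    rw [this]
    exact Ideal.add_mem _ (mv_mem _ h i) (h' i)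

theorem path_glue (w : ℝ → d → Lau B) (hw : Continuous w)
    (hJ : ∀ s t i, w s i - w t i ∈ coefIdeal n hn)
    (hnv : ∀ t ∈ Set.Icc (0 : ℝ) 1, ∀ χ ∈ hull (ZZ Z b), ∃ i, χ (w t i) ≠ 0)
    (v1 v2 : d → B) (h1 : w 0 = fun i => iota (v1 i)) (h2 : w 1 = fun i => iota (v2 i))
    {δ : ℝ} (hδ : 0 < δ) :
    ∃ h : Mat d B, IsUnit h ∧ h - 1 ∈ MM n ∧ ∃ ε ∈ MM (coefIdeal n hn), ‖ε‖ < δ ∧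
      ∀ i, mv (1 + ε) (fun j => iota (mv h v1 j)) i - iota (v2 i) ∈ CC n hn Z b := by
  obtain ⟨g, ⟨hg1, hg2⟩, hg⟩ := path_app (n := n) (hn := hn) w hw hJ hnv
  have hc : ContinuousAt (fun x : Mat d (Lau B) => g * Ring.inverse x - 1) g := by
    obtain ⟨gu, rfl⟩ := hg1
    exact (continuousAt_const.mul (NormedRing.inverse_continuousAt gu)).sub continuousAt_const
  have hz : g * Ring.inverse g - 1 = 0 := by rw [Ring.mul_inverse_cancel _ hg1, sub_self]
  have hc' : Filter.Tendsto (fun x : Mat d (Lau B) => ‖g * Ring.inverse x - 1‖) (nhds g) (nhds 0) := by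
    have := hc.tendsto.norm
    simp only [hz, norm_zero] at this
    exact this
  have hev : ∀ᶠ x in nhds g, IsUnit x ∧ ‖g * Ring.inverse x - 1‖ < δ :=
    (Filter.Eventually.and (Units.isOpen.mem_nhds hg1) (hc'.eventually (gt_mem_nhds hδ)))
  obtain ⟨x, hxH, hxu, hxδ⟩ := ((mem_closure_iff_frequently.1 hg2).and_eventually hev).exists
  have hx1 := HH_sub hxH
  obtain ⟨h, hh, hh1, hh2⟩ := hxH
  have hgJ : g - 1 ∈ MM (coefIdeal n hn) := by
    have hcl : IsClosed {x : Mat d (Lau B) | x - 1 ∈ (MM (coefIdeal n hn) : Submodule ℂ (Mat d (Lau B)))} :=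
      (isClosed_MM (isClosed_coefIdeal n hn)).preimage (continuous_id.sub continuous_const)
    exact closure_minimal (fun y hy => HH_sub hy) hcl hg2
  refine ⟨h, hh, hh1, g * Ring.inverse x - 1, ?_, hxδ, fun i => ?_⟩
  · have : g * Ring.inverse x - 1 = ((g - 1) - (x - 1)) * Ring.inverse x := by
      have h0 := Ring.mul_inverse_cancel _ hxu
      rw [sub_sub_sub_cancel_right, sub_mul, h0]
    rw [this]; exact MM_mul_right _ (Submodule.sub_mem _ hgJ hx1) _
  · have e1 : (1 : Mat d (Lau B)) + (g * Ring.inverse x - 1) = g * Ring.inverse x := by abel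
    have e2 : (fun j => iota (mv h v1 j)) = mv (mapM iota h) (w 0) := by
      rw [h1]; funext j; exact (mapM_mv iota h v1 j).symm
    have e3 : mv (g * Ring.inverse x) (mv (mapM iota h) (w 0)) i - iota (v2 i)
        = (mv g (w 0) i - w 1 i) - mv (g * Ring.inverse x) (mv (x - mapM iota h) (w 0)) i := by
      have h0 := Ring.inverse_mul_cancel _ hxu
      have : g = g * Ring.inverse x * x := by rw [mul_assoc, h0, mul_one]
      rw [sub_mv, mv_sub, Pi.sub_apply, ← mv_mul _ x, ← this, h2]; ring
    rw [e1, e2, e3]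
    exact Ideal.sub_mem _ (hg i) (mv_mem _ (MM_mv hh2 _) i)

end glue
end
end Oka


open WeakDual
set_option linter.all false
set_option linter.deprecated false
set_option linter.unusedSectionVars false
namespace Oka
noncomputable section
section wh
variable {B : Type*} [NormedCommRing B] [NormedAlgebra ℂ B] [CompleteSpace B]
  {d : Type*} [Fintype d] [DecidableEq d]
variable {n : Ideal B} {hn : IsClosed (n : Set B)} {Z : Set B} {b : Bˣ}

/-- entrywise mask -/
def maskM (S : Set ℤ) (M : Mat d (Lau B)) : Mat d (Lau B) := fun i j => mask S (M i j)

theorem maskM_apply (S : Set ℤ) (M : Mat d (Lau B)) (i j : d) : maskM S M i j = mask S (M i j) := rfl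

theorem maskM_sub (S : Set ℤ) (M N : Mat d (Lau B)) : maskM S (M - N) = maskM S M - maskM S N :=
  Mat.ext fun i j => by
    rw [maskM_apply, Mat.sub_apply, Mat.sub_apply, map_sub]; rfl

theorem norm_maskM_le (S : Set ℤ) (M : Mat d (Lau B)) : ‖maskM S M‖ ≤ ‖M‖ :=
  mat_norm_le _ _ (norm_nonneg _) fun i =>
    (Finset.sum_le_sum fun j _ => norm_mask_le S (M i j)).trans (entry_sum_le M i)

theorem mask_add_mask (l : Lau B) : mask {k | 0 ≤ k} l + mask {k | k < 0} l = l :=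
  lau_ext fun k => by
    rw [map_add, coef_mask, coef_mask]
    by_cases h : 0 ≤ k
    · simp [h, not_lt.2 h]
    · simp [h, not_le.1 h]

theorem mask_mask (S T : Set ℤ) (h : S ⊆ T) (l : Lau B) : mask T (mask S l) = mask S l :=
  lau_ext fun k => by
    simp only [coef_mask]
    by_cases hk : k ∈ S
    · simp [hk, h hk]
    · simp [hk]

theorem wiener_hopf (ε : Mat d (Lau B)) (hε : ε ∈ MM (coefIdeal n hn)) (hlt : ‖ε‖ < 1 / 4) :
    ∃ α ∈ MM (coefIdeal n hn), ∃ β ∈ MM (coefIdeal n hn), (1 + α) * (1 + ε) = 1 + β ∧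
      ‖α‖ ≤ 1 / 3 ∧ ‖β‖ ≤ 1 / 3 ∧ maskM {k | k ≤ 0} α = α ∧ maskM {k | 0 ≤ k} β = β := by
  set f : Mat d (Lau B) → Mat d (Lau B) := fun α => - maskM {k | k < 0} (ε + α * ε) with hf
  have hK : ContractingWith (1 / 4) f := by
    refine ⟨by norm_num, LipschitzWith.of_dist_le_mul fun x y => ?_⟩
    rw [dist_eq_norm, dist_eq_norm]
    have : f x - f y = maskM {k | k < 0} ((y - x) * ε) := by
      simp only [hf]
      rw [neg_sub_neg, ← maskM_sub]; congr 1; noncomm_ring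
    rw [this]
    refine (norm_maskM_le _ _).trans ((norm_mul_le _ _).trans ?_)
    rw [norm_sub_rev y x]
    have h0 := norm_nonneg (x - y)
    push_cast
    nlinarith
  set α := hK.fixedPoint f with hα
  have hfix : f α = α := hK.fixedPoint_isFixedPt
  have hJ : ∀ x : Mat d (Lau B), x ∈ MM (coefIdeal n hn) → ∀ S, maskM S x ∈ MM (coefIdeal n hn) :=
    fun x hx S i j => mask_mem (hx i j) S
  have hαJ : α ∈ MM (coefIdeal n hn) := by
    refine (isClosed_MM (isClosed_coefIdeal n hn)).mem_of_tendsto (hK.tendsto_iterate_fixedPoint 0)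
      (Filter.Eventually.of_forall fun k => ?_)
    induction k with
    | zero => exact Submodule.zero_mem _
    | succ k ih =>
      rw [Function.iterate_succ_apply']
      exact Submodule.neg_mem _ (hJ _ (Submodule.add_mem _ hε (MM_mul_left _ hε _)) _)
  have hn1 : ‖ε + α * ε‖ ≤ (1 + ‖α‖) * (1 / 4) := by
    refine (norm_add_le _ _).trans ?_
    have := norm_mul_le α ε
    have h0 := norm_nonneg α
    nlinarith
  have hα1 : ‖α‖ ≤ 1 / 3 := by
    have : ‖α‖ ≤ (1 + ‖α‖) * (1 / 4) := by
      calc ‖α‖ = ‖f α‖ := by rw [hfix]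
        _ = ‖maskM {k | k < 0} (ε + α * ε)‖ := by simp only [hf, norm_neg]
        _ ≤ _ := (norm_maskM_le _ _).trans hn1
    linarith
  refine ⟨α, hαJ, maskM {k | 0 ≤ k} (ε + α * ε), hJ _ (Submodule.add_mem _ hε (MM_mul_left _ hε _)) _,
    ?_, hα1, ?_, ?_, ?_⟩
  · have h1 : (ε + α * ε) = maskM {k | 0 ≤ k} (ε + α * ε) + maskM {k | k < 0} (ε + α * ε) :=
      Mat.ext fun i j => (mask_add_mask _).symm
    have h2 : maskM {k | k < 0} (ε + α * ε) = - α := by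
      rw [eq_neg_iff_add_eq_zero, ← neg_eq_iff_add_eq_zero]; exact hfix
    rw [h2] at h1
    have : (1 + α) * (1 + ε) = 1 + α + (ε + α * ε) := by noncomm_ring
    have h3 := (eq_add_neg_iff_add_eq.1 h1).symm
    rw [this, h3]; abel
  · refine (norm_maskM_le _ _).trans (hn1.trans ?_)
    linarith
  · rw [← hfix]
    refine Mat.ext fun i j => ?_
    simp only [hf]
    rw [maskM_apply, Mat.neg_apply, map_neg, maskM_apply, mask_mask]
    intro k (hk : k < 0); exact hk.le
  · refine Mat.ext fun i j => ?_
    rw [maskM_apply, maskM_apply, mask_mask _ _ subset_rfl]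

/-- nonnegative weights -/
def gp (τ : ℂ) (k : ℤ) : ℂ := if 0 ≤ k then τ ^ k else 0
/-- nonpositive weights -/
def gm (τ : ℂ) (k : ℤ) : ℂ := if k ≤ 0 then τ ^ k else 0

theorem gp_le {τ : ℂ} (h : ‖τ‖ ≤ 1) (k : ℤ) : ‖gp τ k‖ ≤ 1 := by
  unfold gp
  split_ifs with hk
  · lift k to ℕ using hk
    rw [zpow_natCast, norm_pow]; exact pow_le_one₀ (norm_nonneg _) h
  · simp

theorem gm_le {τ : ℂ} (h : 1 ≤ ‖τ‖) (k : ℤ) : ‖gm τ k‖ ≤ 1 := by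
  unfold gm
  split_ifs with hk
  · obtain ⟨m, rfl⟩ := Int.exists_eq_neg_ofNat hk
    rw [zpow_neg, zpow_natCast, norm_inv, norm_pow]
    exact inv_le_one_of_one_le₀ (one_le_pow₀ h)
  · simp

theorem char_unit_ne (χ : characterSpace ℂ B) (b : Bˣ) : χ (b : B) ≠ 0 := by
  intro h
  have : χ ((b : B) * ((b⁻¹ : Bˣ) : B)) = 1 := by rw [Units.mul_inv, map_one]
  rw [map_mul, h, zero_mul] at this
  exact zero_ne_one this

theorem evw_iota (χ : characterSpace ℂ B) (g : ℤ → ℂ) (hg : ∀ k, ‖g k‖ ≤ 1) (h0 : g 0 = 1) (c : B) :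
    evw χ g hg (iota c) = χ c := by rw [iota_def, evw_mono, h0, one_mul]

/-- decomposition predicate -/
def Dec (n : Ideal B) (hn : IsClosed (n : Set B)) (Z : Set B) (b : Bˣ) (e : Lau B) : Prop :=
  ∃ e' ∈ coefIdeal n hn, ∃ e'' ∈ coefIdeal n hn, e = e' + e'' ∧
    mask {k | 0 ≤ k} e' = e' ∧ mask {k | k ≤ 0} e'' = e'' ∧
    (∀ χ ∈ hull Z, ∀ h : ‖χ (b : B)‖ ≤ 1, evw χ (gp (χ b)) (gp_le h) e' = 0) ∧
    (∀ χ ∈ hull Z, ∀ h : 1 ≤ ‖χ (b : B)‖, evw χ (gm (χ b)) (gm_le h) e'' = 0)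

theorem Dec_add {e f : Lau B} (he : Dec n hn Z b e) (hf : Dec n hn Z b f) : Dec n hn Z b (e + f) := by
  obtain ⟨e1, h1, e2, h2, rfl, h3, h4, h5, h6⟩ := he
  obtain ⟨f1, k1, f2, k2, rfl, k3, k4, k5, k6⟩ := hf
  refine ⟨e1 + f1, Ideal.add_mem _ h1 k1, e2 + f2, Ideal.add_mem _ h2 k2, by ring, ?_, ?_, ?_, ?_⟩
  · rw [map_add, h3, k3]
  · rw [map_add, h4, k4]
  · intro χ hχ h; rw [map_add, h5 χ hχ h, k5 χ hχ h, add_zero]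
  · intro χ hχ h; rw [map_add, h6 χ hχ h, k6 χ hχ h, add_zero]

theorem mask_T_mul (l : Lau B) (S S' : Set ℤ) (h : ∀ k, k - 1 ∈ S → k ∈ S') :
    mask S' (TT * mask S l) = TT * mask S l := lau_ext fun k => by
  rw [coef_mask, TT, coef_mono_mul, coef_mask]
  by_cases h1 : k - 1 ∈ S
  · simp [h1, h k h1]
  · simp [h1]

theorem Dec_IJ {e : Lau B} (he : e ∈ IJ n hn Z b) : Dec n hn Z b e := by
  refine Submodule.mul_induction_on he ?_ (fun x y => Dec_add)
  intro i hi
  refine Submodule.span_induction (p := fun i _ => ∀ j ∈ coefIdeal n hn, Dec n hn Z b (i * j))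
    ?_ ?_ ?_ ?_ hi
  · rintro z (⟨z, hz, rfl⟩ | hz) j hj
    · refine ⟨iota z * mask {k | 0 ≤ k} j, Ideal.mul_mem_left _ _ (mask_mem hj _),
        iota z * mask {k | k < 0} j, Ideal.mul_mem_left _ _ (mask_mem hj _), ?_, ?_, ?_, ?_, ?_⟩
      · rw [← mul_add, mask_add_mask]
      · rw [mask_iota_mul, mask_mask _ _ subset_rfl]
      · rw [mask_iota_mul, mask_mask]
        intro k (hk : k < 0); exact hk.le
      · intro χ hχ h; rw [evw_iota_mul, hχ z hz, zero_mul]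
      · intro χ hχ h; rw [evw_iota_mul, hχ z hz, zero_mul]
    · rw [Set.mem_singleton_iff] at hz
      subst hz
      refine ⟨(TT - iota (b : B)) * mask {k | 0 ≤ k} j, Ideal.mul_mem_left _ _ (mask_mem hj _),
        (TT - iota (b : B)) * mask {k | k < 0} j, Ideal.mul_mem_left _ _ (mask_mem hj _),
        ?_, ?_, ?_, ?_, ?_⟩
      · rw [← mul_add, mask_add_mask]
      · rw [sub_mul, map_sub, mask_iota_mul, mask_mask _ _ subset_rfl, mask_T_mul]
        intro k (hk : 0 ≤ k - 1); show 0 ≤ k; omega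
      · rw [sub_mul, map_sub, mask_iota_mul, mask_mask, mask_T_mul]
        · intro k (hk : k - 1 < 0); show k ≤ 0; omega
        · intro k (hk : k < 0); exact hk.le
      · intro χ hχ h
        rw [sub_mul, map_sub, evw_iota_mul, evw_T_mul _ _ _ _ (χ (b : B)), sub_self]
        intro k (hk : 0 ≤ k)
        rw [gp, gp, if_pos hk, if_pos (by omega), zpow_one_add₀ (char_unit_ne χ b)]
      · intro χ hχ h
        rw [sub_mul, map_sub, evw_iota_mul, evw_T_mul _ _ _ _ (χ (b : B)), sub_self]
        intro k (hk : k < 0)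
        rw [gm, gm, if_pos hk.le, if_pos (by omega), zpow_one_add₀ (char_unit_ne χ b)]
  · intro j hj
    rw [zero_mul]
    exact ⟨0, Ideal.zero_mem _, 0, Ideal.zero_mem _, by simp, by simp, by simp, by simp, by simp⟩
  · intro x y _ _ hx hy j hj
    rw [add_mul]; exact Dec_add (hx j hj) (hy j hj)
  · intro a x _ hx j hj
    rw [smul_eq_mul, mul_comm a x, mul_assoc]
    exact hx _ (Ideal.mul_mem_left _ _ hj)

theorem lower (K : Set (characterSpace ℂ B)) (hK : IsClosed K) (x : d → B)
    (h : ∀ χ ∈ K, ∃ i, χ (x i) ≠ 0) : ∃ c > 0, ∀ χ ∈ K, c ≤ ‖fun i => χ (x i)‖ := by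
  rcases K.eq_empty_or_nonempty with rfl | hne
  · exact ⟨1, one_pos, by simp⟩
  have hc : Continuous fun χ : characterSpace ℂ B => ‖fun i => χ (x i)‖ :=
    (continuous_pi fun i => continuous_char_eval (x i)).norm
  obtain ⟨χ, hχ, hmin⟩ := hK.isCompact.exists_isMinOn hne hc.continuousOn
  refine ⟨_, ?_, fun χ' h' => hmin h'⟩
  obtain ⟨i, hi⟩ := h χ hχ
  exact norm_pos_iff.2 fun h0 => hi (congrFun h0 i)

theorem perturb (χ : characterSpace ℂ B) (g : ℤ → ℂ) (hg : ∀ k, ‖g k‖ ≤ 1) (h0 : g 0 = 1)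
    (M : Mat d (Lau B)) (hM : ‖M‖ ≤ 1 / 3) (x : d → B) :
    2 / 3 * ‖fun i => χ (x i)‖ ≤ ‖fun i => evw χ g hg (mv (1 + M) (fun j => iota (x j)) i)‖ := by
  set z := fun i => evw χ g hg (mv (1 + M) (fun j => iota (x j)) i) with hz
  have h1 : ∀ i, z i = χ (x i) + ∑ j, χ (x j) * evw χ g hg (M i j) := by
    intro i
    simp only [hz]
    rw [add_mv, mv_one, Pi.add_apply, map_add, evw_iota _ _ _ h0, mv_apply, map_sum]
    congr 1
    exact Finset.sum_congr rfl fun j _ => by rw [mul_comm, evw_iota_mul]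
  have h2 : ‖fun i => χ (x i)‖ ≤ ‖z‖ + 1 / 3 * ‖fun i => χ (x i)‖ := by
    refine (pi_norm_le_iff_of_nonneg (by positivity)).2 fun i => ?_
    have h3 : χ (x i) = z i - ∑ j, χ (x j) * evw χ g hg (M i j) := by rw [h1]; ring
    rw [h3]
    refine (norm_sub_le _ _).trans (add_le_add (norm_le_pi_norm z i) ?_)
    refine (norm_sum_le _ _).trans ?_
    have : ∀ j ∈ Finset.univ, ‖χ (x j) * evw χ g hg (M i j)‖ ≤ ‖M i j‖ * ‖fun i => χ (x i)‖ := by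
      intro j _
      rw [norm_mul, mul_comm]
      exact mul_le_mul (evw_le _ _ _ _) (norm_le_pi_norm (fun i => χ (x i)) j) (norm_nonneg _)
        (norm_nonneg _)
    refine (Finset.sum_le_sum this).trans ?_
    rw [← Finset.sum_mul]
    exact mul_le_mul_of_nonneg_right ((entry_sum_le M i).trans hM) (norm_nonneg _)
  linarith

theorem mask_mv (S : Set ℤ) (h0 : (0 : ℤ) ∈ S) (M : Mat d (Lau B)) (hM : maskM S M = M) (x : d → B) (i : d) :
    mask S (mv (1 + M) (fun j => iota (x j)) i) = mv (1 + M) (fun j => iota (x j)) i := by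
  rw [add_mv, mv_one, Pi.add_apply, map_add, mv_apply, map_sum]
  congr 1
  · rw [iota_def, mask_mono, if_pos h0]
  · refine Finset.sum_congr rfl fun j _ => ?_
    rw [mul_comm, mask_iota_mul]
    have := congrFun (congrFun hM i) j
    rw [maskM_apply] at this
    rw [this]

theorem eq_iota (v : Lau B) (h1 : mask {k | 0 ≤ k} v = v) (h2 : mask {k | k ≤ 0} v = v) :
    v = iota (coef 0 v) := lau_ext fun k => by
  rw [coef_iota]
  split_ifs with hk
  · rw [hk]
  · by_cases h : 0 ≤ k
    · rw [← h2, coef_mask, if_neg]; show ¬ k ≤ 0; omega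
    · rw [← h1, coef_mask, if_neg]; exact h

theorem gluing (w : ℝ → d → Lau B) (hw : Continuous w)
    (hJ : ∀ s t i, w s i - w t i ∈ coefIdeal n hn)
    (hnv : ∀ t ∈ Set.Icc (0 : ℝ) 1, ∀ χ ∈ hull (ZZ Z b), ∃ i, χ (w t i) ≠ 0)
    (v1 v2 : d → B) (h1 : w 0 = fun i => iota (v1 i)) (h2 : w 1 = fun i => iota (v2 i)) (ρ : ℝ)
    (hv1 : ∀ χ ∈ hull Z, ‖χ (b : B)‖ ≤ 1 → ∃ i, χ (v1 i) ≠ 0)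
    (hv2 : ∀ χ ∈ hull Z, 1 ≤ ‖χ (b : B)‖ → ‖χ (b : B)‖ ≤ ρ → ∃ i, χ (v2 i) ≠ 0) :
    ∃ v : d → B, (∀ i, v i - v1 i ∈ n) ∧ ∀ χ ∈ hull Z, ‖χ (b : B)‖ ≤ ρ → ∃ i, χ (v i) ≠ 0 := by
  obtain ⟨h, hu, hh, ε, hε, hε4, hCC⟩ := path_glue (n := n) (hn := hn) w hw hJ hnv v1 v2 h1 h2
    (δ := 1 / 4) (by norm_num)
  obtain ⟨α, hα, β, hβ, hαβ, hα3, hβ3, hαm, hβm⟩ := wiener_hopf ε hε hε4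
  set x := mv h v1 with hx
  set p := mv (1 + β) (fun j => iota (x j)) with hp
  set q := mv (1 + α) (fun j => iota (v2 j)) with hq
  have hqp : ∀ i, q i - p i ∈ CC n hn Z b := by
    intro i
    have : q i - p i = - mv (1 + α) (mv (1 + ε) (fun j => iota (x j)) - fun j => iota (v2 j)) i := by
      rw [mv_sub, ← mv_mul, hαβ, Pi.sub_apply]; ring
    rw [this]
    exact neg_mem (mv_mem _ hCC i)
  -- compact pieces
  have hbc : Continuous fun χ : characterSpace ℂ B => ‖χ (b : B)‖ := (continuous_char_eval _).norm
  obtain ⟨c1, hc1, hlow1⟩ := lower (hull Z ∩ {χ | ‖χ (b : B)‖ ≤ 1})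
    ((isClosed_hull Z).inter (isClosed_le hbc continuous_const)) x (by
      rintro χ ⟨hχ, hχ1⟩
      by_contra hcon
      push Not at hcon
      obtain ⟨i, hi⟩ := hv1 χ hχ hχ1
      obtain ⟨hu, rfl⟩ := hu
      have e : v1 = mv ((hu⁻¹ : (Mat d B)ˣ) : Mat d B) x := by
        rw [hx, ← mv_mul, Units.inv_mul, mv_one]
      apply hi
      rw [e, mv_apply, map_sum]
      exact Finset.sum_eq_zero fun j _ => by rw [map_mul, hcon j, mul_zero])
  obtain ⟨c2, hc2, hlow2⟩ := lower (hull Z ∩ {χ | 1 ≤ ‖χ (b : B)‖} ∩ {χ | ‖χ (b : B)‖ ≤ ρ})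
    (((isClosed_hull Z).inter (isClosed_le continuous_const hbc)).inter
      (isClosed_le hbc continuous_const)) v2 (fun χ hχ => hv2 χ hχ.1.1 hχ.1.2 hχ.2)
  set c := min c1 c2 / 2 with hc
  have hc0 : 0 < c := by positivity
  have happ : ∀ i, ∃ e ∈ IJ n hn Z b, ‖(q i - p i) - e‖ < c := by
    intro i
    have : q i - p i ∈ (CC n hn Z b : Set (Lau B)) := hqp i
    rw [CC, Ideal.coe_closure, Metric.mem_closure_iff] at this
    obtain ⟨e, he, hd⟩ := this c hc0
    exact ⟨e, he, by rwa [dist_eq_norm] at hd⟩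
  choose e he hec using happ
  choose e1 he1 e2 he2 hee hm1 hm2 hev1 hev2 using fun i => Dec_IJ (he i)
  set η : d → Lau B := fun i => (q i - p i) - e i with hη
  have hηJ : ∀ i, η i ∈ coefIdeal n hn := fun i =>
    Ideal.sub_mem _ (CC_le_J (hqp i)) (IJ_le_J (he i))
  set v : d → Lau B := fun i => p i + e1 i + mask {k | 0 ≤ k} (η i) with hv
  have hv' : ∀ i, v i = q i - e2 i - mask {k | k < 0} (η i) := by
    intro i
    have h1 := mask_add_mask (η i)
    have h2 : mask {k | 0 ≤ k} (η i) = η i - mask {k | k < 0} (η i) := eq_sub_of_add_eq h1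
    simp only [hv, h2]
    have h3 : η i = q i - p i - (e1 i + e2 i) := by rw [← hee i]
    linear_combination h3
  have hvp : ∀ i, mask {k | 0 ≤ k} (v i) = v i := by
    intro i
    simp only [hv]
    rw [map_add, map_add, hm1, mask_mask _ _ subset_rfl, hp, mask_mv _ (by simp) _ hβm]
  have hvm : ∀ i, mask {k | k ≤ 0} (v i) = v i := by
    intro i
    rw [hv', map_sub, map_sub, hm2, mask_mask, hq, mask_mv _ (by simp) _ hαm]
    intro k (hk : k < 0); exact hk.le
  have hvi : ∀ i, v i = iota (coef 0 (v i)) := fun i => eq_iota _ (hvp i) (hvm i)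
  refine ⟨fun i => coef 0 (v i), fun i => ?_, fun χ hχ hρ => ?_⟩
  · rw [← iota_mem (hn := hn), map_sub, ← hvi]
    have : v i - iota (v1 i) = (mv β (fun j => iota (x j)) i + iota (x i - v1 i))
        + e1 i + mask {k | 0 ≤ k} (η i) := by
      simp only [hv, hp]; rw [add_mv, mv_one, Pi.add_apply, map_sub iota]; ring
    rw [this]
    refine Ideal.add_mem _ (Ideal.add_mem _ (Ideal.add_mem _ (MM_mv hβ _ i) ?_) (he1 i))
      (mask_mem (hηJ i) _)
    rw [iota_mem]
    have : x i - v1 i = mv (h - 1) v1 i := by rw [sub_mv, mv_one]; rfl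
    rw [this]; exact MM_mv hh _ i
  · by_contra hcon
    push Not at hcon
    have hz : ∀ (g : ℤ → ℂ) (hg : ∀ k, ‖g k‖ ≤ 1) (h0 : g 0 = 1) (i : d), evw χ g hg (v i) = 0 := by
      intro g hg h0 i
      rw [hvi, evw_iota _ _ _ h0]; exact hcon i
    have fin : ∀ (g : ℤ → ℂ) (hg : ∀ k, ‖g k‖ ≤ 1) (y : d → Lau B) (c' : ℝ), 0 < c' → c ≤ c' / 2 →
        2 / 3 * c' ≤ ‖fun i => evw χ g hg (y i)‖ → 
        (∀ i, ∃ m : Lau B, ‖m‖ < c ∧ evw χ g hg (y i) = evw χ g hg m) → False := by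
      intro g hg y c' hc' hcc hle hm
      have : ‖fun i => evw χ g hg (y i)‖ ≤ c := by
        refine (pi_norm_le_iff_of_nonneg hc0.le).2 fun i => ?_
        obtain ⟨m, hm1, hm2⟩ := hm i
        rw [hm2]; exact (evw_le _ _ _ _).trans hm1.le
      linarith
    rcases le_total ‖χ (b : B)‖ 1 with hb | hb
    · have hl := hlow1 χ ⟨hχ, hb⟩
      have h0 : gp (χ (b : B)) 0 = 1 := by simp [gp]
      have := perturb χ _ (gp_le hb) h0 β hβ3 x
      refine fin _ (gp_le hb) p c1 hc1 (by rw [hc]; gcongr; exact min_le_left _ _) (by linarith) fun i =>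
        ⟨- mask {k | 0 ≤ k} (η i), ?_, ?_⟩
      · rw [norm_neg]; exact (norm_mask_le _ _).trans_lt (hec i)
      · have h3 := hz _ (gp_le hb) h0 i
        simp only [hv] at h3
        rw [map_add, map_add, hev1 i χ hχ hb] at h3
        rw [map_neg]; linear_combination h3
    · have hl := hlow2 χ ⟨⟨hχ, hb⟩, hρ⟩
      have h0 : gm (χ (b : B)) 0 = 1 := by simp [gm]
      have := perturb χ _ (gm_le hb) h0 α hα3 v2
      refine fin _ (gm_le hb) q c2 hc2 (by rw [hc]; gcongr; exact min_le_right _ _) (by linarith) fun i =>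
        ⟨mask {k | k < 0} (η i), (norm_mask_le _ _).trans_lt (hec i), ?_⟩
      have h3 := hz _ (gm_le hb) h0 i
      rw [hv', map_sub, map_sub, hev2 i χ hχ hb] at h3
      linear_combination h3

end wh
end
end Oka


open WeakDual
set_option linter.all false
set_option linter.deprecated false
set_option linter.unusedSectionVars false
namespace Oka
noncomputable section
universe uP uB
open unitInterval

/-- the relative part -/
def NN {P : Type*} (Q : Set P) : Set (P × I) := {y | y.1 ∈ Q ∨ y.2 = 0}

/-- the induction data -/
structure GD (P : Type uP) [TopologicalSpace P] [CompactSpace P] [T2Space P] (Q : Set P)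
    (B : Type uB) [NormedCommRing B] [NormedAlgebra ℂ B] [CompleteSpace B] (bs : List Bˣ) where
  κ : C(P × I, ℂ) →ₐ[ℂ] B
  hκ : Continuous κ
  n : Ideal B
  hn : IsClosed (n : Set B)
  Z : Set B
  h1 : ∀ φ : C(P × I, ℂ), (∀ y ∈ NN Q, φ y = 0) → κ φ ∈ n
  h2 : ∀ χ ∈ hull Z, ∀ χ' ∈ hull Z, (∀ φ, χ (κ φ) = χ' (κ φ)) →
    (∀ b ∈ bs, ‖χ (b : B)‖ = ‖χ' (b : B)‖) → χ = χ'
  h3 : ∀ χ ∈ hull Z, ∀ y : P × I, ∃ χ' ∈ hull Z, (∀ φ, χ' (κ φ) = φ y) ∧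
    ∀ b ∈ bs, ‖χ' (b : B)‖ = ‖χ (b : B)‖
  h4 : ∀ χ ∈ hull Z, ∀ y ∈ NN Q, (∀ φ, χ (κ φ) = φ y) → ∀ m ∈ n, χ m = 0

section main
variable {P : Type uP} [TopologicalSpace P] [CompactSpace P] [T2Space P] {Q : Set P}
    {B : Type uB} [NormedCommRing B] [NormedAlgebra ℂ B] [CompleteSpace B] {bs : List Bˣ}
    {d : Type} [Fintype d] [DecidableEq d]

/-- nonvanishing over the relative part -/
def GD.Rel (G : GD P Q B bs) (u : d → B) : Prop :=
  ∀ χ ∈ hull G.Z, ∀ y ∈ NN Q, (∀ φ, χ (G.κ φ) = φ y) → ∃ i, χ (u i) ≠ 0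

/-- the lifting conclusion -/
def GD.Good (G : GD P Q B bs) (d : Type) [Fintype d] : Prop :=
  ∀ u : d → B, G.Rel u → ∃ v : d → B, (∀ i, v i - u i ∈ G.n) ∧ ∀ χ ∈ hull G.Z, ∃ i, χ (v i) ≠ 0

theorem GD.exists_pt (G : GD P Q B bs) (χ : characterSpace ℂ B) : ∃ y, ∀ φ, χ (G.κ φ) = φ y :=
  exists_eval (comapChar G.κ χ)

theorem exists_cont_ext (hQ : IsClosed Q) (u : C(P × I, d → ℂ)) (hu : ∀ y ∈ NN Q, u y ≠ 0) :
    ∃ w : C(P × I, d → ℂ), (∀ y, w y ≠ 0) ∧ ∀ y ∈ NN Q, w y = u y := by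
  have hcl : IsClosed (Prod.fst '' {y : P × I | u y = 0}) :=
    isClosedMap_fst_of_compactSpace _ (isClosed_eq u.continuous continuous_const)
  obtain ⟨f, hf0, hf1, hf⟩ := exists_continuous_zero_one_of_isClosed hcl hQ (by
    rw [Set.disjoint_left]
    rintro _ ⟨⟨p, s⟩, hy, rfl⟩ hp
    exact hu (p, s) (Or.inl hp) hy)
  let g : C(P × I, P × I) := ⟨fun y => (y.1, y.2 * ⟨f y.1, hf y.1⟩), by fun_prop⟩
  refine ⟨u.comp g, fun y hy => ?_, fun y hy => ?_⟩
  · by_cases hD : y.1 ∈ Prod.fst '' {y : P × I | u y = 0}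
    · have : g y = (y.1, 0) := by
        refine Prod.ext rfl (Subtype.ext ?_)
        have h0 := hf0 hD
        simp [g, h0]
      rw [ContinuousMap.comp_apply, this] at hy
      exact hu _ (Or.inr rfl) hy
    · exact hD ⟨g y, hy, rfl⟩
  · rw [ContinuousMap.comp_apply]
    congr 1
    rcases hy with hy | hy
    · refine Prod.ext rfl (Subtype.ext ?_)
      have h0 := hf1 hy
      simp [g, h0]
    · refine Prod.ext rfl (Subtype.ext ?_)
      simp [g, hy]

theorem isClosed_NN (hQ : IsClosed Q) : IsClosed (NN Q) :=
  (hQ.preimage continuous_fst).union (isClosed_eq continuous_snd continuous_const)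

theorem base_good (hQ : IsClosed Q) (G : GD P Q B []) : G.Good d := by
  intro u hu
  rcases (hull G.Z).eq_empty_or_nonempty with he | ⟨χ0, hχ0⟩
  · exact ⟨u, fun i => by rw [sub_self]; exact G.n.zero_mem, by simp [he]⟩
  -- the homeomorphism
  let π : hull G.Z → P × I := fun χ => (CharacterSpace.homeoEval (P × I) ℂ).symm (comapChar G.κ χ.1)
  have hπc : Continuous π := (Homeomorph.continuous _).comp
    ((continuous_comapChar G.κ).comp continuous_subtype_val)
  have hπ : ∀ χ : hull G.Z, ∀ φ, χ.1 (G.κ φ) = φ (π χ) := by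
    intro χ φ
    have := (CharacterSpace.homeoEval (P × I) ℂ).apply_symm_apply (comapChar G.κ χ.1)
    rw [← comapChar_apply, ← this]
    rfl
  have hsep : ∀ y y' : P × I, (∀ φ : C(P × I, ℂ), φ y = φ y') → y = y' := by
    intro y y' h
    apply (CharacterSpace.homeoEval (P × I) ℂ).injective
    ext φ; exact h φ
  have hbij : Function.Bijective π := by
    constructor
    · intro χ χ' h
      exact Subtype.ext (G.h2 _ χ.2 _ χ'.2 (fun φ => by rw [hπ, hπ, h]) (by simp))
    · intro y
      obtain ⟨χ', h, h', _⟩ := G.h3 χ0 hχ0 y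
      exact ⟨⟨χ', h⟩, hsep _ _ fun φ => by rw [← hπ, h']⟩
  haveI : CompactSpace (hull G.Z) := isCompact_iff_compactSpace.1 (isClosed_hull G.Z).isCompact
  let e : hull G.Z ≃ₜ P × I := Continuous.homeoOfEquivCompactToT2 (f := Equiv.ofBijective π hbij) hπc
  have he : ∀ χ, e χ = π χ := fun χ => rfl
  let û : C(P × I, d → ℂ) := ⟨fun y i => (e.symm y).1 (u i), by
    refine continuous_pi fun i => (continuous_char_eval (u i)).comp
      (continuous_subtype_val.comp e.symm.continuous)⟩
  have hû : ∀ χ : hull G.Z, ∀ i, χ.1 (u i) = û (π χ) i := by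
    intro χ i
    change _ = (e.symm (e χ)).1 (u i)
    rw [e.symm_apply_apply]
  have hûN : ∀ y ∈ NN Q, û y ≠ 0 := by
    intro y hy h0
    obtain ⟨i, hi⟩ := hu (e.symm y).1 (e.symm y).2 y hy (fun φ => by
      rw [hπ, ← he, e.apply_symm_apply])
    exact hi (congrFun h0 i)
  obtain ⟨w, hw0, hwN⟩ := exists_cont_ext hQ û hûN
  have hU : IsOpen {y | ‖û y - w y‖ < ‖w y‖} := isOpen_lt (by fun_prop) (by fun_prop)
  obtain ⟨f, hf0, hf1, hf⟩ := exists_continuous_zero_one_of_isClosed hU.isClosed_compl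
    (isClosed_NN hQ) (by
      rw [Set.disjoint_right]
      intro y hy hy'
      apply hy'
      show ‖û y - w y‖ < ‖w y‖
      rw [hwN y hy, sub_self, norm_zero]
      exact norm_pos_iff.2 (hûN y hy))
  let F : C(P × I, ℂ) := ⟨fun y => (f y : ℂ), by fun_prop⟩
  let W : d → C(P × I, ℂ) := fun i => ⟨fun y => w y i, by fun_prop⟩
  refine ⟨fun i => G.κ (W i) + G.κ F * (u i - G.κ (W i)), fun i => ?_, fun χ hχ => ?_⟩
  · have : G.κ (W i) + G.κ F * (u i - G.κ (W i)) - u i = G.κ (F - 1) * (u i - G.κ (W i)) := by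
      rw [map_sub, map_one]; ring
    rw [this]
    refine G.n.mul_mem_right _ (G.h1 _ fun y hy => ?_)
    have := hf1 hy
    simp only [ContinuousMap.sub_apply, F, ContinuousMap.coe_mk, ContinuousMap.one_apply, this]
    simp
  · by_contra hcon
    push Not at hcon
    set y := π ⟨χ, hχ⟩ with hy
    have h1 : ∀ i, w y i + (f y : ℂ) * (û y i - w y i) = 0 := by
      intro i
      have h2 := hcon i
      rw [map_add, map_mul, map_sub, hπ ⟨χ, hχ⟩, hπ ⟨χ, hχ⟩, hû ⟨χ, hχ⟩] at h2
      exact h2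
    have h3 : w y = - ((f y : ℂ) • (û y - w y)) := by
      funext i
      have := h1 i
      simp only [Pi.neg_apply, Pi.smul_apply, Pi.sub_apply, smul_eq_mul]
      linear_combination this
    have h4 : ‖w y‖ = f y * ‖û y - w y‖ := by
      conv_lhs => rw [h3]
      rw [norm_neg, norm_smul, Complex.norm_real, Real.norm_eq_abs, abs_of_nonneg (hf y).1]
    have h5 : 0 < ‖w y‖ := norm_pos_iff.2 (hw0 y)
    by_cases hyU : y ∈ {y | ‖û y - w y‖ < ‖w y‖}
    · have h6 : ‖û y - w y‖ < ‖w y‖ := hyU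
      have := (hf y).2
      nlinarith [norm_nonneg (û y - w y)]
    · have : f y = 0 := hf0 hyU
      rw [this, zero_mul] at h4
      exact h5.ne' h4

/-- circle operation -/
def GD.lau {b : Bˣ} (G : GD P Q B (b :: bs)) :
    GD P Q (Lau B) (bs.map (Units.map ((iota : B →ₐ[ℂ] Lau B) : B →* Lau B))) where
  κ := iota.comp G.κ
  hκ := continuous_iota.comp G.hκ
  n := coefIdeal G.n G.hn
  hn := isClosed_coefIdeal _ _
  Z := ZZ G.Z b
  h1 φ hφ := iota_mem.2 (G.h1 φ hφ)
  h2 := by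
    intro χ hχ χ' hχ' hk hb
    have hh : ∀ χ ∈ hull (ZZ G.Z b), comapChar iota χ ∈ hull G.Z ∧ χ (iota (b : B)) = χ TT := by
      intro χ hχ
      refine ⟨fun z hz => hχ _ (Or.inl ⟨z, hz, rfl⟩), ?_⟩
      have := hχ _ (Or.inr rfl)
      rw [map_sub, sub_eq_zero] at this
      exact this.symm
    have := G.h2 _ (hh χ hχ).1 _ (hh χ' hχ').1 hk (by
      intro b' hb'
      rcases List.mem_cons.1 hb' with rfl | hb'
      · rw [comapChar_apply, comapChar_apply, (hh χ hχ).2, (hh χ' hχ').2, char_T_norm, char_T_norm]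
      · exact hb _ (List.mem_map.2 ⟨b', hb', rfl⟩))
    have h2 : ∀ c, χ (iota c) = χ' (iota c) := fun c => by
      rw [← comapChar_apply, this, comapChar_apply]
    exact char_ext h2 (by rw [← (hh χ hχ).2, h2, (hh χ' hχ').2])
  h3 := by
    intro χ hχ y
    obtain ⟨χ', hχ', h, hb⟩ := G.h3 (comapChar iota χ) (fun z hz => hχ _ (Or.inl ⟨z, hz, rfl⟩)) y
    have hT : ‖χ' (b : B)‖ = 1 := by
      rw [hb b (by simp), comapChar_apply]
      have := hχ _ (Or.inr rfl)
      rw [map_sub, sub_eq_zero] at this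
      rw [← this, char_T_norm]
    obtain ⟨ψ, hψ, hψT⟩ := exists_char_ext χ' _ hT
    refine ⟨ψ, ?_, fun φ => by rw [← h φ]; exact hψ _, ?_⟩
    · rintro z (⟨z, hz, rfl⟩ | hz)
      · rw [hψ]; exact hχ' z hz
      · rw [Set.mem_singleton_iff.1 hz, map_sub, hψ, hψT, sub_self]
    · intro b' hb'
      obtain ⟨b'', hb'', rfl⟩ := List.mem_map.1 hb'
      have := hb b'' (List.mem_cons_of_mem _ hb'')
      rw [comapChar_apply] at this
      change ‖ψ (iota (b'' : B))‖ = ‖χ (iota (b'' : B))‖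
      rw [hψ, this]
  h4 := by
    intro χ hχ y hy h m hm
    refine char_kill hm χ fun x hx => ?_
    exact G.h4 (comapChar iota χ) (fun z hz => hχ _ (Or.inl ⟨z, hz, rfl⟩)) y hy h x hx

/-- slicing -/
def slice (φ : C((I × P) × I, ℂ)) : C(I, C(P × I, ℂ)) :=
  ContinuousMap.curry (φ.comp ⟨fun x : I × (P × I) => ((x.1, x.2.1), x.2.2), by fun_prop⟩)

theorem slice_apply (φ : C((I × P) × I, ℂ)) (t : I) (y : P × I) : slice φ t y = φ ((t, y.1), y.2) := rfl

/-- new parameters -/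
def QI (Q : Set P) : Set (I × P) := {x | x.1 = 0 ∨ x.1 = 1 ∨ x.2 ∈ Q}

theorem isClosed_QI (hQ : IsClosed Q) : IsClosed (QI Q) :=
  (isClosed_eq continuous_fst continuous_const).union
    ((isClosed_eq continuous_fst continuous_const).union (hQ.preimage continuous_snd))

/-- structure map on slices -/
def kI (κ : C(P × I, ℂ) →ₐ[ℂ] B) (hκ : Continuous κ) : C((I × P) × I, ℂ) →ₐ[ℂ] C(I, B) where
  toFun φ := ContinuousMap.comp ⟨κ, hκ⟩ (slice φ)
  map_one' := by
    ext t; change κ (slice 1 t) = 1; rw [show slice (1 : C((I × P) × I, ℂ)) t = 1 from rfl, map_one]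
  map_mul' φ ψ := by
    ext t; change κ (slice (φ * ψ) t) = κ (slice φ t) * κ (slice ψ t)
    rw [← map_mul]; rfl
  map_zero' := by
    ext t; change κ (slice 0 t) = 0; rw [show slice (0 : C((I × P) × I, ℂ)) t = 0 from rfl, map_zero]
  map_add' φ ψ := by
    ext t; change κ (slice (φ + ψ) t) = κ (slice φ t) + κ (slice ψ t)
    rw [← map_add]; rfl
  commutes' c := by
    ext t; change κ (slice (algebraMap ℂ _ c) t) = algebraMap ℂ _ c
    rw [← κ.commutes]; rfl

theorem kI_apply (κ : C(P × I, ℂ) →ₐ[ℂ] B) (hκ : Continuous κ) (φ : C((I × P) × I, ℂ)) (t : I) :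
    kI κ hκ φ t = κ (slice φ t) := rfl

theorem continuous_kI (κ : C(P × I, ℂ) →ₐ[ℂ] B) (hκ : Continuous κ) : Continuous (kI κ hκ) :=
  (ContinuousMap.continuous_postcomp ⟨κ, hκ⟩).comp
    (ContinuousMap.continuous_curry.comp (ContinuousMap.continuous_precomp _))

/-- path ideal -/
def nI (n : Ideal B) : Ideal C(I, B) where
  carrier := {f | f 0 = 0 ∧ f 1 = 0 ∧ ∀ t, f t ∈ n}
  zero_mem' := ⟨rfl, rfl, fun t => n.zero_mem⟩
  add_mem' := fun {f g} hf hg => ⟨by simp [hf.1, hg.1], by simp [hf.2.1, hg.2.1],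
    fun t => n.add_mem (hf.2.2 t) (hg.2.2 t)⟩
  smul_mem' := fun c f hf => ⟨by simp [hf.1], by simp [hf.2.1], fun t => n.mul_mem_left _ (hf.2.2 t)⟩

theorem mem_nI {n : Ideal B} {f : C(I, B)} : f ∈ nI n ↔ f 0 = 0 ∧ f 1 = 0 ∧ ∀ t, f t ∈ n := Iff.rfl

theorem isClosed_nI {n : Ideal B} (hn : IsClosed (n : Set B)) : IsClosed (nI n : Set C(I, B)) := by
  have : (nI n : Set C(I, B)) = {f | f 0 = 0} ∩ ({f | f 1 = 0} ∩ ⋂ t, (fun f : C(I, B) => f t) ⁻¹' n) := by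
    ext f; simp [mem_nI]
  rw [this]
  exact (isClosed_eq (by fun_prop) continuous_const).inter
    ((isClosed_eq (by fun_prop) continuous_const).inter
      (isClosed_iInter fun t => hn.preimage (by fun_prop)))

/-- path operation -/
def GD.path (G : GD P Q B bs) :
    GD (I × P) (QI Q) C(I, B) (bs.map (Units.map ((constAlg : B →ₐ[ℂ] C(I, B)) : B →* C(I, B)))) where
  κ := kI G.κ G.hκ
  hκ := continuous_kI _ _
  n := nI G.n
  hn := isClosed_nI G.hn
  Z := constAlg '' G.Z
  h1 φ hφ := by
    have h0 : ∀ t : I, (t = 0 ∨ t = 1) → kI G.κ G.hκ φ t = 0 := by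
      intro t ht
      rw [kI_apply, show slice φ t = 0 from ?_, map_zero]
      ext y
      rw [slice_apply, hφ _ (Or.inl ?_)]; rfl
      rcases ht with ht | ht
      · exact Or.inl ht
      · exact Or.inr (Or.inl ht)
    refine ⟨h0 0 (Or.inl rfl), h0 1 (Or.inr rfl), fun t => G.h1 _ fun y hy => ?_⟩
    rw [slice_apply]
    apply hφ
    rcases hy with hy | hy
    · exact Or.inl (Or.inr (Or.inr hy))
    · exact Or.inr hy
  h2 := by
    intro χ hχ χ' hχ' hk hb
    obtain ⟨t, χ0, h0⟩ := char_CP χ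
    obtain ⟨t', χ0', h0'⟩ := char_CP χ'
    have ht : t = t' := by
      let φ : C((I × P) × I, ℂ) := ⟨fun x => ((x.1.1 : ℝ) : ℂ), by fun_prop⟩
      have hs : ∀ t, slice φ t = algebraMap ℂ _ ((t : ℝ) : ℂ) := fun t => rfl
      have := hk φ
      rw [h0, h0', kI_apply, kI_apply, hs, hs, AlgHom.commutes, AlgHom.commutes, AlgHomClass.commutes,
        AlgHomClass.commutes] at this
      apply Subtype.ext
      simpa using this
    subst ht
    have : χ0 = χ0' := by
      refine G.h2 _ (fun z hz => ?_) _ (fun z hz => ?_) (fun φ => ?_) fun b hb' => ?_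
      · have := hχ _ ⟨z, hz, rfl⟩; rw [h0] at this; exact this
      · have := hχ' _ ⟨z, hz, rfl⟩; rw [h0'] at this; exact this
      · have := hk (φ.comp ⟨fun x : (I × P) × I => (x.1.2, x.2), by fun_prop⟩)
        rw [h0, h0'] at this; exact this
      · have := hb _ (List.mem_map.2 ⟨b, hb', rfl⟩)
        rw [h0, h0'] at this; exact this
    subst this
    ext f; rw [h0, h0']
  h3 := by
    rintro χ hχ ⟨⟨t1, p⟩, s⟩
    obtain ⟨t, χ0, h0⟩ := char_CP χ
    obtain ⟨χ1, h1, h2, h3⟩ := G.h3 χ0 (fun z hz => by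
      have := hχ _ ⟨z, hz, rfl⟩; rw [h0] at this; exact this) (p, s)
    refine ⟨comapChar (evalAlg t1) χ1, ?_, fun φ => ?_, ?_⟩
    · rintro _ ⟨z, hz, rfl⟩; exact h1 z hz
    · rw [comapChar_apply]; change χ1 (G.κ (slice φ t1)) = _
      rw [h2, slice_apply]
    · intro b hb
      obtain ⟨b', hb', rfl⟩ := List.mem_map.1 hb
      rw [h0]; exact h3 b' hb'
  h4 := by
    rintro χ hχ ⟨⟨t1, p⟩, s⟩ hy h m hm
    obtain ⟨t, χ0, h0⟩ := char_CP χ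
    have ht : t = t1 := by
      let φ : C((I × P) × I, ℂ) := ⟨fun x => ((x.1.1 : ℝ) : ℂ), by fun_prop⟩
      have hs : ∀ t, slice φ t = algebraMap ℂ _ ((t : ℝ) : ℂ) := fun t => rfl
      have := h φ
      rw [h0, kI_apply, hs, AlgHom.commutes, AlgHomClass.commutes] at this
      apply Subtype.ext
      simpa [φ] using this
    subst ht
    rw [h0]
    have hin : ∀ y : P × I, y = (p, s) → y ∈ NN Q → χ0 (m t) = 0 := by
      rintro _ rfl hy
      refine G.h4 χ0 (fun z hz => ?_) (p, s) hy (fun φ => ?_) _ (hm.2.2 t)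
      · have := hχ _ ⟨z, hz, rfl⟩; rw [h0] at this; exact this
      · have := h (φ.comp ⟨fun x : (I × P) × I => (x.1.2, x.2), by fun_prop⟩)
        rw [h0] at this; exact this
    rcases hy with (hy | hy | hy) | hy
    · have : t = 0 := hy
      rw [this, hm.1, map_zero]
    · have : t = 1 := hy
      rw [this, hm.2.1, map_zero]
    · exact hin _ rfl (Or.inl hy)
    · exact hin _ rfl (Or.inr hy)

end main
end
end Oka


open WeakDual
set_option linter.all false
set_option linter.deprecated false
set_option linter.unusedSectionVars false
namespace Oka
noncomputable section
universe uP uB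
open unitInterval

section main
variable {P : Type uP} [TopologicalSpace P] [CompactSpace P] [T2Space P] {Q : Set P}
    {B : Type uB} [NormedCommRing B] [NormedAlgebra ℂ B] [CompleteSpace B] {bs : List Bˣ}
    {d : Type} [Fintype d] [DecidableEq d]

/-- rescaled unit -/
def sb (r : ℝ) (hr : 0 < r) (b : Bˣ) : Bˣ :=
  Units.map ((algebraMap ℂ B : ℂ →+* B) : ℂ →* B)
    (Units.mk0 ((r : ℂ)⁻¹) (inv_ne_zero (by exact_mod_cast hr.ne'))) * b

theorem char_sb (r : ℝ) (hr : 0 < r) (b : Bˣ) (χ : characterSpace ℂ B) :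
    ‖χ (sb r hr b : B)‖ = ‖χ (b : B)‖ / r := by
  have : (sb r hr b : B) = algebraMap ℂ B ((r : ℂ)⁻¹) * b := rfl
  rw [this, map_mul, norm_mul, AlgHomClass.commutes]
  simp [abs_of_pos hr]
  field_simp

/-- rescaled data -/
def GD.scale {b : Bˣ} (G : GD P Q B (b :: bs)) (r : ℝ) (hr : 0 < r) :
    GD P Q B (sb r hr b :: bs) where
  κ := G.κ
  hκ := G.hκ
  n := G.n
  hn := G.hn
  Z := G.Z
  h1 := G.h1
  h2 χ hχ χ' hχ' h hb := G.h2 χ hχ χ' hχ' h (by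
    intro c hc
    rcases List.mem_cons.1 hc with rfl | hc
    · have := hb (sb r hr c) (by simp)
      rw [char_sb, char_sb] at this
      field_simp at this
      exact this
    · exact hb c (by simp [hc]))
  h3 χ hχ y := by
    obtain ⟨χ', h, h', h''⟩ := G.h3 χ hχ y
    refine ⟨χ', h, h', ?_⟩
    intro c hc
    rcases List.mem_cons.1 hc with rfl | hc
    · rw [char_sb, char_sb, h'' b (by simp)]
    · exact h'' c (by simp [hc])
  h4 := G.h4

theorem hull_ZZ {Z : Set B} {b : Bˣ} {ψ : characterSpace ℂ (Lau B)} :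
    ψ ∈ hull (ZZ Z b) ↔ comapChar iota ψ ∈ hull Z ∧ ψ TT = ψ (iota (b : B)) := by
  constructor
  · intro h
    refine ⟨fun z hz => h _ (Or.inl ⟨z, hz, rfl⟩), ?_⟩
    have := h (TT - iota (b : B)) (Or.inr rfl)
    rwa [map_sub, sub_eq_zero] at this
  · rintro ⟨h, h'⟩ z (⟨z, hz, rfl⟩ | rfl)
    · exact h z hz
    · rw [map_sub, h', sub_self]

theorem step_one {b : Bˣ} (G : GD P Q B (b :: bs)) (hg : G.lau.Good d) (u : d → B) (hu : G.Rel u) :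
    ∃ v : d → B, (∀ i, v i - u i ∈ G.n) ∧ ∀ χ ∈ hull G.Z, ‖χ (b : B)‖ = 1 → ∃ i, χ (v i) ≠ 0 := by
  obtain ⟨w, hw, hnv⟩ := hg (fun i => iota (u i)) (by
    intro χ hχ y hy h
    exact hu (comapChar iota χ) (hull_ZZ.1 hχ).1 y hy h)
  obtain ⟨c, hc, hcl⟩ := lower _ (isClosed_hull _) w hnv
  have ht : ∀ i, ∃ m' ∈ G.n, ∃ l, ‖(w i - iota (u i)) - l‖ < c ∧ l - iota m' ∈ IJ G.n G.hn G.Z b :=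
    fun i => trunc (hw i) hc
  choose m hm l hl hlm using ht
  refine ⟨fun i => u i + m i, fun i => by simpa using hm i, ?_⟩
  intro χ hχ hb
  obtain ⟨ψ, h1, h2⟩ := exists_char_ext χ (χ (b : B)) hb
  have hψ : ψ ∈ hull (ZZ G.Z b) := hull_ZZ.2 ⟨fun z hz => by
    rw [comapChar_apply, h1]; exact hχ z hz, by rw [h2, h1]⟩
  by_contra! hcon
  refine absurd (hcl ψ hψ) (not_le.2 ((pi_norm_lt_iff hc).2 fun i => ?_))
  have e1 : ψ (l i - iota (m i)) = 0 := char_span hψ (Ideal.mul_le_left (hlm i))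
  have e2 : ψ (w i) = ψ (w i - iota (u i) - l i) := by
    have := hcon i
    rw [← h1, map_add, map_add] at this
    rw [map_sub] at e1
    rw [map_sub, map_sub]
    linear_combination e1 + this
  rw [e2]
  exact (char_le _ _).trans_lt (hl i)

theorem step_i {b : Bˣ} (G : GD P Q B (b :: bs)) (r : ℝ) (hr : 0 < r)
    (hg : (G.scale r hr).lau.Good d) (u : d → B) (hu : G.Rel u) :
    ∃ v : d → B, (∀ i, v i - u i ∈ G.n) ∧ ∃ δ > 0, ∀ χ ∈ hull G.Z, |‖χ (b : B)‖ - r| ≤ δ →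
      ∃ i, χ (v i) ≠ 0 := by
  obtain ⟨v, hv, hnv⟩ := step_one (G.scale r hr) hg u hu
  refine ⟨v, hv, ?_⟩
  let K : Set (characterSpace ℂ B) := hull G.Z ∩ ⋂ i, {χ | χ (v i) = 0}
  have hK : IsCompact K := ((isClosed_hull _).inter (isClosed_iInter fun i =>
    isClosed_eq (continuous_char_eval _) continuous_const)).isCompact
  have hc : Continuous fun χ : characterSpace ℂ B => |‖χ (b : B)‖ - r| :=
    ((continuous_char_eval _).norm.sub continuous_const).abs
  have hpos : ∀ χ ∈ K, 0 < |‖χ (b : B)‖ - r| := by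
    rintro χ ⟨h, h'⟩
    rw [abs_pos, sub_ne_zero]
    intro e
    obtain ⟨i, hi⟩ := hnv χ h (by rw [char_sb, e, div_self hr.ne'])
    exact hi (Set.mem_iInter.1 h' i)
  have : ∃ δ > 0, ∀ χ ∈ K, δ < |‖χ (b : B)‖ - r| := by
    rcases K.eq_empty_or_nonempty with he | hne
    · exact ⟨1, one_pos, by simp [he]⟩
    · obtain ⟨χ0, h0, hmin⟩ := hK.exists_isMinOn hne hc.continuousOn
      exact ⟨|‖χ0 (b : B)‖ - r| / 2, half_pos (hpos χ0 h0), fun χ hχ =>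
        (half_lt_self (hpos χ0 h0)).trans_le (hmin hχ)⟩
  obtain ⟨δ, hδ, h⟩ := this
  refine ⟨δ, hδ, fun χ hχ hb => ?_⟩
  by_contra! hcon
  exact absurd (h χ ⟨hχ, Set.mem_iInter.2 hcon⟩) (not_lt.2 hb)

theorem step_ii {b : Bˣ} (G : GD P Q B (b :: bs)) (hg : G.lau.path.Good d) (u : d → B) (hu : G.Rel u)
    (v1 v2 : d → B) (hv1 : ∀ i, v1 i - u i ∈ G.n) (hv2 : ∀ i, v2 i - u i ∈ G.n) (ρ : ℝ) (hρ : 1 ≤ ρ)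
    (h1 : ∀ χ ∈ hull G.Z, ‖χ (b:B)‖ ≤ 1 → ∃ i, χ (v1 i) ≠ 0)
    (h2 : ∀ χ ∈ hull G.Z, 1 ≤ ‖χ (b:B)‖ → ‖χ (b:B)‖ ≤ ρ → ∃ i, χ (v2 i) ≠ 0) :
    ∃ v : d → B, (∀ i, v i - u i ∈ G.n) ∧ ∀ χ ∈ hull G.Z, ‖χ (b:B)‖ ≤ ρ → ∃ i, χ (v i) ≠ 0 := by
  let q : d → C(I, Lau B) := fun i => ⟨fun t => iota (v1 i) + ((t : ℝ) : ℂ) • iota (v2 i - v1 i), by fun_prop⟩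
  have hn12 : ∀ i, v2 i - v1 i ∈ G.n := fun i => by
    have := G.n.sub_mem (hv2 i) (hv1 i); simpa using this
  have hTT : ∀ ψ ∈ hull (ZZ G.Z b), ‖ψ (iota (b : B))‖ = 1 := by
    intro ψ h
    rw [← (hull_ZZ.1 h).2]; exact char_T_norm ψ
  obtain ⟨w, hw, hnv⟩ := hg q (by
    intro χ hχ y hy h
    obtain ⟨t, ψ, hψ⟩ := char_CP χ
    have hψZ : ψ ∈ hull (ZZ G.Z b) := by
      intro z hz
      have := hχ (constAlg z) ⟨z, hz, rfl⟩
      rw [hψ] at this; exact this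
    have hψZ' := (hull_ZZ.1 hψZ)
    have hqq : ∀ i, χ (q i) = ψ (iota (v1 i)) + ((t : ℝ) : ℂ) * ψ (iota (v2 i - v1 i)) := by
      intro i
      rw [hψ]
      change ψ (iota (v1 i) + ((t : ℝ) : ℂ) • iota (v2 i - v1 i)) = _
      rw [map_add, map_smul, smul_eq_mul]
    -- locate the point
    have hcoord : y.1.1 = t := by
      let φ : C((I × P) × I, ℂ) := ⟨fun z => ((z.1.1 : ℝ) : ℂ), by fun_prop⟩
      have e := h φ
      rw [hψ] at e
      have e2 : slice φ t = algebraMap ℂ C(P × I, ℂ) ((t : ℝ) : ℂ) := by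
        ext z; rfl
      have e3 : (GD.path G.lau).κ φ t = algebraMap ℂ (Lau B) ((t : ℝ) : ℂ) := by
        change kI G.lau.κ G.lau.hκ φ t = _
        rw [kI_apply, e2, AlgHomClass.commutes]
      rw [e3, AlgHomClass.commutes] at e
      have : ((t : ℝ) : ℂ) = ((y.1.1 : ℝ) : ℂ) := e
      exact Subtype.ext (by exact_mod_cast this.symm)
    by_cases ht0 : t = 0
    · obtain ⟨i, hi⟩ := h1 _ hψZ'.1 (hTT ψ hψZ).le
      exact ⟨i, by rw [hqq, ht0]; simpa using hi⟩
    by_cases ht1 : t = 1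
    · obtain ⟨i, hi⟩ := h2 _ hψZ'.1 (hTT ψ hψZ).ge ((hTT ψ hψZ).le.trans hρ)
      refine ⟨i, ?_⟩
      rw [hqq, ht1]
      have : ψ (iota (v2 i)) ≠ 0 := hi
      simpa [map_sub] using this
    -- now the parameter lies in the relative part
    have hy' : (y.1.2, y.2) ∈ NN Q := by
      rcases hy with hy | hy
      · rcases hy with hy | hy | hy
        · exact absurd (hcoord ▸ hy) ht0
        · exact absurd (hcoord ▸ hy) ht1
        · exact Or.inl hy
      · exact Or.inr hy
    have hpt : ∀ φ, ψ (G.lau.κ φ) = φ (y.1.2, y.2) := by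
      intro φ
      let φ' : C((I × P) × I, ℂ) := ⟨fun z => φ (z.1.2, z.2), by fun_prop⟩
      have e := h φ'
      rw [hψ] at e
      have e2 : slice φ' t = φ := by ext z; rfl
      have e3 : (GD.path G.lau).κ φ' t = G.lau.κ φ := by
        change kI G.lau.κ G.lau.hκ φ' t = _
        rw [kI_apply, e2]
      rw [e3] at e; exact e
    have hkill : ∀ m ∈ G.n, ψ (iota m) = 0 := fun m hm =>
      G.h4 (comapChar iota ψ) hψZ'.1 _ hy' hpt m hm
    obtain ⟨i, hi⟩ := h1 _ hψZ'.1 (hTT ψ hψZ).le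
    refine ⟨i, ?_⟩
    rw [hqq, hkill _ (hn12 i), mul_zero, add_zero]; exact hi)
  have hwn : ∀ i, w i 0 = iota (v1 i) ∧ w i 1 = iota (v2 i) ∧ ∀ t, w i t - q i t ∈ coefIdeal G.n G.hn := by
    intro i
    obtain ⟨a0, a1, a2⟩ := mem_nI.1 (hw i)
    refine ⟨?_, ?_, a2⟩
    · rw [ContinuousMap.sub_apply, sub_eq_zero] at a0
      rw [a0]
      change iota (v1 i) + (((0 : I) : ℝ) : ℂ) • iota (v2 i - v1 i) = _
      simp
    · rw [ContinuousMap.sub_apply, sub_eq_zero] at a1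
      rw [a1]
      change iota (v1 i) + (((1 : I) : ℝ) : ℂ) • iota (v2 i - v1 i) = _
      simp [map_sub]
  have hwv : ∀ i t, w i t - iota (v1 i) ∈ coefIdeal G.n G.hn := by
    intro i t
    have a := (hwn i).2.2 t
    have a2 : q i t - iota (v1 i) ∈ coefIdeal G.n G.hn := by
      change iota (v1 i) + ((t : ℝ) : ℂ) • iota (v2 i - v1 i) - iota (v1 i) ∈ _
      rw [add_sub_cancel_left]
      exact Submodule.smul_of_tower_mem _ _ (iota_mem.2 (hn12 i))
    have := Ideal.add_mem _ a a2
    simpa using this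
  obtain ⟨v, hv, hvn⟩ := gluing (n := G.n) (hn := G.hn) (Z := G.Z) (b := b)
    (fun t i => w i (Set.projIcc 0 1 zero_le_one t))
    (continuous_pi fun i => (w i).continuous.comp continuous_projIcc)
    (by
      intro s t i
      have := Ideal.sub_mem _ (hwv i (Set.projIcc 0 1 zero_le_one s)) (hwv i (Set.projIcc 0 1 zero_le_one t))
      simpa using this)
    (by
      intro t ht χ hχ
      obtain ⟨i, hi⟩ := hnv (comapChar (evalAlg ⟨t, ht⟩) χ) (by
        rintro _ ⟨z, hz, rfl⟩
        exact hχ z hz)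
      refine ⟨i, ?_⟩
      rw [Set.projIcc_of_mem _ ht]
      exact hi)
    v1 v2
    (by funext i; rw [Set.projIcc_left]; exact (hwn i).1)
    (by funext i; rw [Set.projIcc_right]; exact (hwn i).2.1)
    ρ h1 h2
  refine ⟨v, fun i => ?_, hvn⟩
  have := G.n.add_mem (hv i) (hv1 i)
  simpa using this

theorem main_good (d : Type) [Fintype d] [DecidableEq d] (k : ℕ) :
    ∀ (P : Type uP) [TopologicalSpace P] [CompactSpace P] [T2Space P] (Q : Set P)
    (B : Type uB) [NormedCommRing B] [NormedAlgebra ℂ B] [CompleteSpace B] (bs : List Bˣ)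
    (G : GD P Q B bs), bs.length = k → IsClosed Q → G.Good d := by
  induction k with
  | zero =>
    intro P _ _ _ Q B _ _ _ bs G hl hQ
    obtain rfl := List.length_eq_zero_iff.1 hl
    exact base_good hQ G
  | succ k ih =>
    intro P _ _ _ Q B _ _ _ bs G hl hQ
    rcases bs with _ | ⟨b, bs⟩
    · simp at hl
    have hlen : bs.length = k := by simpa using hl
    intro u hu
    let S : Set ℝ := {r | 0 < r ∧ ∃ v : d → B, (∀ i, v i - u i ∈ G.n) ∧
      ∀ χ ∈ hull G.Z, ‖χ (b : B)‖ ≤ r → ∃ i, χ (v i) ≠ 0}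
    have hbig : ∀ r ∈ S, ‖(b : B)‖ ≤ r → ∃ v : d → B, (∀ i, v i - u i ∈ G.n) ∧
        ∀ χ ∈ hull G.Z, ∃ i, χ (v i) ≠ 0 := by
      rintro r ⟨hr, v, hv, h⟩ hb
      exact ⟨v, hv, fun χ hχ => h χ hχ ((char_le _ _).trans hb)⟩
    by_contra hcon
    have hub : ∀ r ∈ S, r ≤ ‖(b : B)‖ := by
      intro r hr
      by_contra hlt
      exact hcon (hbig r hr (not_le.1 hlt).le)
    have hr0 : (‖((b⁻¹ : Bˣ) : B)‖ + 1)⁻¹ ∈ S := by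
      have hp : 0 < ‖((b⁻¹ : Bˣ) : B)‖ + 1 := by positivity
      refine ⟨inv_pos.2 hp, u, fun i => by simp, fun χ hχ hb => ?_⟩
      exfalso
      have e : ‖χ (b : B)‖ * ‖χ ((b⁻¹ : Bˣ) : B)‖ = 1 := by
        rw [← norm_mul, ← map_mul, Units.mul_inv, map_one, norm_one]
      have e2 := char_le χ ((b⁻¹ : Bˣ) : B)
      have e3 : ‖χ (b : B)‖ * ‖χ ((b⁻¹ : Bˣ) : B)‖ ≤ (‖((b⁻¹ : Bˣ) : B)‖ + 1)⁻¹ * ‖((b⁻¹ : Bˣ) : B)‖ :=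
        mul_le_mul hb e2 (norm_nonneg _) (inv_nonneg.2 hp.le)
      rw [e, inv_mul_eq_div, le_div_iff₀ hp] at e3
      linarith
    have hbd : BddAbove S := ⟨_, hub⟩
    have hne : S.Nonempty := ⟨_, hr0⟩
    set r := sSup S with hrdef
    have hrpos : 0 < r := hr0.1.trans_le (le_csSup hbd hr0)
    obtain ⟨v2, hv2, δ, hδ, hn2⟩ := step_i G r hrpos
      (ih P Q (Lau B) _ (G.scale r hrpos).lau (by simpa using hlen) hQ) u hu
    obtain ⟨r', hr'S, hr'⟩ := exists_lt_of_lt_csSup hne (sub_lt_self r hδ)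
    obtain ⟨hr'0, v1, hv1, hn1⟩ := hr'S
    have hr'le : r' ≤ r := le_csSup hbd ⟨hr'0, v1, hv1, hn1⟩
    obtain ⟨v, hv, hn⟩ := step_ii (G.scale r' hr'0)
      (ih (I × P) (QI Q) C(I, Lau B) _ (G.scale r' hr'0).lau.path (by simpa using hlen) (isClosed_QI hQ))
      u hu v1 v2 hv1 hv2 ((r + δ) / r') (by rw [le_div_iff₀ hr'0]; linarith)
      (by
        intro χ hχ hb
        rw [char_sb, div_le_one hr'0] at hb
        exact hn1 χ hχ hb)
      (by
        intro χ hχ hb hb2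
        rw [char_sb, one_le_div hr'0] at hb
        rw [char_sb, div_le_div_iff_of_pos_right hr'0] at hb2
        exact hn2 χ hχ (abs_le.2 ⟨by linarith, by linarith⟩))
    have : r + δ ∈ S := ⟨by positivity, v, hv, fun χ hχ hb => hn χ hχ (by
      rw [char_sb, div_le_div_iff_of_pos_right hr'0]; exact hb)⟩
    have := le_csSup hbd this
    linarith
end main
end
end Oka


open WeakDual
set_option linter.all false
set_option linter.deprecated false
set_option linter.unusedSectionVars false
namespace Oka
noncomputable section
universe uP uB
open unitInterval

section cyl
variable (A : Type uB) [NormedCommRing A] [NormedAlgebra ℂ A] [CompleteSpace A]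

/-- the mapping cylinder algebra -/
def CylS : Subalgebra ℂ (C(I × characterSpace ℂ A, ℂ) × A) where
  carrier := {z | ∀ x : characterSpace ℂ A, z.1 (1, x) = x z.2}
  mul_mem' {a b} ha hb x := by
    have h1 := ha x; have h2 := hb x
    simp only [Prod.fst_mul, Prod.snd_mul, ContinuousMap.mul_apply, map_mul, h1, h2]
  add_mem' {a b} ha hb x := by
    have h1 := ha x; have h2 := hb x
    simp only [Prod.fst_add, Prod.snd_add, ContinuousMap.add_apply, map_add, h1, h2]
  algebraMap_mem' r x := by
    rw [Prod.algebraMap_apply, AlgHomClass.commutes]; rfl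

theorem isClosed_CylS : IsClosed (CylS A : Set (C(I × characterSpace ℂ A, ℂ) × A)) := by
  have : (CylS A : Set (C(I × characterSpace ℂ A, ℂ) × A)) = ⋂ x : characterSpace ℂ A, {z | z.1 (1, x) = x z.2} := by
    ext z; simp only [Set.mem_iInter]; rfl
  rw [this]
  refine isClosed_iInter fun x => isClosed_eq ?_ ?_
  · exact (continuous_eval_const _).comp continuous_fst
  · exact (map_continuous x).comp continuous_snd

/-- the mapping cylinder algebra, as a type -/
def Cyl : Type uB := ↥(CylS A)

instance : NormedCommRing (Cyl A) := inferInstanceAs (NormedCommRing ↥(CylS A))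
instance : NormedAlgebra ℂ (Cyl A) := inferInstanceAs (NormedAlgebra ℂ ↥(CylS A))
instance : CompleteSpace (Cyl A) := (isClosed_CylS A).completeSpace_coe

variable {A}

/-- constructor -/
def mkC (F : C(I × characterSpace ℂ A, ℂ)) (a : A) (h : ∀ x : characterSpace ℂ A, F (1, x) = x a) : Cyl A :=
  (⟨(F, a), h⟩ : ↥(CylS A))

/-- the function part -/
def fn (z : Cyl A) : C(I × characterSpace ℂ A, ℂ) := (Subtype.val (p := fun z => z ∈ CylS A) z).1

/-- the algebra part -/
def sd (z : Cyl A) : A := (Subtype.val (p := fun z => z ∈ CylS A) z).2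

theorem fn_one (z : Cyl A) (x : characterSpace ℂ A) : fn z (1, x) = x (sd z) :=
  (Subtype.property (p := fun z => z ∈ CylS A) z) x

theorem cyl_ext {z z' : Cyl A} (h : ∀ y, fn z y = fn z' y) (h2 : sd z = sd z') : z = z' :=
  Subtype.ext (p := fun z => z ∈ CylS A) (Prod.ext (ContinuousMap.ext h) h2)

theorem norm_cyl (z : Cyl A) : ‖z‖ = max ‖fn z‖ ‖sd z‖ := rfl

@[simp] theorem fn_add (z z' : Cyl A) : fn (z + z') = fn z + fn z' := rfl
@[simp] theorem fn_sub (z z' : Cyl A) : fn (z - z') = fn z - fn z' := rfl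
@[simp] theorem fn_mul (z z' : Cyl A) : fn (z * z') = fn z * fn z' := rfl
@[simp] theorem fn_zero : fn (0 : Cyl A) = 0 := rfl
@[simp] theorem fn_smul (c : ℂ) (z : Cyl A) : fn (c • z) = c • fn z := rfl
@[simp] theorem sd_add (z z' : Cyl A) : sd (z + z') = sd z + sd z' := rfl
@[simp] theorem sd_sub (z z' : Cyl A) : sd (z - z') = sd z - sd z' := rfl
@[simp] theorem sd_mul (z z' : Cyl A) : sd (z * z') = sd z * sd z' := rfl
@[simp] theorem sd_zero : sd (0 : Cyl A) = 0 := rfl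
@[simp] theorem sd_smul (c : ℂ) (z : Cyl A) : sd (c • z) = c • sd z := rfl

@[simp] theorem fn_mkC (F : C(I × characterSpace ℂ A, ℂ)) (a : A) (h) : fn (mkC F a h) = F := rfl
@[simp] theorem sd_mkC (F : C(I × characterSpace ℂ A, ℂ)) (a : A) (h) : sd (mkC F a h) = a := rfl

/-- the function part, linear -/
def fnL : Cyl A →L[ℂ] C(I × characterSpace ℂ A, ℂ) :=
  LinearMap.mkContinuous { toFun := fn, map_add' := fn_add, map_smul' := fn_smul } 1
    (fun z => by rw [one_mul]; exact le_max_left _ _)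

/-- the algebra part, linear -/
def sdL : Cyl A →L[ℂ] A :=
  LinearMap.mkContinuous { toFun := sd, map_add' := sd_add, map_smul' := sd_smul } 1
    (fun z => by rw [one_mul]; exact le_max_right _ _)

theorem continuous_fn : Continuous (fn : Cyl A → _) := fnL.continuous
theorem continuous_sd : Continuous (sd : Cyl A → _) := sdL.continuous

theorem continuous_cyl {T : Type*} [TopologicalSpace T] {f : T → Cyl A} (h1 : Continuous fun t => fn (f t))
    (h2 : Continuous fun t => sd (f t)) : Continuous f :=
  Continuous.subtype_mk (p := fun z => z ∈ CylS A) (Continuous.prodMk h1 h2) _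

/-- the function part, multiplicative -/
def fnA : Cyl A →ₐ[ℂ] C(I × characterSpace ℂ A, ℂ) where
  toFun := fn
  map_one' := rfl
  map_mul' := fn_mul
  map_zero' := rfl
  map_add' := fn_add
  commutes' r := rfl

/-- point evaluation -/
def cylChar (y : I × characterSpace ℂ A) : characterSpace ℂ (Cyl A) :=
  comapChar fnA (CharacterSpace.continuousMapEval _ ℂ y)

@[simp] theorem cylChar_apply (y : I × characterSpace ℂ A) (z : Cyl A) : cylChar y z = fn z y := rfl

/-- functions of the cylinder coordinate -/
def kC : C(I, ℂ) →ₐ[ℂ] Cyl A where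
  toFun g := mkC ⟨fun y => g y.1, by fun_prop⟩ (algebraMap ℂ A (g 1)) (fun x => by
    rw [AlgHomClass.commutes]; rfl)
  map_one' := cyl_ext (fun y => rfl) (map_one _)
  map_mul' f g := cyl_ext (fun y => rfl) (map_mul _ _ _)
  map_zero' := cyl_ext (fun y => rfl) (map_zero _)
  map_add' f g := cyl_ext (fun y => rfl) (map_add _ _ _)
  commutes' r := cyl_ext (fun y => rfl) rfl

@[simp] theorem fn_kC (g : C(I, ℂ)) (y : I × characterSpace ℂ A) : fn (kC g) y = g y.1 := rfl
@[simp] theorem sd_kC (g : C(I, ℂ)) : sd (kC g : Cyl A) = algebraMap ℂ A (g 1) := rfl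

theorem continuous_kC : Continuous (kC : C(I, ℂ) → Cyl A) := by
  refine continuous_cyl ?_ ?_
  · exact ContinuousMap.continuous_precomp (⟨Prod.fst, continuous_fst⟩ : C(I × characterSpace ℂ A, I))
  · exact (continuous_algebraMap ℂ A).comp (continuous_eval_const (1 : I))

/-- constant extension -/
def jj : A →ₐ[ℂ] Cyl A where
  toFun a := mkC ⟨fun y => y.2 a, (continuous_char_eval a).comp continuous_snd⟩ a (fun x => rfl)
  map_one' := cyl_ext (fun y => map_one y.2) rfl
  map_mul' f g := cyl_ext (fun y => map_mul y.2 f g) rfl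
  map_zero' := cyl_ext (fun y => map_zero y.2) rfl
  map_add' f g := cyl_ext (fun y => map_add y.2 f g) rfl
  commutes' r := cyl_ext (fun y => AlgHomClass.commutes y.2 r) rfl

@[simp] theorem fn_jj (a : A) (y : I × characterSpace ℂ A) : fn (jj a) y = y.2 a := rfl
@[simp] theorem snd_jj (a : A) : sd (jj a) = a := rfl

/-- functions vanishing at the end -/
def zf (F : C(I × characterSpace ℂ A, ℂ)) (hF : ∀ x, F (1, x) = 0) : Cyl A :=
  mkC F 0 (fun x => by rw [map_zero]; exact hF x)

@[simp] theorem fn_zf (F : C(I × characterSpace ℂ A, ℂ)) (hF : ∀ x, F (1, x) = 0) : fn (zf F hF) = F := rfl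
@[simp] theorem snd_zf (F : C(I × characterSpace ℂ A, ℂ)) (hF : ∀ x, F (1, x) = 0) : sd (zf F hF) = 0 := rfl

theorem cyl_char (ψ : characterSpace ℂ (Cyl A)) : ∃ y, ψ = cylChar y := by
  obtain ⟨s, hs⟩ := exists_eval (comapChar kC ψ)
  by_cases h1 : s = 1
  · -- elements with zero algebra part are killed
    have hk : ∀ z : Cyl A, sd z = 0 → ψ z = 0 := by
      intro z hz
      have hz1 : ∀ x, fn z (1, x) = 0 := fun x => by rw [fn_one, hz, map_zero]
      by_contra hne
      have hpos : 0 < ‖ψ z‖ := norm_pos_iff.2 hne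
      -- the closed set where z is large
      have hcl : IsClosed (Prod.fst '' {y : I × characterSpace ℂ A | ‖ψ z‖ / 2 ≤ ‖fn z y‖}) :=
        isClosedMap_fst_of_compactSpace _ (isClosed_le continuous_const (fn z).continuous.norm)
      obtain ⟨g, hg0, hg1, hg⟩ := exists_continuous_zero_one_of_isClosed hcl
        (isClosed_singleton (x := (1 : I))) (by
          rw [Set.disjoint_singleton_right]
          rintro ⟨⟨s, x⟩, hy, h⟩
          have h : s = 1 := h
          have hy : ‖ψ z‖ / 2 ≤ ‖fn z (s, x)‖ := hy
          rw [h, hz1, norm_zero] at hy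
          linarith)
      let g' : C(I, ℂ) := ⟨fun t => ((g t : ℝ) : ℂ), by fun_prop⟩
      have e1 : ψ (kC g') = 1 := by
        rw [← comapChar_apply, hs, h1]
        change ((g 1 : ℝ) : ℂ) = 1
        have := hg1 (Set.mem_singleton (1 : I))
        rw [this]; simp
      have e2 : ψ z = ψ (kC g' * z) := by rw [map_mul, e1, one_mul]
      have e3 : ‖kC g' * z‖ ≤ ‖ψ z‖ / 2 := by
        rw [norm_cyl]
        refine max_le ((ContinuousMap.norm_le _ (by positivity)).2 fun y => ?_) ?_
        · rw [fn_mul, ContinuousMap.mul_apply, fn_kC, norm_mul]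
          change ‖((g y.1 : ℝ) : ℂ)‖ * _ ≤ _
          by_cases hy : ‖ψ z‖ / 2 ≤ ‖fn z y‖
          · have := hg0 ⟨y, hy, rfl⟩
            rw [this]; simp; positivity
          · rw [Complex.norm_real, Real.norm_of_nonneg (hg y.1).1]
            calc g y.1 * ‖fn z y‖ ≤ 1 * ‖fn z y‖ := by gcongr; exact (hg y.1).2
              _ ≤ ‖ψ z‖ / 2 := by rw [one_mul]; exact (not_le.1 hy).le
        · have : sd (kC g' * z) = sd (kC g') * sd z := rfl
          rw [this, hz, mul_zero, norm_zero]; positivity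
      have := char_le ψ (kC g' * z)
      rw [← e2] at this
      linarith
    refine ⟨(1, comapChar jj ψ), CharacterSpace.ext fun z => ?_⟩
    rw [cylChar_apply, fn_one, comapChar_apply]
    have := hk (z - jj (sd z)) (by
      change sd z - sd (jj (sd z)) = 0
      simp)
    rw [map_sub, sub_eq_zero] at this
    exact this
  · obtain ⟨g, hg0, hg1, hg⟩ := exists_continuous_zero_one_of_isClosed
      (isClosed_singleton (x := (1 : I))) (isClosed_singleton (x := s)) (by
        rw [Set.disjoint_singleton]; exact fun h => h1 h.symm)
    let g' : C(I, ℂ) := ⟨fun t => ((g t : ℝ) : ℂ), by fun_prop⟩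
    have hg'1 : g' 1 = 0 := by
      change ((g 1 : ℝ) : ℂ) = 0
      have := hg0 (Set.mem_singleton (1 : I))
      rw [this]; simp
    have e1 : ψ (kC g') = 1 := by
      rw [← comapChar_apply, hs]
      change ((g s : ℝ) : ℂ) = 1
      have := hg1 (Set.mem_singleton s)
      rw [this]; simp
    let mm (F : C(I × characterSpace ℂ A, ℂ)) : Cyl A := zf (fn (kC g') * F) (fun x => by
      rw [ContinuousMap.mul_apply, fn_kC, hg'1, zero_mul])
    have hmul : ∀ F z, mm F * z = mm (F * fn z) := by
      intro F z
      refine cyl_ext (fun y => ?_) ?_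
      · simp [mm, mul_assoc]
      · change sd (mm F) * sd z = 0
        simp [mm]
    have hmm : ∀ F F', mm F * mm F' = kC g' * mm (F * F') := by
      intro F F'
      refine cyl_ext (fun y => ?_) ?_
      · simp [mm]; ring
      · change sd (mm F) * sd (mm F') = sd (kC g') * sd (mm (F * F'))
        simp [mm]
    have hm1 : ψ (mm 1) = 1 := by
      have : mm 1 = kC g' := by
        refine cyl_ext (fun y => ?_) ?_
        · simp [mm]
        · change 0 = algebraMap ℂ A (g' 1)
          rw [hg'1, map_zero]
      rw [this, e1]
    let Φ : C(I × characterSpace ℂ A, ℂ) →ₐ[ℂ] ℂ := AlgHom.ofLinearMap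
      { toFun := fun F => ψ (mm F)
        map_add' := fun F F' => by
          rw [← map_add]; congr 1
          refine cyl_ext (fun y => ?_) ?_
          · simp [mm, mul_add]
          · change 0 = sd (mm F) + sd (mm F')
            simp [mm]
        map_smul' := fun c F => by
          rw [RingHom.id_apply, smul_eq_mul, ← smul_eq_mul, ← map_smul]; congr 1
          refine cyl_ext (fun y => ?_) ?_
          · simp [mm]
          · change 0 = c • sd (mm F)
            simp [mm] } hm1 (fun F F' => by
          change ψ (mm (F * F')) = ψ (mm F) * ψ (mm F')
          rw [← map_mul, hmm, map_mul, e1, one_mul])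
    obtain ⟨y, hy⟩ := exists_eval (CharacterSpace.equivAlgHom.symm Φ)
    refine ⟨y, CharacterSpace.ext fun z => ?_⟩
    have h := hy (fn z)
    change ψ (mm (fn z)) = fn z y at h
    rw [cylChar_apply, ← h]
    have : mm (fn z) = mm 1 * z := by rw [hmul, one_mul]
    rw [this, map_mul, hm1, one_mul]
end cyl
end
end Oka


open WeakDual
set_option linter.all false
set_option linter.deprecated false
set_option linter.unusedSectionVars false
namespace Oka
noncomputable section
universe uP uB
open unitInterval

section fg
variable {A : Type uB} [NormedCommRing A] [NormedAlgebra ℂ A] [CompleteSpace A]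
variable {P : Type uP} [TopologicalSpace P] [CompactSpace P] [T2Space P] {Q : Set P}

/-- shifted unit -/
theorem exists_shift (a : A) (c : ℂ) (hc : ‖c‖ = 1) :
    ∃ b : Aˣ, (b : A) = algebraMap ℂ A (c * ((‖a‖ * ‖(1 : A)‖ + 1 : ℝ) : ℂ)) - a := by
  have h : c * ((‖a‖ * ‖(1 : A)‖ + 1 : ℝ) : ℂ) ∈ resolventSet ℂ a := by
    apply spectrum.mem_resolventSet_of_norm_lt_mul
    rw [norm_mul, hc, one_mul, Complex.norm_real, Real.norm_of_nonneg (by positivity)]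
    linarith
  obtain ⟨b, hb⟩ := h
  exact ⟨b, hb⟩

theorem four_norms' (z w : ℂ) (R : ℝ) (hR : 0 < R) (h : ∀ c ∈ ([1, -1, Complex.I, -Complex.I] : List ℂ), ‖c * R - z‖ = ‖c * R - w‖) : z = w := by
  have e : ∀ c ∈ ([1, -1, Complex.I, -Complex.I] : List ℂ), Complex.normSq (c * R - z) = Complex.normSq (c * R - w) := by
    intro c hc
    rw [Complex.normSq_eq_norm_sq, Complex.normSq_eq_norm_sq, h c hc]
  have e1 := e 1 (by simp)
  have e2 := e (-1) (by simp)
  have e3 := e Complex.I (by simp)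
  have e4 := e (-Complex.I) (by simp)
  simp [Complex.normSq_apply] at e1 e2 e3 e4
  apply Complex.ext
  · have : R * (z.re - w.re) = 0 := by nlinarith
    rcases mul_eq_zero.1 this with h | h <;> linarith
  · have : R * (z.im - w.im) = 0 := by nlinarith
    rcases mul_eq_zero.1 this with h | h <;> linarith

/-- the structure map -/
def kap : C(P × I, ℂ) →ₐ[ℂ] C(P, Cyl A) where
  toFun φ := ⟨fun p => kC (φ.curry p), continuous_kC.comp φ.curry.continuous⟩
  map_one' := by
    ext p
    exact map_one (kC : C(I, ℂ) →ₐ[ℂ] Cyl A)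
  map_mul' φ φ' := by
    ext p
    exact map_mul (kC : C(I, ℂ) →ₐ[ℂ] Cyl A) (φ.curry p) (φ'.curry p)
  map_zero' := by
    ext p
    exact map_zero (kC : C(I, ℂ) →ₐ[ℂ] Cyl A)
  map_add' φ φ' := by
    ext p
    exact map_add (kC : C(I, ℂ) →ₐ[ℂ] Cyl A) (φ.curry p) (φ'.curry p)
  commutes' r := by
    ext p
    exact AlgHomClass.commutes (kC : C(I, ℂ) →ₐ[ℂ] Cyl A) r

theorem fn_kap (φ : C(P × I, ℂ)) (p : P) (s : I) (x : characterSpace ℂ A) :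
    fn (kap (A := A) φ p) (s, x) = φ (p, s) := rfl

theorem continuous_kap : Continuous (kap : C(P × I, ℂ) → C(P, Cyl A)) :=
  (ContinuousMap.continuous_postcomp (⟨kC, continuous_kC⟩ : C(C(I, ℂ), Cyl A))).comp
    (ContinuousMap.continuous_curry)

/-- the relative ideal -/
def nC (A : Type uB) [NormedCommRing A] [NormedAlgebra ℂ A] [CompleteSpace A] (Q : Set P) : Ideal C(P, Cyl A) where
  carrier := {g | (∀ q ∈ Q, g q = 0) ∧ ∀ p x, fn (g p) (0, x) = 0}
  zero_mem' := ⟨fun q _ => rfl, fun p x => rfl⟩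
  add_mem' {f g} hf hg := ⟨fun q hq => by rw [ContinuousMap.add_apply, hf.1 q hq, hg.1 q hq, add_zero],
    fun p x => by rw [ContinuousMap.add_apply, fn_add, ContinuousMap.add_apply, hf.2, hg.2, add_zero]⟩
  smul_mem' c g hg := ⟨fun q hq => by rw [smul_eq_mul, ContinuousMap.mul_apply, hg.1 q hq, mul_zero],
    fun p x => by rw [smul_eq_mul, ContinuousMap.mul_apply, fn_mul, ContinuousMap.mul_apply, hg.2, mul_zero]⟩

theorem mem_nC {g : C(P, Cyl A)} : g ∈ nC A Q ↔ (∀ q ∈ Q, g q = 0) ∧ ∀ p x, fn (g p) (0, x) = 0 := Iff.rfl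

theorem isClosed_nC : IsClosed (nC A Q : Set C(P, Cyl A)) := by
  have : (nC A Q : Set C(P, Cyl A)) = (⋂ q ∈ Q, {g | g q = 0}) ∩ ⋂ p, ⋂ x, {g | fn (g p) (0, x) = 0} := by
    ext g
    simp only [Set.mem_inter_iff, Set.mem_iInter]
    exact mem_nC
  rw [this]
  refine IsClosed.inter (isClosed_biInter fun q _ => isClosed_eq (continuous_eval_const q) continuous_const)
    (isClosed_iInter fun p => isClosed_iInter fun x => isClosed_eq ?_ continuous_const)
  exact (continuous_eval_const (0, x)).comp (continuous_fn.comp (continuous_eval_const p))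

theorem char_B (ψ : characterSpace ℂ C(P, Cyl A)) : ∃ p s x, ∀ f, ψ f = fn (f p) (s, x) := by
  obtain ⟨p, χ, h⟩ := char_CP ψ
  obtain ⟨⟨s, x⟩, rfl⟩ := cyl_char χ
  exact ⟨p, s, x, h⟩

/-- the evaluation characters -/
def evB (p : P) (s : I) (x : characterSpace ℂ A) : characterSpace ℂ C(P, Cyl A) :=
  comapChar (evalAlg p) (cylChar (s, x))

@[simp] theorem evB_apply (p : P) (s : I) (x : characterSpace ℂ A) (f : C(P, Cyl A)) :
    evB p s x f = fn (f p) (s, x) := rfl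

theorem pt_sep {K : Type*} [TopologicalSpace K] [CompactSpace K] [T2Space K] {y y' : K}
    (h : ∀ φ : C(K, ℂ), φ y = φ y') : y = y' := by
  apply (CharacterSpace.homeoEval K ℂ).injective
  ext φ; exact h φ

/-- the data for finitely generated algebras -/
def gdC (Q : Set P) (bs : List Aˣ) (hS : ∀ x x' : characterSpace ℂ A, (∀ b ∈ bs, ‖x (b : A)‖ = ‖x' (b : A)‖) → x = x') :
    GD P Q C(P, Cyl A) (bs.map (Units.map (((constAlg : Cyl A →ₐ[ℂ] C(P, Cyl A)).comp jj : A →ₐ[ℂ] C(P, Cyl A)) : A →* C(P, Cyl A)))) where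
  κ := kap
  hκ := continuous_kap
  n := nC A Q
  hn := isClosed_nC
  Z := ∅
  h1 φ hφ := by
    refine mem_nC.2 ⟨fun q hq => ?_, fun p x => ?_⟩
    · have : φ.curry q = 0 := by
        ext s; exact hφ (q, s) (Or.inl hq)
      change kC (φ.curry q) = 0
      rw [this, map_zero]
    · rw [fn_kap]; exact hφ (p, 0) (Or.inr rfl)
  h2 := by
    intro χ _ χ' _ h hb
    obtain ⟨p, s, x, hχ⟩ := char_B χ
    obtain ⟨p', s', x', hχ'⟩ := char_B χ'
    have e1 : (p, s) = (p', s') := pt_sep fun φ => by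
      have := h φ
      rw [hχ, hχ', fn_kap, fn_kap] at this
      exact this
    have e2 : x = x' := by
      apply hS
      intro b hbb
      have := hb _ (List.mem_map_of_mem hbb)
      rw [hχ, hχ'] at this
      exact this
    obtain ⟨rfl, rfl⟩ := Prod.mk.inj e1
    subst e2
    exact CharacterSpace.ext fun f => by rw [hχ, hχ']
  h3 := by
    intro χ _ y
    obtain ⟨p, s, x, hχ⟩ := char_B χ
    refine ⟨evB y.1 y.2 x, fun z hz => hz.elim, fun φ => rfl, ?_⟩
    intro b hb
    obtain ⟨b, hbb, rfl⟩ := List.mem_map.1 hb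
    rw [hχ]; rfl
  h4 := by
    intro χ _ y hy h m hm
    obtain ⟨p, s, x, hχ⟩ := char_B χ
    have e1 : (p, s) = y := pt_sep fun φ => by
      have := h φ
      rw [hχ, fn_kap] at this
      exact this
    rw [← e1] at hy
    rw [hχ]
    rcases hy with hy | hy
    · rw [(mem_nC.1 hm).1 p hy]; rfl
    · have hy : s = 0 := hy
      rw [hy, (mem_nC.1 hm).2 p x]

/-- lifting property for algebras with finitely many separating elements -/
theorem glp_fg {d : Type} [Fintype d] [DecidableEq d] (S : List A)
    (hS : ∀ x x' : characterSpace ℂ A, (∀ a ∈ S, x a = x' a) → x = x') (hQ : IsClosed Q)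
    (u : d → C(P, Cyl A)) (hu : ∀ p s x, (p ∈ Q ∨ s = 0) → ∃ i, fn (u i p) (s, x) ≠ 0) :
    ∃ v : d → C(P, Cyl A), (∀ i, v i - u i ∈ nC A Q) ∧ ∀ p s x, ∃ i, fn (v i p) (s, x) ≠ 0 := by
  have hex : ∀ (a : A) (c : ℂ), ∃ b : Aˣ, ‖c‖ = 1 → (b : A) = algebraMap ℂ A (c * ((‖a‖ * ‖(1 : A)‖ + 1 : ℝ) : ℂ)) - a := by
    intro a c
    by_cases hc : ‖c‖ = 1
    · obtain ⟨b, hb⟩ := exists_shift a c hc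
      exact ⟨b, fun _ => hb⟩
    · exact ⟨1, fun h => absurd h hc⟩
  choose bb hbb using hex
  let cs : List ℂ := [1, -1, Complex.I, -Complex.I]
  let bs : List Aˣ := S.flatMap fun a => cs.map (bb a)
  have hbs : ∀ x x' : characterSpace ℂ A, (∀ b ∈ bs, ‖x (b : A)‖ = ‖x' (b : A)‖) → x = x' := by
    intro x x' h
    apply hS
    intro a ha
    refine four_norms' (x a) (x' a) (‖a‖ * ‖(1 : A)‖ + 1) (by positivity) fun c hc => ?_
    have hc1 : ‖c‖ = 1 := by
      simp only [List.mem_cons, List.not_mem_nil, or_false] at hc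
      rcases hc with rfl | rfl | rfl | rfl <;> simp
    have := h (bb a c) (List.mem_flatMap.2 ⟨a, ha, List.mem_map_of_mem hc⟩)
    rw [hbb a c hc1, map_sub, map_sub, AlgHomClass.commutes, AlgHomClass.commutes] at this
    exact this
  obtain ⟨v, hv, hn⟩ := main_good d _ P Q C(P, Cyl A) _ (gdC Q bs hbs) rfl hQ u (by
    intro χ _ y hy h
    obtain ⟨p, s, x, hχ⟩ := char_B χ
    have e1 : (p, s) = y := pt_sep fun φ => by
      have := h φ
      rw [hχ] at this
      exact this
    rw [← e1] at hy
    obtain ⟨i, hi⟩ := hu p s x hy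
    exact ⟨i, by rw [hχ]; exact hi⟩)
  refine ⟨v, hv, fun p s x => ?_⟩
  exact hn (evB p s x) (fun z hz => hz.elim)
end fg
end
end Oka


open WeakDual
set_option linter.all false
set_option linter.deprecated false
set_option linter.unusedSectionVars false
namespace Oka
noncomputable section
universe uP uB
open unitInterval

section fgs
variable {A : Type uB} [NormedCommRing A] [NormedAlgebra ℂ A] [CompleteSpace A]

/-- closed subalgebra generated by a finite set -/
def AS (S : Finset A) : Subalgebra ℂ A := (Algebra.adjoin ℂ (S : Set A)).topologicalClosure

/-- as a type -/
def AT (S : Finset A) : Type uB := ↥(AS S)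

instance (S : Finset A) : NormedCommRing (AT S) := inferInstanceAs (NormedCommRing ↥(AS S))
instance (S : Finset A) : NormedAlgebra ℂ (AT S) := inferInstanceAs (NormedAlgebra ℂ ↥(AS S))
instance (S : Finset A) : CompleteSpace (AT S) :=
  (Subalgebra.isClosed_topologicalClosure (Algebra.adjoin ℂ (S : Set A))).completeSpace_coe

/-- inclusion -/
def inc (S : Finset A) : AT S →ₐ[ℂ] A where
  toFun a := Subtype.val (p := fun z => z ∈ AS S) a
  map_one' := rfl
  map_mul' _ _ := rfl
  map_zero' := rfl
  map_add' _ _ := rfl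
  commutes' _ := rfl

theorem inc_mem {S : Finset A} (a : AT S) : inc S a ∈ AS S := Subtype.property (p := fun z => z ∈ AS S) a

/-- constructor -/
def mkT {S : Finset A} (a : A) (h : a ∈ AS S) : AT S := (⟨a, h⟩ : ↥(AS S))

@[simp] theorem inc_mkT {S : Finset A} (a : A) (h : a ∈ AS S) : inc S (mkT a h) = a := rfl

theorem inc_inj {S : Finset A} {a b : AT S} (h : inc S a = inc S b) : a = b :=
  Subtype.ext (p := fun z => z ∈ AS S) h

theorem norm_inc {S : Finset A} (a : AT S) : ‖inc S a‖ = ‖a‖ := rfl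

theorem continuous_inc {S : Finset A} : Continuous (inc S) := continuous_subtype_val (p := fun z => z ∈ AS S)

theorem mem_AS {S : Finset A} {a : A} (h : a ∈ S) : a ∈ AS S :=
  Subalgebra.le_topologicalClosure _ (Algebra.subset_adjoin h)

theorem AS_mono {S S' : Finset A} (h : S ⊆ S') : AS S ≤ AS S' :=
  Subalgebra.topologicalClosure_mono (Algebra.adjoin_mono (by exact_mod_cast h))

/-- transition -/
def incl {S S' : Finset A} (h : S ⊆ S') : AT S →ₐ[ℂ] AT S' where
  toFun a := mkT (inc S a) (AS_mono h (inc_mem a))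
  map_one' := inc_inj (by rw [inc_mkT, map_one, map_one])
  map_mul' a b := inc_inj (by rw [inc_mkT, map_mul, map_mul, inc_mkT, inc_mkT])
  map_zero' := inc_inj (by rw [inc_mkT, map_zero, map_zero])
  map_add' a b := inc_inj (by rw [inc_mkT, map_add, map_add, inc_mkT, inc_mkT])
  commutes' r := inc_inj (by rw [inc_mkT, AlgHomClass.commutes, AlgHomClass.commutes])

theorem incl_apply {S S' : Finset A} (h : S ⊆ S') (a : AT S) :
    incl h a = mkT (inc S a) (AS_mono h (inc_mem a)) := by
  rw [incl, AlgHom.coe_mk]; rfl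

@[simp] theorem inc_incl {S S' : Finset A} (h : S ⊆ S') (a : AT S) : inc S' (incl h a) = inc S a := by
  rw [incl_apply, inc_mkT]

theorem continuous_incl {S S' : Finset A} (h : S ⊆ S') : Continuous (incl h) :=
  Continuous.subtype_mk (p := fun z => z ∈ AS S') continuous_inc _

theorem exists_sep (S : Finset A) : ∃ L : List (AT S), ∀ x x' : characterSpace ℂ (AT S),
    (∀ a ∈ L, x a = x' a) → x = x' := by
  refine ⟨S.attach.toList.map fun a => mkT a.1 (mem_AS a.2), fun x x' h => ?_⟩
  let E : Subalgebra ℂ (AT S) := AlgHom.equalizer (CharacterSpace.equivAlgHom x) (CharacterSpace.equivAlgHom x')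
  have hE : ∀ a, a ∈ E ↔ x a = x' a := fun a => Iff.rfl
  have hcl : IsClosed (E : Set (AT S)) := by
    have : (E : Set (AT S)) = {a | x a = x' a} := Set.ext fun a => hE a
    rw [this]
    exact isClosed_eq (map_continuous x) (map_continuous x')
  have hce : Topology.IsClosedEmbedding (inc S) :=
    (Subalgebra.isClosed_topologicalClosure (Algebra.adjoin ℂ (S : Set A))).isClosedEmbedding_subtypeVal
  have hle : AS S ≤ E.map (inc S) := by
    refine Subalgebra.topologicalClosure_minimal ?_ ?_
    · rw [Algebra.adjoin_le_iff]
      intro a ha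
      exact ⟨mkT a (mem_AS ha), (hE _).2 (h _ (List.mem_map.2 ⟨⟨a, ha⟩, by simp, rfl⟩)), rfl⟩
    · rw [Subalgebra.coe_map]
      exact hce.isClosedMap _ hcl
  refine CharacterSpace.ext fun a => ?_
  obtain ⟨b, hb, hab⟩ := hle (inc_mem a)
  rw [← inc_inj hab]
  exact (hE b).1 hb

theorem char_cont {B : Type*} [NormedCommRing B] [NormedAlgebra ℂ B] [CompleteSpace B] :
    Topology.IsInducing (fun (x : characterSpace ℂ B) (b : B) => x b) := by
  constructor
  refine le_antisymm ?_ ?_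
  · rw [← continuous_iff_le_induced]
    exact continuous_pi fun b => continuous_char_eval b
  · letI := TopologicalSpace.induced (fun (x : characterSpace ℂ B) (b : B) => x b) Pi.topologicalSpace
    refine continuous_id_iff_le.1 ?_
    refine continuous_char_iff.2 fun b => ?_
    exact (continuous_apply b).comp continuous_induced_dom

theorem exists_larger (S : Finset A) (V : Set (characterSpace ℂ (AT S))) (hV : IsOpen V)
    (h : ∀ x : characterSpace ℂ A, comapChar (inc S) x ∈ V) :
    ∃ S', ∃ hS : S ⊆ S', ∀ x : characterSpace ℂ (AT S'), comapChar (incl hS) x ∈ V := by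
  classical
  by_contra! hcon
  choose y hy using hcon
  let ι := {S' : Finset A // S ⊆ S'}
  let f : ι → A → ℂ := fun T a => if ha : a ∈ AS T.1 then y T.1 T.2 (mkT a ha) else 0
  have hf : ∀ (T : ι) (a : AT T.1), f T (inc T.1 a) = y T.1 T.2 a := by
    intro T a
    simp only [f]
    rw [dif_pos (inc_mem a)]
    congr 1
  let K : Set (A → ℂ) := Set.univ.pi fun a => Metric.closedBall (0 : ℂ) ‖a‖
  have hK : IsCompact K := isCompact_univ_pi fun a => isCompact_closedBall _ _
  have hfK : ∀ T, f T ∈ K := by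
    intro T a _
    rw [mem_closedBall_zero_iff]
    simp only [f]
    split_ifs with ha
    · exact char_le _ _
    · simp
  haveI : Nonempty ι := ⟨⟨S, subset_rfl⟩⟩
  haveI : IsDirectedOrder ι := ⟨fun a b => ⟨⟨a.1 ∪ b.1, a.2.trans Finset.subset_union_left⟩,
    Finset.subset_union_left, Finset.subset_union_right⟩⟩
  obtain ⟨𝒰, h𝒰⟩ : ∃ 𝒰 : Ultrafilter ι, (𝒰 : Filter ι) ≤ Filter.atTop := ⟨_, Ultrafilter.of_le _⟩
  obtain ⟨g, hgK, hg⟩ := hK.ultrafilter_le_nhds' (𝒰.map f) (by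
    rw [Ultrafilter.mem_map]; exact Filter.Eventually.of_forall hfK)
  have hlim : ∀ a, Filter.Tendsto (fun T => f T a) 𝒰 (nhds (g a)) := fun a =>
    (tendsto_pi_nhds.1 (show Filter.Tendsto f 𝒰 (nhds g) from hg)) a
  have hev : ∀ a : A, ∀ᶠ T in (𝒰 : Filter ι), a ∈ AS T.1 := by
    intro a
    have hT := h𝒰 (Filter.mem_atTop (⟨S ∪ {a}, Finset.subset_union_left⟩ : ι))
    filter_upwards [hT] with T hT
    have : S ∪ {a} ⊆ T.1 := hT
    exact mem_AS (this (by simp))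
  have hadd : ∀ a b, g (a + b) = g a + g b := by
    intro a b
    refine tendsto_nhds_unique (hlim _) (((hlim a).add (hlim b)).congr' ?_)
    filter_upwards [hev a, hev b]
    intro T ha hb
    have e1 := inc_mkT a ha
    have e2 := inc_mkT b hb
    rw [← e1, ← e2, ← map_add, hf, hf, hf, map_add]
  have hmul : ∀ a b, g (a * b) = g a * g b := by
    intro a b
    refine tendsto_nhds_unique (hlim _) (((hlim a).mul (hlim b)).congr' ?_)
    filter_upwards [hev a, hev b]
    intro T ha hb
    have e1 := inc_mkT a ha
    have e2 := inc_mkT b hb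
    rw [← e1, ← e2, ← map_mul, hf, hf, hf, map_mul]
  have halg : ∀ r, g (algebraMap ℂ A r) = r := by
    intro r
    refine tendsto_nhds_unique (hlim _) (tendsto_const_nhds.congr ?_)
    intro T
    rw [← AlgHomClass.commutes (inc T.1), hf, AlgHomClass.commutes, Algebra.algebraMap_self_apply]
  let G : A →ₐ[ℂ] ℂ :=
    { toFun := g
      map_one' := by simpa using halg 1
      map_mul' := hmul
      map_zero' := by simpa using halg 0
      map_add' := hadd
      commutes' := halg }
  let x : characterSpace ℂ A := CharacterSpace.equivAlgHom.symm G
  have hx : ∀ a, x a = g a := fun a => rfl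
  have hconv : Filter.Tendsto (fun T : ι => comapChar (incl T.2) (y T.1 T.2)) 𝒰
      (nhds (comapChar (inc S) x)) := by
    rw [char_cont.tendsto_nhds_iff, tendsto_pi_nhds]
    intro a
    have := hlim (inc S a)
    refine this.congr fun T => ?_
    rw [← inc_incl T.2, hf]
    exact (comapChar_apply (incl T.2) (y T.1 T.2) a).symm
  have := hV.isClosed_compl.mem_of_tendsto hconv (Filter.Eventually.of_forall fun T => hy T.1 T.2)
  exact this (h x)
end fgs
end
end Oka


open WeakDual
set_option linter.all false
set_option linter.deprecated false
set_option linter.unusedSectionVars false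
namespace Oka
noncomputable section
universe uP uB
open unitInterval

section gen
variable {A : Type uB} [NormedCommRing A] [NormedAlgebra ℂ A] [CompleteSpace A]
  {A' : Type uB} [NormedCommRing A'] [NormedAlgebra ℂ A'] [CompleteSpace A']
variable {P : Type uP} [TopologicalSpace P] [CompactSpace P] [T2Space P] {Q : Set P}

/-- pullback of points -/
def ptMap (f : A →ₐ[ℂ] A') : C(I × characterSpace ℂ A', I × characterSpace ℂ A) :=
  ⟨fun y => (y.1, comapChar f y.2), continuous_fst.prodMk ((continuous_comapChar f).comp continuous_snd)⟩

theorem continuous_jj : Continuous (jj : A → Cyl A) := by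
  have hL : ∀ a : A, ‖jj a‖ ≤ 1 * ‖a‖ := by
    intro a
    rw [norm_cyl, one_mul]
    exact max_le ((ContinuousMap.norm_le _ (norm_nonneg _)).2 fun y => by rw [fn_jj]; exact char_le _ _)
      (by rw [snd_jj])
  exact (LinearMap.mkContinuous (jj : A →ₐ[ℂ] Cyl A).toLinearMap 1 hL).continuous

/-- functoriality -/
def cylMap (f : A →ₐ[ℂ] A') (z : Cyl A) : Cyl A' :=
  mkC ((fn z).comp (ptMap f)) (f (sd z)) (fun x => by
    rw [ContinuousMap.comp_apply]
    exact (fn_one z (comapChar f x)).trans (comapChar_apply f x _))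

theorem fn_cylMap (f : A →ₐ[ℂ] A') (z : Cyl A) (s : I) (x : characterSpace ℂ A') :
    fn (cylMap f z) (s, x) = fn z (s, comapChar f x) := by
  rw [cylMap, fn_mkC]; rfl

theorem sd_cylMap (f : A →ₐ[ℂ] A') (z : Cyl A) : sd (cylMap f z) = f (sd z) := by
  rw [cylMap, sd_mkC]

theorem continuous_cylMap (f : A →ₐ[ℂ] A') (hf : Continuous f) : Continuous (cylMap f) := by
  refine continuous_cyl ?_ ?_
  · simp only [cylMap, fn_mkC]
    exact (ContinuousMap.continuous_precomp (ptMap f)).comp continuous_fn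
  · simp only [sd_cylMap]
    exact hf.comp continuous_sd

theorem cylMap_zero (f : A →ₐ[ℂ] A') : cylMap f 0 = 0 := by
  refine cyl_ext (fun y => ?_) ?_
  · obtain ⟨s, x⟩ := y
    rw [fn_cylMap, fn_zero, fn_zero]; rfl
  · rw [sd_cylMap, sd_zero, sd_zero, map_zero]

theorem cylMap_sub (f : A →ₐ[ℂ] A') (z z' : Cyl A) : cylMap f (z - z') = cylMap f z - cylMap f z' := by
  refine cyl_ext (fun y => ?_) ?_
  · obtain ⟨s, x⟩ := y
    rw [fn_cylMap, fn_sub, fn_sub, ContinuousMap.sub_apply, ContinuousMap.sub_apply, fn_cylMap, fn_cylMap]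
  · rw [sd_cylMap, sd_sub, sd_sub, map_sub, sd_cylMap, sd_cylMap]

/-- on functions -/
def cMap (f : A →ₐ[ℂ] A') (hf : Continuous f) (g : C(P, Cyl A)) : C(P, Cyl A') :=
  ⟨fun p => cylMap f (g p), (continuous_cylMap f hf).comp g.continuous⟩

theorem cMap_apply (f : A →ₐ[ℂ] A') (hf : Continuous f) (g : C(P, Cyl A)) (p : P) :
    cMap f hf g p = cylMap f (g p) := rfl

theorem cMap_nC (f : A →ₐ[ℂ] A') (hf : Continuous f) (g g' : C(P, Cyl A)) (h : g - g' ∈ nC A Q) :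
    cMap f hf g - cMap f hf g' ∈ nC A' Q := by
  refine mem_nC.2 ⟨fun q hq => ?_, fun p x => ?_⟩
  · rw [ContinuousMap.sub_apply, cMap_apply, cMap_apply, ← cylMap_sub, ← ContinuousMap.sub_apply,
      (mem_nC.1 h).1 q hq, cylMap_zero]
  · rw [ContinuousMap.sub_apply, cMap_apply, cMap_apply, ← cylMap_sub, ← ContinuousMap.sub_apply,
      fn_cylMap, (mem_nC.1 h).2]

/-- full pullback of points -/
def pMap (P : Type uP) [TopologicalSpace P] (f : A →ₐ[ℂ] A') :
    C(P × (I × characterSpace ℂ A'), P × (I × characterSpace ℂ A)) :=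
  ⟨fun y => (y.1, ptMap f y.2), by fun_prop⟩

theorem pMap_apply (f : A →ₐ[ℂ] A') (p : P) (s : I) (x : characterSpace ℂ A') :
    pMap P f (p, (s, x)) = (p, (s, comapChar f x)) := rfl

theorem comap_incl {S S' : Finset A} (h : S ⊆ S') (x : characterSpace ℂ A) :
    comapChar (incl h) (comapChar (inc S') x) = comapChar (inc S) x := by
  refine CharacterSpace.ext fun a => ?_
  rw [comapChar_apply, comapChar_apply, comapChar_apply, inc_incl]

theorem pMap_incl {S S' : Finset A} (h : S ⊆ S') (y : P × (I × characterSpace ℂ A)) :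
    pMap P (incl h) (pMap P (inc S') y) = pMap P (inc S) y := by
  obtain ⟨p, s, x⟩ := y
  rw [pMap_apply, pMap_apply, pMap_apply, comap_incl]

/-- functions depending on finitely many elements -/
def fin (P : Type uP) [TopologicalSpace P] [CompactSpace P] [T2Space P] (A : Type uB) [NormedCommRing A] [NormedAlgebra ℂ A] [CompleteSpace A] :
    StarSubalgebra ℂ C(P × (I × characterSpace ℂ A), ℂ) where
  carrier := {F | ∃ S : Finset A, ∃ G : C(P × (I × characterSpace ℂ (AT S)), ℂ), ∀ y, F y = G (pMap P (inc S) y)}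
  mul_mem' := by
    classical
    rintro F F' ⟨S, G, h⟩ ⟨S', G', h'⟩
    refine ⟨S ∪ S', (G.comp (pMap P (incl Finset.subset_union_left))) * (G'.comp (pMap P (incl Finset.subset_union_right))), fun y => ?_⟩
    rw [ContinuousMap.mul_apply, ContinuousMap.mul_apply, ContinuousMap.comp_apply, ContinuousMap.comp_apply,
      pMap_incl, pMap_incl, h, h']
  add_mem' := by
    classical
    rintro F F' ⟨S, G, h⟩ ⟨S', G', h'⟩
    refine ⟨S ∪ S', (G.comp (pMap P (incl Finset.subset_union_left))) + (G'.comp (pMap P (incl Finset.subset_union_right))), fun y => ?_⟩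
    rw [ContinuousMap.add_apply, ContinuousMap.add_apply, ContinuousMap.comp_apply, ContinuousMap.comp_apply,
      pMap_incl, pMap_incl, h, h']
  algebraMap_mem' r := ⟨∅, algebraMap ℂ _ r, fun y => rfl⟩
  star_mem' := by
    rintro F ⟨S, G, h⟩
    exact ⟨S, star G, fun y => by rw [ContinuousMap.star_apply, ContinuousMap.star_apply, h]⟩

theorem fin_dense (F : C(P × (I × characterSpace ℂ A), ℂ)) (ε : ℝ) (hε : 0 < ε) :
    ∃ S : Finset A, ∃ G : C(P × (I × characterSpace ℂ (AT S)), ℂ), ∀ y, ‖F y - G (pMap P (inc S) y)‖ < ε := by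
  classical
  have htop := ContinuousMap.starSubalgebra_topologicalClosure_eq_top_of_separatesPoints (fin P A) (by
    rintro ⟨p, s, x⟩ ⟨p', s', x'⟩ hne
    by_cases h1 : (p, s) = (p', s')
    · obtain ⟨rfl, rfl⟩ := Prod.mk.inj h1
      have hx : x ≠ x' := fun h => hne (by rw [h])
      obtain ⟨a, ha⟩ : ∃ a, x a ≠ x' a := by
        by_contra! hcon
        exact hx (CharacterSpace.ext hcon)
      refine ⟨_, ⟨⟨fun y => y.2.2 a, (continuous_char_eval a).comp (continuous_snd.comp continuous_snd)⟩,
        ⟨{a}, ⟨fun y => y.2.2 (mkT a (mem_AS (by simp))), (continuous_char_eval _).comp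
          (continuous_snd.comp continuous_snd)⟩, ?_⟩, rfl⟩, ha⟩
      rintro ⟨p, s, x⟩
      exact (comapChar_apply (inc {a}) x (mkT a (mem_AS (by simp)))).symm
    · obtain ⟨φ, hφ⟩ : ∃ φ : C(P × I, ℂ), φ (p, s) ≠ φ (p', s') := by
        by_contra! hcon
        exact h1 (pt_sep hcon)
      exact ⟨_, ⟨⟨fun y => φ (y.1, y.2.1), by fun_prop⟩,
        ⟨∅, ⟨fun y => φ (y.1, y.2.1), by fun_prop⟩, fun y => rfl⟩, rfl⟩, hφ⟩)
  have hF : F ∈ (fin P A).topologicalClosure := by rw [htop]; trivial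
  have hF' : F ∈ closure (fin P A : Set C(P × (I × characterSpace ℂ A), ℂ)) := hF
  obtain ⟨F', ⟨S, G, h⟩, hd⟩ := Metric.mem_closure_iff.1 hF' ε hε
  refine ⟨S, G, fun y => ?_⟩
  rw [← h, ← dist_eq_norm]
  exact (ContinuousMap.dist_lt_iff hε).1 hd y

theorem alg_dense (h : C(P, A)) (ε : ℝ) (hε : 0 < ε) :
    ∃ S : Finset A, ∃ g : C(P, AT S), ∀ p, ‖h p - inc S (g p)‖ < ε := by
  classical
  obtain ⟨t, _, htf, hcov⟩ := (isCompact_range h.continuous).finite_cover_balls hε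
  refine ⟨htf.toFinset, ?_⟩
  let T : P → Set (AT htf.toFinset) := fun p => {e | ‖h p - inc _ e‖ < ε}
  obtain ⟨g, hg⟩ := exists_continuous_forall_mem_convex_of_local_const (t := T) (by
    intro p
    have : T p = (inc htf.toFinset).toLinearMap.restrictScalars ℝ ⁻¹' Metric.ball (h p) ε := by
      ext e
      simp only [T, Set.mem_setOf_eq, Set.mem_preimage, mem_ball_iff_norm, norm_sub_rev (h p)]
      rfl
    rw [this]
    exact (convex_ball _ _).linear_preimage _) (by
    intro p
    obtain ⟨a, ha, hpa⟩ := Set.mem_iUnion₂.1 (hcov ⟨p, rfl⟩)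
    refine ⟨mkT a (mem_AS (by simpa using ha)), ?_⟩
    have : ∀ᶠ y in nhds p, ‖h y - a‖ < ε := by
      have hc : Continuous fun y => ‖h y - a‖ := by fun_prop
      exact hc.continuousAt.eventually_lt_const (mem_ball_iff_norm.1 hpa)
    exact this)
  exact ⟨g, hg⟩

theorem cyl_dense (u : C(P, Cyl A)) (ε : ℝ) (hε : 0 < ε) :
    ∃ S : Finset A, ∃ g : C(P, Cyl (AT S)), ∀ p s x, ‖fn (u p) (s, x) - fn (cylMap (inc S) (g p)) (s, x)‖ < ε := by
  classical
  have hε3 : 0 < ε / 3 := by positivity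
  obtain ⟨S1, h, hh⟩ := alg_dense (⟨fun p => sd (u p), continuous_sd.comp u.continuous⟩ : C(P, A)) (ε / 3) hε3
  let F : C(P × (I × characterSpace ℂ A), ℂ) :=
    ContinuousMap.uncurry ⟨fun p => fn (u p), continuous_fn.comp u.continuous⟩
  have hF : ∀ p s x, F (p, (s, x)) = fn (u p) (s, x) := fun p s x => rfl
  obtain ⟨S2, G, hG⟩ := fin_dense (F - F.comp ⟨fun y => (y.1, (1, y.2.2)), by fun_prop⟩) (ε / 3) hε3
  have hG' : ∀ p s x, ‖fn (u p) (s, x) - fn (u p) (1, x) - G (p, (s, comapChar (inc S2) x))‖ < ε / 3 :=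
    fun p s x => hG (p, (s, x))
  let S := S1 ∪ S2
  have hS1 : S1 ⊆ S := Finset.subset_union_left
  have hS2 : S2 ⊆ S := Finset.subset_union_right
  let G1 : C(P × (I × characterSpace ℂ (AT S)), ℂ) := G.comp (pMap P (incl hS2))
  let G2 : C(P × (I × characterSpace ℂ (AT S)), ℂ) := G1 - G1.comp ⟨fun y => (y.1, (1, y.2.2)), by fun_prop⟩
  have hG2 : ∀ p s x, G2 (p, (s, x)) = G (p, (s, comapChar (incl hS2) x)) - G (p, (1, comapChar (incl hS2) x)) :=
    fun p s x => rfl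
  have hz : ∀ p x, G2.curry p (1, x) = 0 := fun p x => by
    rw [ContinuousMap.curry_apply, hG2, sub_self]
  let g1 : C(P, Cyl (AT S)) := ⟨fun p => zf (G2.curry p) (hz p), by
      refine continuous_cyl ?_ ?_
      · simp only [fn_zf]; exact G2.curry.continuous
      · simp only [snd_zf]; exact continuous_const⟩
  let g2 : C(P, Cyl (AT S)) := ⟨fun p => cylMap (incl hS1) (jj (h p)), by
      refine (continuous_cylMap _ (continuous_incl hS1)).comp ?_
      exact (continuous_jj).comp h.continuous⟩
  refine ⟨S, g1 + g2, fun p s x => ?_⟩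
  have e1 : fn (g1 p) (s, comapChar (inc S) x) = G (p, (s, comapChar (inc S2) x)) - G (p, (1, comapChar (inc S2) x)) := by
    change fn (zf (G2.curry p) (hz p)) _ = _
    rw [fn_zf, ContinuousMap.curry_apply, hG2, comap_incl]
  have e2 : fn (g2 p) (s, comapChar (inc S) x) = x (inc S1 (h p)) := by
    change fn (cylMap (incl hS1) (jj (h p))) _ = _
    rw [fn_cylMap, fn_jj, comap_incl, comapChar_apply]
  rw [fn_cylMap, ContinuousMap.add_apply, fn_add, ContinuousMap.add_apply, e1, e2]
  have a1 := hG' p s x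
  have a2 := hG' p 1 x
  have a3 : ‖x (sd (u p) - inc S1 (h p))‖ < ε / 3 := (char_le _ _).trans_lt (hh p)
  rw [map_sub, ← fn_one] at a3
  calc _ = ‖(fn (u p) (s, x) - fn (u p) (1, x) - G (p, (s, comapChar (inc S2) x)))
        - (fn (u p) (1, x) - fn (u p) (1, x) - G (p, (1, comapChar (inc S2) x)))
        + (fn (u p) (1, x) - x (inc S1 (h p)))‖ := by congr 1; ring
    _ ≤ ‖(fn (u p) (s, x) - fn (u p) (1, x) - G (p, (s, comapChar (inc S2) x)))‖
        + ‖(fn (u p) (1, x) - fn (u p) (1, x) - G (p, (1, comapChar (inc S2) x)))‖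
        + ‖(fn (u p) (1, x) - x (inc S1 (h p)))‖ := (norm_add_le _ _).trans (add_le_add_left (norm_sub_le _ _) _)
    _ < ε := by linarith
end gen
end
end Oka


open WeakDual
set_option linter.all false
set_option linter.deprecated false
set_option linter.unusedSectionVars false
namespace Oka
noncomputable section
universe uP uB
open unitInterval

section gen
variable {A : Type uB} [NormedCommRing A] [NormedAlgebra ℂ A] [CompleteSpace A]
  {A' : Type uB} [NormedCommRing A'] [NormedAlgebra ℂ A'] [CompleteSpace A']
variable {P : Type uP} [TopologicalSpace P] [CompactSpace P] [T2Space P] {Q : Set P}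


variable {d : Type} [Fintype d] [DecidableEq d]

/-- the image vector -/
def img (u : d → C(P, Cyl A)) : C(P × (I × characterSpace ℂ A), d → ℂ) :=
  ⟨fun y i => fn (u i y.1) y.2, continuous_pi fun i =>
    (ContinuousMap.uncurry ⟨fun p => fn (u i p), continuous_fn.comp (u i).continuous⟩).continuous⟩

theorem img_apply (u : d → C(P, Cyl A)) (p : P) (y : I × characterSpace ℂ A) (i : d) :
    img u (p, y) i = fn (u i p) y := rfl

theorem img_ne (u : d → C(P, Cyl A)) (p : P) (s : I) (x : characterSpace ℂ A) :
    img u (p, (s, x)) ≠ 0 ↔ ∃ i, fn (u i p) (s, x) ≠ 0 := by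
  rw [Function.ne_iff]; rfl

theorem img_cMap (f : A →ₐ[ℂ] A') (hf : Continuous f) (u : d → C(P, Cyl A)) (p : P) (s : I) (x : characterSpace ℂ A') :
    img (fun i => cMap f hf (u i)) (p, (s, x)) = img u (p, (s, comapChar f x)) := by
  funext i
  rw [img_apply, img_apply, cMap_apply, fn_cylMap]

theorem nC_img {u v : d → C(P, Cyl A)} (h : ∀ i, v i - u i ∈ nC A Q) (p : P) (s : I) (x : characterSpace ℂ A)
    (hy : (p, s) ∈ NN Q) : img v (p, (s, x)) = img u (p, (s, x)) := by
  funext i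
  rw [img_apply, img_apply, ← sub_eq_zero, ← ContinuousMap.sub_apply, ← fn_sub, ← ContinuousMap.sub_apply]
  rcases hy with hy | hy
  · rw [(mem_nC.1 (h i)).1 p hy, fn_zero]; rfl
  · have hy : s = 0 := hy
    rw [hy, (mem_nC.1 (h i)).2 p x]

theorem kap_mem (φ : C(P × I, ℂ)) (h : ∀ y ∈ NN Q, φ y = 0) : kap (A := A) φ ∈ nC A Q := by
  refine mem_nC.2 ⟨fun q hq => ?_, fun p x => ?_⟩
  · refine cyl_ext (fun y => ?_) ?_
    · obtain ⟨s, x⟩ := y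
      rw [fn_kap, fn_zero, h _ (Or.inl hq)]; rfl
    · change sd (kC (φ.curry q)) = _
      rw [sd_kC, sd_zero, ContinuousMap.curry_apply, h _ (Or.inl hq), map_zero]
  · rw [fn_kap, h _ (Or.inr rfl)]

theorem glp (hQ : IsClosed Q)
    (u : d → C(P, Cyl A)) (hu : ∀ p s x, (p ∈ Q ∨ s = 0) → ∃ i, fn (u i p) (s, x) ≠ 0) :
    ∃ v : d → C(P, Cyl A), (∀ i, v i - u i ∈ nC A Q) ∧ ∀ p s x, ∃ i, fn (v i p) (s, x) ≠ 0 := by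
  classical
  have hNN := isClosed_NN hQ
  -- lower bound
  obtain ⟨c, hc, hcu⟩ : ∃ c > 0, ∀ p s (x : characterSpace ℂ A), (p, s) ∈ NN Q → c ≤ ‖img u (p, (s, x))‖ := by
    let N : Set (P × (I × characterSpace ℂ A)) := {y | (y.1, y.2.1) ∈ NN Q}
    have hN : IsClosed N := hNN.preimage (by fun_prop)
    rcases N.eq_empty_or_nonempty with he | hne
    · exact ⟨1, one_pos, fun p s x h => by
        have : (p, (s, x)) ∈ N := h
        rw [he] at this; exact this.elim⟩
    · obtain ⟨y, hy, hmin⟩ := hN.isCompact.exists_isMinOn hne (img u).continuous.norm.continuousOn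
      refine ⟨‖img u y‖, norm_pos_iff.2 ((img_ne u _ _ _).2 (hu _ _ _ hy)), fun p s x h => hmin (show (p, (s, x)) ∈ N from h)⟩
  let ε := c / 4
  have hε : 0 < ε := by positivity
  have hcε : c = 4 * ε := by simp only [ε]; ring
  choose S0 g hg using fun i => cyl_dense (u i) ε hε
  let S := Finset.univ.biUnion S0
  have hS0 : ∀ i, S0 i ⊆ S := fun i => Finset.subset_biUnion_of_mem S0 (Finset.mem_univ i)
  let uS : d → C(P, Cyl (AT S)) := fun i => cMap (incl (hS0 i)) (continuous_incl _) (g i)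
  have h1 : ∀ p s (x : characterSpace ℂ A), ‖img u (p, (s, x)) - img uS (p, (s, comapChar (inc S) x))‖ < ε := by
    intro p s x
    rw [pi_norm_lt_iff hε]
    intro i
    rw [Pi.sub_apply, img_apply, img_apply]
    have := hg i p s x
    rw [fn_cylMap] at this
    change ‖_ - fn (cylMap (incl (hS0 i)) (g i p)) _‖ < ε
    rwa [fn_cylMap, comap_incl]
  let V : Set (characterSpace ℂ (AT S)) := {x | ∀ t ∈ NN Q, img uS (t.1, (t.2, x)) ≠ 0}
  have hV : IsOpen V := by
    have hcl : IsClosed {y : (P × I) × characterSpace ℂ (AT S) | y.1 ∈ NN Q ∧ img uS (y.1.1, (y.1.2, y.2)) = 0} :=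
      (hNN.preimage continuous_fst).inter (isClosed_eq (by fun_prop) continuous_const)
    have := isClosedMap_snd_of_compactSpace _ hcl
    convert this.isOpen_compl using 1
    ext x
    simp only [V, Set.mem_setOf_eq, Set.mem_compl_iff, Set.mem_image, not_exists]
    constructor
    · rintro h y ⟨⟨hy1, hy2⟩, rfl⟩
      exact h _ hy1 hy2
    · intro h t ht h0
      exact h (t, x) ⟨⟨ht, h0⟩, rfl⟩
  obtain ⟨S', hS, hS'⟩ := exists_larger S V hV (by
    intro x t ht h0
    have := h1 t.1 t.2 x
    rw [h0, sub_zero] at this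
    have := hcu t.1 t.2 x ht
    linarith)
  let u' : d → C(P, Cyl (AT S')) := fun i => cMap (incl hS) (continuous_incl _) (uS i)
  obtain ⟨L, hL⟩ := exists_sep S'
  obtain ⟨v', hv1, hv2⟩ := glp_fg L hL hQ u' (by
    intro p s x h
    rw [← img_ne, img_cMap]
    exact hS' x (p, s) h)
  let w : d → C(P, Cyl A) := fun i => cMap (inc S') (continuous_inc) (v' i)
  let b : d → C(P, Cyl A) := fun i => cMap (inc S') (continuous_inc) (u' i)
  have hwb : ∀ i, w i - b i ∈ nC A Q := fun i => cMap_nC _ _ _ _ (hv1 i)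
  have hb : ∀ p s (x : characterSpace ℂ A), img b (p, (s, x)) = img uS (p, (s, comapChar (inc S) x)) := by
    intro p s x
    rw [img_cMap, img_cMap, comap_incl]
  have hw : ∀ p s (x : characterSpace ℂ A), img w (p, (s, x)) ≠ 0 := by
    intro p s x
    rw [img_cMap, img_ne]
    exact hv2 _ _ _
  let D : Set (P × I) := {t | ∃ x, ‖img w (t.1, (t.2, x))‖ ≤ 2 * ε}
  have hD : IsClosed D := by
    have hcl : IsClosed {y : (P × I) × characterSpace ℂ A | ‖img w (y.1.1, (y.1.2, y.2))‖ ≤ 2 * ε} :=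
      isClosed_le (by fun_prop) continuous_const
    convert isClosedMap_fst_of_compactSpace _ hcl using 1
    ext t
    simp only [D, Set.mem_setOf_eq, Set.mem_image]
    constructor
    · rintro ⟨x, hx⟩
      exact ⟨(t, x), hx, rfl⟩
    · rintro ⟨y, hy, rfl⟩
      exact ⟨_, hy⟩
  have hdis : Disjoint D (NN Q) := by
    rw [Set.disjoint_left]
    rintro ⟨p, s⟩ ⟨x, hx⟩ ht
    simp only [] at hx
    rw [nC_img hwb p s x ht, hb] at hx
    have a1 := hcu p s x ht
    have a2 := h1 p s x
    have a3 := norm_sub_norm_le (img u (p, (s, x))) (img uS (p, (s, comapChar (inc S) x)))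
    linarith
  obtain ⟨f, hf0, hf1, hf⟩ := exists_continuous_zero_one_of_isClosed hD hNN hdis
  let ψ : C(P × I, ℂ) := ⟨fun t => (f t : ℂ), by fun_prop⟩
  refine ⟨fun i => w i + kap ψ * (u i - b i), fun i => ?_, fun p s x => ?_⟩
  · have : w i + kap ψ * (u i - b i) - u i = (w i - b i) + kap (ψ - 1) * (u i - b i) := by
      rw [map_sub, map_one]; ring
    rw [this]
    refine Ideal.add_mem _ (hwb i) (Ideal.mul_mem_right _ _ (kap_mem _ ?_))
    intro y hy
    change ((f y : ℝ) : ℂ) - 1 = 0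
    rw [hf1 hy]; simp
  · rw [← img_ne]
    have he : img (fun i => w i + kap ψ * (u i - b i)) (p, (s, x)) =
        img w (p, (s, x)) + (f (p, s) : ℂ) • (img u (p, (s, x)) - img b (p, (s, x))) := by
      funext i
      rw [img_apply, ContinuousMap.add_apply, fn_add, ContinuousMap.add_apply, ContinuousMap.mul_apply, fn_mul,
        ContinuousMap.mul_apply, fn_kap, ContinuousMap.sub_apply, fn_sub, ContinuousMap.sub_apply]
      rfl
    rw [he]
    by_cases hd : (p, s) ∈ D
    · rw [hf0 hd]
      simpa using hw p s x
    · intro h0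
      apply hd
      refine ⟨x, ?_⟩
      have h2 := h1 p s x
      rw [← hb] at h2
      have h3 : ‖img w (p, (s, x))‖ = ‖(f (p, s) : ℂ) • (img u (p, (s, x)) - img b (p, (s, x)))‖ := by
        rw [eq_neg_of_add_eq_zero_left h0, norm_neg]
      change ‖img w (p, (s, x))‖ ≤ _
      rw [h3, norm_smul, Complex.norm_real, Real.norm_of_nonneg (hf _).1]
      nlinarith [(hf (p, s)).1, (hf (p, s)).2, norm_nonneg (img u (p, (s, x)) - img b (p, (s, x)))]
end gen
end
end Oka


open WeakDual
set_option linter.all false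
set_option linter.deprecated false
set_option linter.unusedSectionVars false
namespace Oka
noncomputable section
universe uJ uE
open unitInterval

/-- relative lifting property -/
def RLP {E : Type uE} [TopologicalSpace E] {F : Type uJ} [TopologicalSpace F] (π : E → F) (W : Set F) : Prop :=
  ∀ (P : Type uJ) [TopologicalSpace P] [CompactSpace P] [T2Space P] (Q : Set P), IsClosed Q →
    ∀ f : C(P, F), (∀ p, f p ∈ W) → ∀ e : P → E, ContinuousOn e Q → (∀ q ∈ Q, π (e q) = f q) →
      ∃ e' : C(P, E), (∀ p, π (e' p) = f p) ∧ ∀ q ∈ Q, e' q = e q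

section simp
variable {J : Type uJ}

/-- simplex -/
def Δ (G : Finset J) : Set (J → ℝ) := {t | (∀ j, 0 ≤ t j) ∧ (∀ j, j ∉ G → t j = 0) ∧ ∑ j ∈ G, t j = 1}

theorem isClosed_Δ (G : Finset J) : IsClosed (Δ G) := by
  refine IsClosed.inter (s₁ := {t : J → ℝ | ∀ j, 0 ≤ t j}) ?_ (IsClosed.inter (s₁ := {t : J → ℝ | ∀ j, j ∉ G → t j = 0})
    (s₂ := {t : J → ℝ | ∑ j ∈ G, t j = 1}) ?_ ?_)
  · simp only [Set.setOf_forall]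
    exact isClosed_iInter fun j => isClosed_le continuous_const (continuous_apply j)
  · simp only [Set.setOf_forall]
    exact isClosed_iInter fun j => isClosed_iInter fun _ => isClosed_eq (continuous_apply j) continuous_const
  · exact isClosed_eq (continuous_finsetSum _ fun j _ => continuous_apply j) continuous_const

theorem isCompact_Δ (G : Finset J) : IsCompact (Δ G) := by
  refine (isCompact_univ_pi (s := fun _ : J => Set.Icc (0 : ℝ) 1) fun _ => isCompact_Icc).of_isClosed_subset (isClosed_Δ G) ?_
  rintro t ⟨h0, h1, h2⟩ j _
  refine ⟨h0 j, ?_⟩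
  by_cases hj : j ∈ G
  · rw [← h2]; exact Finset.single_le_sum (fun i _ => h0 i) hj
  · rw [h1 j hj]; exact zero_le_one

theorem Δ_mono {G G' : Finset J} (h : G ⊆ G') : Δ G ⊆ Δ G' := by
  rintro t ⟨h0, h1, h2⟩
  refine ⟨h0, fun j hj => h1 j fun h' => hj (h h'), ?_⟩
  rw [← h2]
  exact (Finset.sum_subset h fun j _ hj => h1 j hj).symm

theorem supp_sub {G : Finset J} {t : J → ℝ} (h : t ∈ Δ G) : Function.support t ⊆ G := by
  intro j hj
  by_contra h'
  exact hj (h.2.1 j h')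

theorem mem_of_supp {G G' : Finset J} {t : J → ℝ} (h : t ∈ Δ G) (hs : Function.support t ⊆ G') : t ∈ Δ G' := by
  classical
  have h1 : t ∈ Δ (G ∪ G') := Δ_mono Finset.subset_union_left h
  refine ⟨h.1, fun j hj => by by_contra h'; exact hj (hs h'), ?_⟩
  rw [← h1.2.2]
  refine Finset.sum_subset Finset.subset_union_right fun j _ hj => ?_
  by_contra h'; exact hj (hs h')

variable {E : Type uE} [TopologicalSpace E] [Nonempty E] {F : Type uJ} [TopologicalSpace F]
  (π : E → F) (W : Set F) (K : Set (Finset J)) (f : (J → ℝ) → F)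

/-- partial lift over the skeleton -/
def Good (n : ℕ) (e : (J → ℝ) → E) : Prop :=
  ∀ G ∈ K, G.card ≤ n → ContinuousOn e (Δ G) ∧ ∀ t ∈ Δ G, π (e t) = f t

theorem skel_step (hR : RLP π W) (hK : ∀ G ∈ K, ∀ G', G' ⊆ G → G' ∈ K)
    (hf : ∀ G ∈ K, ContinuousOn f (Δ G)) (hfW : ∀ G ∈ K, ∀ t ∈ Δ G, f t ∈ W) (n : ℕ) (e : (J → ℝ) → E)
    (he : Good π K f n e) : ∃ e', Good π K f (n + 1) e' ∧ ∀ G ∈ K, G.card ≤ n → Set.EqOn e e' (Δ G) := by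
  classical
  have key : ∀ G : Finset J, ∃ l : (J → ℝ) → E, G ∈ K → G.card = n + 1 → ContinuousOn l (Δ G) ∧ (∀ t ∈ Δ G, π (l t) = f t) ∧
      ∀ t ∈ Δ G, (∃ j ∈ G, t j = 0) → l t = e t := by
    intro G
    by_cases hG : G ∈ K ∧ G.card = n + 1
    swap
    · exact ⟨e, fun h h' => (hG ⟨h, h'⟩).elim⟩
    obtain ⟨hG, hn⟩ := hG
    haveI : CompactSpace (Δ G) := isCompact_iff_compactSpace.1 (isCompact_Δ G)
    have hface : ∀ j ∈ G, (G.erase j) ∈ K ∧ (G.erase j).card ≤ n := fun j hj =>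
      ⟨hK G hG _ (Finset.erase_subset _ _), by rw [Finset.card_erase_of_mem hj, hn]; omega⟩
    let Q : Set (Δ G) := ⋃ j : G, {t | (t : J → ℝ) ∈ Δ (G.erase j)}
    have hcl : ∀ j : G, IsClosed {t : Δ G | (t : J → ℝ) ∈ Δ (G.erase j)} := fun j =>
      (isClosed_Δ _).preimage continuous_subtype_val
    obtain ⟨l, hl1, hl2⟩ := hR (Δ G) Q (isClosed_iUnion_of_finite hcl) ⟨fun t => f t, continuousOn_iff_continuous_restrict.1 (hf G hG)⟩
      (fun t => hfW G hG t t.2) (fun t => e t) (by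
        refine LocallyFinite.continuousOn_iUnion (locallyFinite_of_finite _) hcl fun j => ?_
        refine ((he _ (hface j j.2).1 (hface j j.2).2).1).comp continuous_subtype_val.continuousOn ?_
        intro t ht; exact ht) (by
        intro t ht
        obtain ⟨j, hj⟩ := Set.mem_iUnion.1 ht
        exact (he _ (hface j j.2).1 (hface j j.2).2).2 t hj)
    refine ⟨fun t => if h : t ∈ Δ G then l ⟨t, h⟩ else Classical.arbitrary E, fun _ _ => ⟨?_, ?_, ?_⟩⟩
    · rw [continuousOn_iff_continuous_restrict]
      convert l.continuous using 1
      funext t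
      simp [Set.restrict]
    · intro t ht
      simp only [ht, dif_pos]
      exact hl1 ⟨t, ht⟩
    · rintro t ht ⟨j, hj, h0⟩
      simp only [ht, dif_pos]
      refine hl2 ⟨t, ht⟩ (Set.mem_iUnion.2 ⟨⟨j, hj⟩, mem_of_supp ht ?_⟩)
      intro i hi
      have : i ≠ j := fun h => hi (h ▸ h0)
      exact Finset.mem_coe.2 (Finset.mem_erase.2 ⟨this, supp_sub ht hi⟩)
  choose l hl using key
  let e' : (J → ℝ) → E := fun t => if h : ∃ G ∈ K, G.card = n + 1 ∧ Function.support t = G then l h.choose t else e t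
  have hlow : ∀ t : J → ℝ, (¬ ∃ G : Finset J, G.card = n + 1 ∧ Function.support t = G) → e' t = e t := by
    intro t ht
    have : ¬ ∃ G ∈ K, G.card = n + 1 ∧ Function.support t = G := fun ⟨G, _, h⟩ => ht ⟨G, h⟩
    simp only [e', this, dif_neg, not_false_eq_true]
  have hsmall : ∀ G : Finset J, G.card ≤ n → Set.EqOn e e' (Δ G) := by
    intro G hG t ht
    refine (hlow t ?_).symm
    rintro ⟨G', hc, hs⟩
    have : G' ⊆ G := by
      have := supp_sub ht
      rw [hs] at this
      exact Finset.coe_subset.1 this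
    have := Finset.card_le_card this
    omega
  have hbig : ∀ G ∈ K, G.card = n + 1 → Set.EqOn (l G) e' (Δ G) := by
    intro G hGK hc t ht
    by_cases hs : Function.support t = G
    · have hex : ∃ G ∈ K, G.card = n + 1 ∧ Function.support t = G := ⟨G, hGK, hc, hs⟩
      have h2 : hex.choose = G := Finset.coe_injective (by rw [← hex.choose_spec.2.2, hs])
      simp only [e', hex, dif_pos]
      rw [h2]
    · obtain ⟨j, hj, hj0⟩ : ∃ j ∈ G, t j = 0 := by
        by_contra! hcon
        exact hs (subset_antisymm (supp_sub ht) fun j hj => hcon j hj)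
      rw [(hl G hGK hc).2.2 t ht ⟨j, hj, hj0⟩, hlow]
      rintro ⟨G', hc', hs'⟩
      have hsub : G' ⊆ G := by
        have := supp_sub ht
        rw [hs'] at this
        exact Finset.coe_subset.1 this
      have : G' = G := Finset.eq_of_subset_of_card_le hsub (by omega)
      exact hs (this ▸ hs')
  refine ⟨e', fun G hG hc => ?_, fun G _ hc => hsmall G hc⟩
  rcases Nat.lt_or_ge n G.card with h | h
  · have hc : G.card = n + 1 := by omega
    have hb := hbig G hG hc
    exact ⟨(hl G hG hc).1.congr hb.symm, fun t ht => by rw [← hb ht]; exact (hl G hG hc).2.1 t ht⟩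
  · have hb := hsmall G h
    exact ⟨(he G hG h).1.congr hb.symm, fun t ht => by rw [← hb ht]; exact (he G hG h).2 t ht⟩

theorem skel (hR : RLP π W) (hK : ∀ G ∈ K, ∀ G', G' ⊆ G → G' ∈ K)
    (hf : ∀ G ∈ K, ContinuousOn f (Δ G)) (hfW : ∀ G ∈ K, ∀ t ∈ Δ G, f t ∈ W) :
    ∃ e : (J → ℝ) → E, ∀ G ∈ K, ContinuousOn e (Δ G) ∧ ∀ t ∈ Δ G, π (e t) = f t := by
  classical
  choose! st hst1 hst2 using skel_step π W K f hR hK hf hfW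
  let e : ℕ → (J → ℝ) → E := fun n => Nat.rec (fun _ => Classical.arbitrary E) (fun n x => st n x) n
  have hsucc : ∀ n, e (n + 1) = st n (e n) := fun n => rfl
  have hg : ∀ n, Good π K f n (e n) := by
    intro n
    induction n with
    | zero =>
      intro G _ hc
      have : Δ G = ∅ := by
        ext t
        have : G = ∅ := Finset.card_eq_zero.1 (by omega)
        simp [Δ, this]
      rw [this]
      simp
    | succ n ih => rw [hsucc]; exact hst1 n _ ih
  have hag : ∀ k n, ∀ G ∈ K, G.card ≤ n → Set.EqOn (e n) (e (n + k)) (Δ G) := by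
    intro k n G hG hc
    induction k with
    | zero => exact fun _ _ => rfl
    | succ k ih =>
      refine ih.trans ?_
      rw [← add_assoc, hsucc]
      exact hst2 _ _ (hg _) G hG (by omega)
  refine ⟨fun t => e (Function.support t).ncard t, fun G hG => ?_⟩
  have heq : Set.EqOn (fun t => e (Function.support t).ncard t) (e G.card) (Δ G) := by
    intro t ht
    have hs := supp_sub ht
    have hfin : (Function.support t).Finite := G.finite_toSet.subset hs
    have hsub : hfin.toFinset ⊆ G := by
      rw [← Finset.coe_subset, hfin.coe_toFinset]; exact hs
    have hle := Finset.card_le_card hsub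
    have hnc : (Function.support t).ncard = hfin.toFinset.card := Set.ncard_eq_toFinset_card _ hfin
    have := hag (G.card - hfin.toFinset.card) hfin.toFinset.card _ (hK G hG _ hsub) le_rfl
      (mem_of_supp ht (by rw [hfin.coe_toFinset]))
    rw [Nat.add_sub_cancel' hle] at this
    simp only [hnc]
    exact this
  exact ⟨(hg _ G hG le_rfl).1.congr heq, fun t ht => by rw [heq ht]; exact (hg _ G hG le_rfl).2 t ht⟩
end simp
end
end Oka


open WeakDual
set_option linter.all false
set_option linter.deprecated false
set_option linter.unusedSectionVars false
namespace Oka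
noncomputable section
universe uJ uE
open unitInterval

theorem nerve {E : Type uE} [TopologicalSpace E] [Nonempty E] {F : Type uJ} [NormedAddCommGroup F] [NormedSpace ℝ F]
    (π : E → F) (W C : Set F) (hC : Convex ℝ C) (hWC : W ⊆ C)
    (hW : ∀ w ∈ W, ∃ r > 0, Metric.ball w r ∩ C ⊆ W) (hR : RLP π W) :
    ∃ sg : C(W, E), ∀ w : W, segment ℝ (w : F) (π (sg w)) ⊆ W := by
  classical
  choose r hr hrW using fun w : W => hW w w.2
  let U : W → Set W := fun j => {w | ‖(w : F) - j‖ < r j / 2}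
  have hU : ∀ j, IsOpen (U j) := fun j => isOpen_lt (by fun_prop) continuous_const
  obtain ⟨ρ, hρ⟩ := PartitionOfUnity.exists_isSubordinate (isClosed_univ (X := W)) U hU (fun w _ =>
    Set.mem_iUnion.2 ⟨w, by simp only [U, Set.mem_setOf_eq, sub_self, norm_zero]; exact half_pos (hr w)⟩)
  let K : Set (Finset W) := {G | ∃ w : W, ∀ j ∈ G, w ∈ U j}
  let f : (W → ℝ) → F := fun t => ∑ᶠ j, t j • (j : F)
  have hfG : ∀ G : Finset W, Set.EqOn f (fun t => ∑ j ∈ G, t j • (j : F)) (Δ G) := by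
    intro G t ht
    refine finsum_eq_sum_of_support_subset _ ?_
    intro j hj
    refine supp_sub ht ?_
    intro h0
    exact hj (by simp [h0])
  have hseg : ∀ (G : Finset W) (w : W), (∀ j ∈ G, w ∈ U j) → ∀ t ∈ Δ G, segment ℝ (w : F) (f t) ⊆ W := by
    intro G w hw t ht
    have hne : G.Nonempty := by
      rw [Finset.nonempty_iff_ne_empty]
      rintro rfl
      have := ht.2.2
      simp at this
    obtain ⟨j0, hj0, hmax⟩ := Finset.exists_max_image G r hne
    refine Set.Subset.trans ?_ (hrW j0)
    have hcv : Convex ℝ (Metric.ball (j0 : F) (r j0) ∩ C) := (convex_ball _ _).inter hC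
    refine hcv.segment_subset ⟨?_, hWC w.2⟩ ?_
    · rw [mem_ball_iff_norm]
      have h1 : ‖(w : F) - j0‖ < r j0 / 2 := hw j0 hj0
      have := hr j0
      linarith
    · rw [hfG G ht]
      refine hcv.sum_mem (fun j _ => ht.1 j) ht.2.2 fun j hj => ⟨?_, hWC j.2⟩
      rw [mem_ball_iff_norm]
      have h1 : ‖(w : F) - j0‖ < r j0 / 2 := hw j0 hj0
      have h2 : ‖(w : F) - j‖ < r j / 2 := hw j hj
      have h3 := hmax j hj
      have h4 : (j : F) - j0 = ((w : F) - j0) - ((w : F) - j) := by abel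
      rw [h4]
      exact (norm_sub_le _ _).trans_lt (by linarith)
  obtain ⟨e, he⟩ := skel π W K f hR (fun G ⟨w, hw⟩ G' h => ⟨w, fun j hj => hw j (h hj)⟩)
    (fun G _ => by
      refine ContinuousOn.congr ?_ (hfG G)
      fun_prop)
    (fun G ⟨w, hw⟩ t ht => hseg G w hw t ht (right_mem_segment _ _ _))
  let τ : W → (W → ℝ) := fun w j => ρ j w
  have hτ : Continuous τ := continuous_pi fun j => (ρ j).continuous
  have hfin : ∀ w, ∃ G : Finset W, (G : Set W) = Function.support (τ w) ∧ τ w ∈ Δ G ∧ ∀ j ∈ G, w ∈ U j := by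
    intro w
    have hf : (Function.support (τ w)).Finite := ρ.locallyFinite.point_finite w
    refine ⟨hf.toFinset, hf.coe_toFinset, ⟨fun j => ρ.nonneg j w, ?_, ?_⟩, ?_⟩
    · intro j hj
      by_contra h
      exact hj (hf.mem_toFinset.2 h)
    · have := ρ.sum_eq_one (Set.mem_univ w)
      rw [← this]
      exact (finsum_eq_sum_of_support_subset _ (by rw [hf.coe_toFinset])).symm
    · intro j hj
      exact hρ j (subset_tsupport _ (hf.mem_toFinset.1 hj))
  have hcont : Continuous fun w => e (τ w) := by
    rw [continuous_iff_continuousAt]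
    intro w0
    obtain ⟨N, hN, hNf⟩ := ρ.locallyFinite w0
    let ι := {G : Finset W // G ⊆ hNf.toFinset ∧ G ∈ K}
    haveI : Finite ι := Set.Finite.to_subtype (Set.Finite.subset (hNf.toFinset.powerset.finite_toSet)
      fun G hG => Finset.mem_coe.2 (Finset.mem_powerset.2 hG.1))
    let T : ι → Set W := fun G => {w | ∀ j ∉ G.1, τ w j = 0}
    have hT : ∀ G, IsClosed (T G) := by
      intro G
      simp only [T, Set.setOf_forall]
      exact isClosed_iInter fun j => isClosed_iInter fun _ => isClosed_eq ((continuous_apply j).comp hτ) continuous_const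
    have hon : ContinuousOn (fun w => e (τ w)) (⋃ G, T G) := by
      refine LocallyFinite.continuousOn_iUnion (locallyFinite_of_finite _) hT fun G => ?_
      refine (he G.1 G.2.2).1.comp hτ.continuousOn ?_
      intro w hw
      obtain ⟨G', h1, h2, h3⟩ := hfin w
      refine mem_of_supp h2 ?_
      intro j hj
      by_contra h
      exact hj (hw j h)
    refine hon.continuousAt (Filter.mem_of_superset hN ?_)
    intro w hw
    obtain ⟨G', h1, h2, h3⟩ := hfin w
    refine Set.mem_iUnion.2 ⟨⟨G', ?_, w, h3⟩, fun j hj => h2.2.1 j hj⟩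
    intro j hj
    rw [hNf.mem_toFinset]
    refine ⟨w, ?_, hw⟩
    have : j ∈ Function.support (τ w) := by rw [← h1]; exact hj
    exact this
  refine ⟨⟨fun w => e (τ w), hcont⟩, fun w => ?_⟩
  obtain ⟨G', h1, h2, h3⟩ := hfin w
  change segment ℝ (w : F) (π (e (τ w))) ⊆ W
  rw [(he G' ⟨w, h3⟩).2 _ h2]
  exact hseg G' w h3 _ h2
end
end Oka


open WeakDual
set_option linter.all false
set_option linter.deprecated false
set_option linter.unusedSectionVars false
namespace Oka
noncomputable section
universe uJ uE
open unitInterval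

theorem line_hom {Y : Type*} [TopologicalSpace Y] {F : Type*} [NormedAddCommGroup F] [NormedSpace ℝ F] {S : Set F}
    (f g : C(Y, S)) (h : ∀ y, segment ℝ (f y : F) (g y) ⊆ S) : ContinuousMap.Homotopic f g := by
  have hmem : ∀ y : I × Y, (f y.2 : F) + (y.1 : ℝ) • ((g y.2 : F) - f y.2) ∈ S := by
    rintro ⟨s, y⟩
    refine h y ?_
    rw [segment_eq_image']
    exact ⟨s, s.2, rfl⟩
  refine ⟨⟨⟨fun y => ⟨_, hmem y⟩, ?_⟩, ?_, ?_⟩⟩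
  · refine Continuous.subtype_mk ?_ _
    have h1 : Continuous fun y : I × Y => (f y.2 : F) := continuous_subtype_val.comp (f.continuous.comp continuous_snd)
    have h2 : Continuous fun y : I × Y => (g y.2 : F) := continuous_subtype_val.comp (g.continuous.comp continuous_snd)
    have h3 : Continuous fun y : I × Y => (y.1 : ℝ) := continuous_subtype_val.comp continuous_fst
    exact h1.add (h3.smul (h2.sub h1))
  · intro y
    exact Subtype.ext (by simp)
  · intro y
    exact Subtype.ext (by simp)

section he
variable {EE FF : Type uJ} [NormedAddCommGroup EE] [NormedSpace ℝ EE] [NormedAddCommGroup FF] [NormedSpace ℝ FF]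
  (π : EE →L[ℝ] FF) (E : Set EE) (W : Set FF)

/-- the path version of the projection -/
def πP (Θ : C(I, E)) : C(I, FF) × EE × EE :=
  (⟨fun s => π (Θ s), π.continuous.comp (continuous_subtype_val.comp Θ.continuous)⟩, (Θ 0 : EE), (Θ 1 : EE))

/-- compatible triples -/
def CP : Set (C(I, FF) × EE × EE) := {y | y.1 0 = π y.2.1 ∧ y.1 1 = π y.2.2}

/-- admissible triples -/
def WP : Set (C(I, FF) × EE × EE) := {y | y ∈ CP π ∧ (∀ s, y.1 s ∈ W) ∧ y.2.1 ∈ E ∧ y.2.2 ∈ E}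

theorem convex_CP : Convex ℝ (CP π) := by
  rintro ⟨Γ, a, b⟩ ⟨h0, h1⟩ ⟨Γ', a', b'⟩ ⟨h0', h1'⟩ s t hs ht hst
  simp only [] at h0 h1 h0' h1'
  constructor
  · change s • Γ 0 + t • Γ' 0 = π (s • a + t • a')
    rw [h0, h0', map_add, map_smul, map_smul]
  · change s • Γ 1 + t • Γ' 1 = π (s • b + t • b')
    rw [h1, h1', map_add, map_smul, map_smul]

theorem WP_open (hE : IsOpen E) (hW : IsOpen W) : ∀ w ∈ WP π E W, ∃ r > 0, Metric.ball w r ∩ CP π ⊆ WP π E W := by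
  intro w hw
  have ho : IsOpen {y : C(I, FF) × EE × EE | (∀ s, y.1 s ∈ W) ∧ y.2.1 ∈ E ∧ y.2.2 ∈ E} := by
    refine IsOpen.inter (s := {y : C(I, FF) × EE × EE | ∀ s, y.1 s ∈ W}) ?_
      ((hE.preimage (continuous_fst.comp continuous_snd)).inter (hE.preimage (continuous_snd.comp continuous_snd)))
    have := (ContinuousMap.isOpen_setOf_mapsTo (isCompact_univ (X := I)) hW).preimage
      (continuous_fst : Continuous fun y : C(I, FF) × EE × EE => y.1)
    convert this using 1
    ext y
    simp [Set.MapsTo]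
  obtain ⟨r, hr, hb⟩ := Metric.isOpen_iff.1 ho w hw.2
  exact ⟨r, hr, fun y hy => ⟨hy.2, hb hy.1⟩⟩

theorem RLP_path (hR : RLP (fun e : E => π e) W) : RLP (πP π E) (WP π E W) := by
  classical
  intro P _ _ _ Q hQ f hf e he hef
  let Q1 : Set (P × I) := {y | y.1 ∈ Q}
  let Q2 : Set (P × I) := {y | y.2 = 0}
  let Q3 : Set (P × I) := {y | y.2 = 1}
  have c1 : IsClosed Q1 := hQ.preimage continuous_fst
  have c2 : IsClosed Q2 := isClosed_eq continuous_snd continuous_const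
  have c3 : IsClosed Q3 := isClosed_eq continuous_snd continuous_const
  let a : P → E := fun p => ⟨(f p).2.1, (hf p).2.2.1⟩
  let b : P → E := fun p => ⟨(f p).2.2, (hf p).2.2.2⟩
  have ha : Continuous a := Continuous.subtype_mk (by fun_prop) _
  have hb : Continuous b := Continuous.subtype_mk (by fun_prop) _
  let e2 : P × I → E := fun y => if y.1 ∈ Q then e y.1 y.2 else if y.2 = 0 then a y.1 else b y.1
  have d1 : ∀ y ∈ Q1, e2 y = e y.1 y.2 := fun y hy => by
    have hy : y.1 ∈ Q := hy
    simp only [e2, hy, if_true]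
  have d2 : ∀ y ∈ Q2, e2 y = a y.1 := by
    rintro ⟨p, s⟩ hy
    have hy : s = 0 := hy
    subst hy
    by_cases hp : p ∈ Q
    · rw [d1 _ hp]
      have := hef p hp
      exact Subtype.ext (congrArg (fun z => z.2.1) this)
    · simp only [e2, hp, if_false, if_true]
  have d3 : ∀ y ∈ Q3, e2 y = b y.1 := by
    rintro ⟨p, s⟩ hy
    have hy : s = 1 := hy
    subst hy
    by_cases hp : p ∈ Q
    · rw [d1 _ hp]
      have := hef p hp
      exact Subtype.ext (congrArg (fun z => z.2.2) this)
    · have : (1 : I) ≠ 0 := one_ne_zero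
      simp only [e2, hp, if_false, this]
  have k1 : ContinuousOn e2 Q1 := by
    refine ContinuousOn.congr ?_ d1
    have : ContinuousOn (fun y : P × I => (e y.1, y.2)) Q1 :=
      (he.comp continuous_fst.continuousOn fun y hy => hy).prodMk continuous_snd.continuousOn
    exact (ContinuousEval.continuous_eval (F := C(I, E))).comp_continuousOn this
  have k2 : ContinuousOn e2 Q2 := ContinuousOn.congr (ha.comp continuous_fst).continuousOn d2
  have k3 : ContinuousOn e2 Q3 := ContinuousOn.congr (hb.comp continuous_fst).continuousOn d3
  let f2 : C(P × I, FF) := ContinuousMap.uncurry ⟨fun p => (f p).1, by fun_prop⟩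
  have hf2 : ∀ p s, f2 (p, s) = (f p).1 s := fun p s => rfl
  obtain ⟨L, hL1, hL2⟩ := hR (P × I) (Q1 ∪ (Q2 ∪ Q3)) (c1.union (c2.union c3)) f2
    (by rintro ⟨p, s⟩; exact (hf p).2.1 s) e2
    (k1.union_of_isClosed (k2.union_of_isClosed k3 c2 c3) c1 (c2.union c3)) (by
      rintro ⟨p, s⟩ (h | h | h)
      · rw [d1 _ h, hf2, ← hef p h]; rfl
      · rw [d2 _ h, hf2]
        have h : s = 0 := h
        rw [h]; exact (hf p).1.1.symm
      · rw [d3 _ h, hf2]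
        have h : s = 1 := h
        rw [h]; exact (hf p).1.2.symm)
  refine ⟨L.curry, fun p => ?_, fun q hq => ?_⟩
  · refine Prod.ext ?_ (Prod.ext ?_ ?_)
    · ext s
      exact hL1 (p, s)
    · change (L (p, 0) : EE) = (f p).2.1
      rw [hL2 (p, 0) (Or.inr (Or.inl rfl)), d2 _ rfl]
    · change (L (p, 1) : EE) = (f p).2.2
      rw [hL2 (p, 1) (Or.inr (Or.inr rfl)), d3 _ rfl]
  · ext s
    change (L (q, s) : EE) = _
    rw [hL2 (q, s) (Or.inl hq), d1 _ hq]

theorem he_of_RLP [Nonempty E] (hE : IsOpen E) (hW : IsOpen W) (hπ : ∀ e ∈ E, π e ∈ W)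
    (hR : RLP (fun e : E => π e) W) : ∃ h : ContinuousMap.HomotopyEquiv E W, ∀ e : E, (h e : FF) = π e := by
  obtain ⟨sg, hsg⟩ := nerve (fun e : E => π e) W Set.univ convex_univ (Set.subset_univ _) (by
    intro w hw
    obtain ⟨r, hr, h⟩ := Metric.isOpen_iff.1 hW w hw
    exact ⟨r, hr, fun y hy => h hy.1⟩) hR
  haveI : Nonempty C(I, E) := ⟨ContinuousMap.const _ (Classical.arbitrary E)⟩
  obtain ⟨tg, htg⟩ := nerve (πP π E) (WP π E W) (CP π) (convex_CP π) (fun w hw => hw.1) (WP_open π E W hE hW)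
    (RLP_path π E W hR)
  let p : C(E, W) := ⟨fun e => ⟨π e, hπ e e.2⟩, by fun_prop⟩
  have hp : ∀ e : E, (p e : FF) = π e := fun e => rfl
  let G : C(E × I, FF) := ⟨fun y => π y.1 + (y.2 : ℝ) • (π (sg (p y.1)) - π y.1), by fun_prop⟩
  have hG : ∀ e s, G (e, s) = π e + (s : ℝ) • (π (sg (p e)) - π e) := fun e s => rfl
  have hmem : ∀ e : E, (G.curry e, (e : EE), (sg (p e) : EE)) ∈ WP π E W := by
    intro e
    refine ⟨⟨?_, ?_⟩, fun s => ?_, e.2, (sg (p e)).2⟩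
    · change G (e, 0) = _
      rw [hG]; simp
    · change G (e, 1) = _
      rw [hG]; simp
    · refine hsg (p e) ?_
      rw [segment_eq_image']
      exact ⟨s, s.2, rfl⟩
  let w' : C(E, WP π E W) := ⟨fun e => ⟨(G.curry e, (e : EE), (sg (p e) : EE)), hmem e⟩,
    Continuous.subtype_mk (G.curry.continuous.prodMk (by fun_prop)) _⟩
  let Θ : C(E, C(I, E)) := tg.comp w'
  have hΘ : ∀ e : E, segment ℝ (e : EE) (Θ e 0) ⊆ E ∧ segment ℝ (sg (p e) : EE) (Θ e 1) ⊆ E := by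
    intro e
    have h := htg (w' e)
    constructor
    · rintro _ ⟨a, b, ha, hb, hab, rfl⟩
      exact (h ⟨a, b, ha, hb, hab, rfl⟩).2.2.1
    · rintro _ ⟨a, b, ha, hb, hab, rfl⟩
      exact (h ⟨a, b, ha, hb, hab, rfl⟩).2.2.2
  let t0 : C(E, E) := ⟨fun e => Θ e 0, by fun_prop⟩
  let t1 : C(E, E) := ⟨fun e => Θ e 1, by fun_prop⟩
  have H1 : ContinuousMap.Homotopic (ContinuousMap.id E) t0 := line_hom _ _ fun e => (hΘ e).1
  have H2 : ContinuousMap.Homotopic t0 t1 :=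
    ⟨⟨⟨fun y => Θ y.2 y.1, by fun_prop⟩, fun e => rfl, fun e => rfl⟩⟩
  have H3 : ContinuousMap.Homotopic (sg.comp p) t1 := line_hom _ _ fun e => (hΘ e).2
  refine ⟨⟨p, sg, H3.trans (H2.symm.trans H1.symm), ?_⟩, hp⟩
  exact (line_hom _ _ fun w => hsg w).symm
end he
end
end Oka


open WeakDual
set_option linter.all false
set_option linter.deprecated false
set_option linter.unusedSectionVars false
namespace Oka
noncomputable section
universe uJ uE
open unitInterval

theorem tietze {P : Type*} [TopologicalSpace P] [CompactSpace P] [T2Space P] {F : Type*} [NormedAddCommGroup F]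
    [NormedSpace ℝ F] [CompleteSpace F] {Q : Set P} (hQ : IsClosed Q) (e : P → F) (he : ContinuousOn e Q) :
    ∃ g : C(P, F), ∀ q ∈ Q, g q = e q := by
  haveI : CompactSpace Q := isCompact_iff_compactSpace.1 hQ.isCompact
  let ι : C(Q, P) := ⟨Subtype.val, continuous_subtype_val⟩
  let res : NormedAddGroupHom C(P, F) C(Q, F) :=
    { toFun := fun g => g.comp ι
      map_add' := fun g g' => rfl
      bound' := ⟨1, fun g => by
        rw [one_mul]
        exact (ContinuousMap.norm_le _ (norm_nonneg _)).2 fun q => g.norm_coe_le_norm q⟩ }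
  have hres : ∀ g (q : Q), res g q = g q := fun g q => rfl
  let h : C(Q, F) := ⟨fun q => e q, continuousOn_iff_continuous_restrict.1 he⟩
  have hs : res.SurjectiveOnWith res.range 1 := by
    rintro k ⟨g, rfl⟩
    have hk : ∀ q : Q, ‖g q‖ ≤ ‖res g‖ := fun q => (res g).norm_coe_le_norm q
    change ∃ g', res g' = res g ∧ ‖g'‖ ≤ 1 * ‖res g‖
    rcases (norm_nonneg (res g)).eq_or_lt with h0 | h0
    · refine ⟨0, ?_, by simp⟩
      rw [norm_eq_zero.1 h0.symm, map_zero]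
    · generalize hM : ‖res g‖ = M at hk h0
      have hpos : ∀ p, 0 < max M ‖g p‖ := fun p => lt_max_of_lt_left h0
      refine ⟨⟨fun p => (M / max M ‖g p‖) • g p, ?_⟩, ?_, ?_⟩
      · refine Continuous.smul (Continuous.div₀ continuous_const (by fun_prop) fun p => (hpos p).ne') g.continuous
      · ext q
        change (M / max M ‖g q‖) • g q = g q
        rw [max_eq_left (hk q), div_self h0.ne', one_smul]
      · rw [one_mul, ContinuousMap.norm_le _ h0.le]
        intro p
        change ‖(M / max M ‖g p‖) • g p‖ ≤ M
        rw [norm_smul, Real.norm_of_nonneg (div_nonneg h0.le (hpos p).le), div_mul_eq_mul_div, div_le_iff₀ (hpos p)]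
        exact mul_le_mul_of_nonneg_left (le_max_right _ _) h0.le
  have hd : h ∈ res.range.topologicalClosure := by
    change h ∈ closure (res.range : Set C(Q, F))
    rw [Metric.mem_closure_iff]
    intro ε hε
    let t : P → Set F := fun p => {c | p ∈ Q → dist c (e p) < ε}
    obtain ⟨g, hg⟩ := exists_continuous_forall_mem_convex_of_local_const (t := t) (by
      intro p
      by_cases hp : p ∈ Q
      · have : t p = Metric.ball (e p) ε := by ext c; simp [t, hp]
        rw [this]; exact convex_ball _ _
      · have : t p = Set.univ := by ext c; simp [t, hp]
        rw [this]; exact convex_univ) (by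
      intro p
      refine ⟨e p, ?_⟩
      by_cases hp : p ∈ Q
      · have h1 : ∀ᶠ y in nhdsWithin p Q, dist (e y) (e p) < ε := (he p hp).eventually (Metric.ball_mem_nhds _ hε)
        rw [eventually_nhdsWithin_iff] at h1
        filter_upwards [h1] with y hy hyQ
        rw [dist_comm]; exact hy hyQ
      · filter_upwards [hQ.isOpen_compl.mem_nhds hp] with y hy hyQ
        exact absurd hyQ hy)
    refine ⟨res g, ⟨g, rfl⟩, ?_⟩
    rw [ContinuousMap.dist_lt_iff hε]
    intro q
    rw [dist_comm]
    exact hg q q.2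
  obtain ⟨g, hg, -⟩ := controlled_closure_of_complete one_pos one_pos hs h hd
  exact ⟨g, fun q hq => by
    have := DFunLike.congr_fun hg ⟨q, hq⟩
    exact this⟩
end
end Oka


open WeakDual
set_option linter.all false
set_option linter.deprecated false
set_option linter.unusedSectionVars false
namespace Oka
noncomputable section
universe uB
open unitInterval

section conc
variable (A : Type uB) [NormedCommRing A] [NormedAlgebra ℂ A] [CompleteSpace A] (d : Type) [Fintype d] [DecidableEq d]

/-- nonvanishing vectors over the cylinder algebra -/
def EU : Set (d → Cyl A) := {z | ∀ y, ∃ i, fn (z i) y ≠ 0}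
/-- nonvanishing vectors of functions -/
def WU : Set (d → C(characterSpace ℂ A, ℂ)) := {w | ∀ x, ∃ i, w i x ≠ 0}
/-- nonvanishing vectors over the algebra -/
def UU : Set (d → A) := {a | ∀ x : characterSpace ℂ A, ∃ i, x (a i) ≠ 0}

theorem isOpen_nv {Z Y : Type*} [TopologicalSpace Z] [TopologicalSpace Y] [CompactSpace Y] (g : Z × Y → d → ℂ)
    (hg : Continuous g) : IsOpen {z | ∀ y, ∃ i, g (z, y) i ≠ 0} := by
  have hcl : IsClosed {q : Z × Y | g q = 0} := isClosed_eq hg continuous_const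
  convert (isClosedMap_fst_of_compactSpace _ hcl).isOpen_compl using 1
  ext z
  simp only [Set.mem_setOf_eq, Set.mem_compl_iff, Set.mem_image, not_exists]
  constructor
  · rintro h ⟨z', y⟩ ⟨h0, rfl⟩
    obtain ⟨i, hi⟩ := h y
    exact hi (congrFun h0 i)
  · intro h y
    by_contra! hcon
    exact h (z, y) ⟨funext hcon, rfl⟩

theorem isOpen_EU : IsOpen (EU A d) := by
  refine isOpen_nv d (fun (q : (d → Cyl A) × (I × characterSpace ℂ A)) i => fn (q.1 i) q.2) (continuous_pi fun i => ?_)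
  have h1 : Continuous fun q : (d → Cyl A) × (I × characterSpace ℂ A) => fn (q.1 i) :=
    continuous_fn.comp ((continuous_apply i).comp continuous_fst)
  exact h1.eval continuous_snd

theorem isOpen_WU : IsOpen (WU A d) := by
  refine isOpen_nv d (fun (q : (d → C(characterSpace ℂ A, ℂ)) × characterSpace ℂ A) i => q.1 i q.2) (continuous_pi fun i => ?_)
  have h1 : Continuous fun q : (d → C(characterSpace ℂ A, ℂ)) × characterSpace ℂ A => q.1 i := by fun_prop
  exact h1.eval continuous_snd

/-- bottom inclusion -/
def bot : C(characterSpace ℂ A, I × characterSpace ℂ A) := ⟨fun x => (0, x), by fun_prop⟩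

/-- restriction to the bottom, one coordinate -/
def bt (z : Cyl A) : C(characterSpace ℂ A, ℂ) := (fn z).comp (bot A)

theorem continuous_bt : Continuous (bt A) := (ContinuousMap.continuous_precomp (bot A)).comp continuous_fn

theorem bt_apply (z : Cyl A) (x : characterSpace ℂ A) : bt A z x = fn z (0, x) := rfl

/-- restriction to the bottom -/
def piC : (d → Cyl A) →L[ℂ] (d → C(characterSpace ℂ A, ℂ)) where
  toFun z i := bt A (z i)
  map_add' z z' := by
    funext i; ext x
    change fn (z i + z' i) _ = _
    rw [fn_add]; rfl
  map_smul' c z := by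
    funext i; ext x
    change fn (c • z i) _ = _
    rw [fn_smul]; rfl
  cont := continuous_pi fun i => (continuous_bt A).comp (continuous_apply i)

/-- real version -/
def piR : (d → Cyl A) →L[ℝ] (d → C(characterSpace ℂ A, ℂ)) := (piC A d).restrictScalars ℝ

theorem piR_apply (z : d → Cyl A) (i : d) : piR A d z i = bt A (z i) := rfl

/-- extension from the bottom -/
def exF (g : C(characterSpace ℂ A, ℂ)) : C(I × characterSpace ℂ A, ℂ) :=
  ⟨fun y => ((1 - (y.1 : ℝ) : ℝ) : ℂ), by fun_prop⟩ * g.comp ⟨Prod.snd, continuous_snd⟩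

theorem exF_apply (g : C(characterSpace ℂ A, ℂ)) (s : I) (x : characterSpace ℂ A) :
    exF A g (s, x) = ((1 - (s : ℝ) : ℝ) : ℂ) * g x := rfl

theorem exF_one (g : C(characterSpace ℂ A, ℂ)) (x : characterSpace ℂ A) : exF A g (1, x) = 0 := by
  rw [exF_apply]; simp

theorem continuous_exF : Continuous (exF A) :=
  continuous_const.mul (ContinuousMap.continuous_precomp _)

/-- extension as cylinder element -/
def Rz (g : C(characterSpace ℂ A, ℂ)) : Cyl A := zf (exF A g) (exF_one A g)

theorem fn_Rz (g : C(characterSpace ℂ A, ℂ)) : fn (Rz A g) = exF A g := by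
  rw [Rz, fn_zf]

theorem sd_Rz (g : C(characterSpace ℂ A, ℂ)) : sd (Rz A g) = 0 := by
  rw [Rz, snd_zf]

theorem continuous_Rz : Continuous (Rz A) := by
  refine continuous_cyl ?_ ?_
  · simp only [fn_Rz]; exact continuous_exF A
  · simp only [sd_Rz]; exact continuous_const

theorem Rz_zero : Rz A 0 = 0 := by
  refine cyl_ext (fun y => ?_) ?_
  · obtain ⟨s, x⟩ := y
    rw [fn_Rz, exF_apply, fn_zero]; simp
  · rw [sd_Rz, sd_zero]

theorem RLP_conc : RLP (fun e : EU A d => piR A d e) (WU A d) := by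
  intro P _ _ _ Q hQ f hf e he hef
  obtain ⟨e1, he1⟩ := tietze hQ (fun p => (e p : d → Cyl A)) (continuous_subtype_val.comp_continuousOn he)
  let u : d → C(P, Cyl A) := fun i => ⟨fun p => e1 p i + Rz A (f p i - bt A (e1 p i)), by
    have h1 : Continuous fun p => e1 p i := (continuous_apply i).comp e1.continuous
    have h2 : Continuous fun p => f p i := (continuous_apply i).comp f.continuous
    exact h1.add ((continuous_Rz A).comp (h2.sub ((continuous_bt A).comp h1)))⟩
  have hu : ∀ i p, u i p = e1 p i + Rz A (f p i - bt A (e1 p i)) := fun i p => rfl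
  have huQ : ∀ i, ∀ q ∈ Q, u i q = (e q : d → Cyl A) i := by
    intro i q hq
    have h1 : bt A ((e q : d → Cyl A) i) = f q i := congrFun (hef q hq) i
    rw [hu, he1 q hq, h1, sub_self, Rz_zero, add_zero]
  have hu0 : ∀ i p x, fn (u i p) (0, x) = f p i x := by
    intro i p x
    rw [hu, fn_add, ContinuousMap.add_apply, fn_Rz, exF_apply, ContinuousMap.sub_apply, bt_apply]
    simp
  obtain ⟨v, hv1, hv2⟩ := glp hQ u (by
    rintro p s x (h | rfl)
    · obtain ⟨i, hi⟩ := (e p).2 (s, x)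
      exact ⟨i, by rw [huQ i p h]; exact hi⟩
    · obtain ⟨i, hi⟩ := hf p x
      exact ⟨i, by rw [hu0]; exact hi⟩)
  refine ⟨⟨fun p => ⟨fun i => v i p, fun y => hv2 p y.1 y.2⟩,
    Continuous.subtype_mk (continuous_pi fun i => (v i).continuous) _⟩, fun p => ?_, fun q hq => ?_⟩
  · funext i
    ext x
    change fn (v i p) (0, x) = _
    rw [← hu0, ← sub_eq_zero, ← ContinuousMap.sub_apply, ← fn_sub, ← ContinuousMap.sub_apply]
    exact (mem_nC.1 (hv1 i)).2 p x
  · refine Subtype.ext (funext fun i => ?_)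
    change v i q = _
    rw [← huQ i q hq, ← sub_eq_zero, ← ContinuousMap.sub_apply]
    exact (mem_nC.1 (hv1 i)).1 q hq

theorem he_EW [Nonempty d] : ∃ h : ContinuousMap.HomotopyEquiv (EU A d) (WU A d),
    ∀ e : EU A d, (h e : d → C(characterSpace ℂ A, ℂ)) = piR A d e := by
  haveI : Nonempty (EU A d) := ⟨⟨fun _ => jj 1, fun y => ⟨Classical.arbitrary d, by
    obtain ⟨s, x⟩ := y
    rw [fn_jj, map_one]; exact one_ne_zero⟩⟩⟩
  refine he_of_RLP (piR A d) (EU A d) (WU A d) (isOpen_EU A d) (isOpen_WU A d) ?_ (RLP_conc A d)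
  intro e he x
  exact he (0, x)

/-- the sliding map -/
def slide (τ : I) (z : Cyl A) : Cyl A :=
  mkC ((fn z).comp ⟨fun y => (max y.1 τ, y.2), by fun_prop⟩) (sd z) (fun x => by
    change fn z (max 1 τ, x) = _
    rw [max_eq_left le_one', fn_one])

theorem fn_slide (τ : I) (z : Cyl A) (s : I) (x : characterSpace ℂ A) :
    fn (slide A τ z) (s, x) = fn z (max s τ, x) := by
  rw [slide, fn_mkC]; rfl

theorem sd_slide (τ : I) (z : Cyl A) : sd (slide A τ z) = sd z := by rw [slide, sd_mkC]

theorem continuous_slide : Continuous fun q : I × Cyl A => slide A q.1 q.2 := by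
  refine continuous_cyl ?_ ?_
  · refine ContinuousMap.continuous_of_continuous_uncurry _ ?_
    have : (Function.uncurry fun q : I × Cyl A => ((fn (slide A q.1 q.2) : C(I × characterSpace ℂ A, ℂ)) : I × characterSpace ℂ A → ℂ)) =
        fun q : (I × Cyl A) × (I × characterSpace ℂ A) => fn q.1.2 (max q.2.1 q.1.1, q.2.2) := by
      funext ⟨⟨τ, z⟩, ⟨s, x⟩⟩
      exact fn_slide A τ z s x
    rw [this]
    have h1 : Continuous fun q : (I × Cyl A) × (I × characterSpace ℂ A) => fn q.1.2 :=
      continuous_fn.comp (continuous_snd.comp continuous_fst)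
    exact h1.eval (by fun_prop)
  · simp only [sd_slide]
    exact continuous_sd.comp continuous_snd

/-- inclusion of constants -/
def jU : C(UU A d, EU A d) := ⟨fun a => ⟨fun i => jj (a.1 i), fun y => by
    obtain ⟨s, x⟩ := y
    obtain ⟨i, hi⟩ := a.2 x
    exact ⟨i, by rw [fn_jj]; exact hi⟩⟩, Continuous.subtype_mk (continuous_pi fun i =>
      continuous_jj.comp ((continuous_apply i).comp continuous_subtype_val)) _⟩

/-- projection to the top -/
def rU : C(EU A d, UU A d) := ⟨fun z => ⟨fun i => sd (z.1 i), fun x => by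
    obtain ⟨i, hi⟩ := z.2 (1, x)
    exact ⟨i, by rw [← fn_one]; exact hi⟩⟩, Continuous.subtype_mk (continuous_pi fun i =>
      continuous_sd.comp ((continuous_apply i).comp continuous_subtype_val)) _⟩

/-- first equivalence -/
def he_UE : ContinuousMap.HomotopyEquiv (UU A d) (EU A d) where
  toFun := jU A d
  invFun := rU A d
  left_inv := by
    have : (rU A d).comp (jU A d) = ContinuousMap.id _ := by
      refine ContinuousMap.ext fun a => Subtype.ext (funext fun i => ?_)
      exact snd_jj _
    rw [this]
  right_inv := by
    refine ContinuousMap.Homotopic.symm ?_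
    refine ⟨⟨⟨fun q => ⟨fun i => slide A q.1 (q.2.1 i), fun y => ?_⟩, ?_⟩, ?_, ?_⟩⟩
    · obtain ⟨s, x⟩ := y
      obtain ⟨i, hi⟩ := q.2.2 (max s q.1, x)
      exact ⟨i, by rw [fn_slide]; exact hi⟩
    · refine Continuous.subtype_mk (continuous_pi fun i => ?_) _
      exact (continuous_slide A).comp (continuous_fst.prodMk ((continuous_apply i).comp (continuous_subtype_val.comp continuous_snd)))
    · intro z
      refine Subtype.ext (funext fun i => ?_)
      change slide A 0 (z.1 i) = z.1 i
      refine cyl_ext (fun y => ?_) (sd_slide _ _ _)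
      obtain ⟨s, x⟩ := y
      rw [fn_slide, max_eq_left nonneg']
    · intro z
      refine Subtype.ext (funext fun i => ?_)
      change slide A 1 (z.1 i) = jj (sd (z.1 i))
      refine cyl_ext (fun y => ?_) (by rw [sd_slide, snd_jj])
      obtain ⟨s, x⟩ := y
      rw [fn_slide, max_eq_right le_one', fn_one, fn_jj]

end conc
end
end Oka


open WeakDual
set_option linter.all false
set_option linter.deprecated false
set_option linter.unusedSectionVars false
namespace Oka
noncomputable section
universe uB
open unitInterval

section conc
variable (A : Type uB) [NormedCommRing A] [NormedAlgebra ℂ A] [CompleteSpace A] (d : Type) [Fintype d] [DecidableEq d]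

/-- Euclidean vector -/
def euc (w : d → C(characterSpace ℂ A, ℂ)) (x : characterSpace ℂ A) : EuclideanSpace ℂ d := WithLp.toLp 2 fun i => w i x

theorem euc_apply (w : d → C(characterSpace ℂ A, ℂ)) (x : characterSpace ℂ A) (i : d) : euc A d w x i = w i x := rfl

theorem continuous_euc : Continuous fun q : (d → C(characterSpace ℂ A, ℂ)) × characterSpace ℂ A => euc A d q.1 q.2 := by
  refine (PiLp.continuous_toLp 2 _).comp (continuous_pi fun i => ?_)
  have h1 : Continuous fun q : (d → C(characterSpace ℂ A, ℂ)) × characterSpace ℂ A => q.1 i := by fun_prop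
  exact h1.eval continuous_snd

theorem euc_ne (w : WU A d) (x : characterSpace ℂ A) : euc A d w x ≠ 0 := by
  obtain ⟨i, hi⟩ := w.2 x
  intro h
  apply hi
  rw [← euc_apply A d w.1 x i, h]; rfl

/-- normalisation -/
def nrm (q : WU A d × characterSpace ℂ A) : Metric.sphere (0 : EuclideanSpace ℂ d) 1 :=
  ⟨((‖euc A d q.1 q.2‖⁻¹ : ℝ) : ℂ) • euc A d q.1 q.2, by
    rw [mem_sphere_zero_iff_norm, norm_smul, Complex.norm_real, norm_inv, norm_norm,
      inv_mul_cancel₀ (norm_ne_zero_iff.2 (euc_ne A d q.1 q.2))]⟩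

theorem continuous_nrm : Continuous (nrm A d) := by
  refine Continuous.subtype_mk ?_ _
  have h1 : Continuous fun q : WU A d × characterSpace ℂ A => euc A d q.1 q.2 :=
    (continuous_euc A d).comp ((continuous_subtype_val.comp continuous_fst).prodMk continuous_snd)
  exact (Complex.continuous_ofReal.comp (h1.norm.inv₀ fun q => norm_ne_zero_iff.2 (euc_ne A d q.1 q.2))).smul h1

/-- second equivalence, forward -/
def fS : C(WU A d, C(characterSpace ℂ A, Metric.sphere (0 : EuclideanSpace ℂ d) 1)) :=
  ContinuousMap.curry ⟨nrm A d, continuous_nrm A d⟩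

theorem fS_apply (w : WU A d) (x : characterSpace ℂ A) : fS A d w x = nrm A d (w, x) := rfl

/-- coordinates -/
def crd (i : d) : C(Metric.sphere (0 : EuclideanSpace ℂ d) 1, ℂ) :=
  ⟨fun v => (v : EuclideanSpace ℂ d) i, by fun_prop⟩

/-- second equivalence, backward -/
def gS : C(C(characterSpace ℂ A, Metric.sphere (0 : EuclideanSpace ℂ d) 1), WU A d) :=
  ⟨fun c => ⟨fun i => (crd d i).comp c, fun x => by
    by_contra! hcon
    have h0 : (c x : EuclideanSpace ℂ d) = 0 := by
      ext i; exact hcon i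
    have := (c x).2
    rw [h0] at this
    simp at this⟩, Continuous.subtype_mk (continuous_pi fun i => ContinuousMap.continuous_postcomp _) _⟩

theorem euc_gS (c : C(characterSpace ℂ A, Metric.sphere (0 : EuclideanSpace ℂ d) 1)) (x : characterSpace ℂ A) :
    euc A d (gS A d c).1 x = c x := by
  ext i; rfl

/-- last equivalence -/
def he_WS : ContinuousMap.HomotopyEquiv (WU A d) C(characterSpace ℂ A, Metric.sphere (0 : EuclideanSpace ℂ d) 1) where
  toFun := fS A d
  invFun := gS A d
  right_inv := by
    have : (fS A d).comp (gS A d) = ContinuousMap.id _ := by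
      refine ContinuousMap.ext fun c => ContinuousMap.ext fun x => Subtype.ext ?_
      change ((‖euc A d (gS A d c).1 x‖⁻¹ : ℝ) : ℂ) • euc A d (gS A d c).1 x = c x
      rw [euc_gS, mem_sphere_zero_iff_norm.1 (c x).2]
      simp
    rw [this]
  left_inv := by
    refine line_hom _ _ fun w => ?_
    rintro _ ⟨a, b, ha, hb, hab, rfl⟩
    intro x
    obtain ⟨i, hi⟩ := w.2 x
    refine ⟨i, ?_⟩
    have hpos : 0 < ‖euc A d w.1 x‖⁻¹ := inv_pos.2 (norm_pos_iff.2 (euc_ne A d w x))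
    have : (a • ((gS A d (fS A d w)).1) + b • (w.1)) i x = ((a * ‖euc A d w.1 x‖⁻¹ + b : ℝ) : ℂ) * w.1 i x := by
      change (a : ℝ) • ((‖euc A d w.1 x‖⁻¹ : ℝ) : ℂ) • (w.1 i x) + b • w.1 i x = _
      simp only [Complex.real_smul, smul_eq_mul]
      push_cast
      ring
    change (a • ((gS A d (fS A d w)).1) + b • (w.1)) i x ≠ 0
    rw [this]
    refine mul_ne_zero ?_ hi
    rw [Complex.ofReal_ne_zero]
    have : 0 < a * ‖euc A d w.1 x‖⁻¹ + b := by
      rcases ha.eq_or_lt with h | h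
      · have : b = 1 := by rw [← h] at hab; linarith
        rw [← h, this]; norm_num
      · positivity
    exact this.ne'

end conc

section pc
variable {X Y : Type*} [TopologicalSpace X] [TopologicalSpace Y]

theorem joined_I (s t : I) : Joined s t := by
  haveI : PathConnectedSpace I := isPathConnected_iff_pathConnectedSpace.1
    ((convex_Icc (0 : ℝ) 1).isPathConnected ⟨0, by simp⟩)
  exact PathConnectedSpace.joined _ _

theorem pc_map (f : C(X, Y)) {x x' : X} (h : x' ∈ pathComponent x) : f x' ∈ pathComponent (f x) :=
  Joined.map h f.continuous

/-- restriction of maps to path components -/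
def rP (f : C(X, Y)) (x : X) (y : Y) (h : Joined y (f x)) : C(pathComponent x, pathComponent y) :=
  ⟨fun z => ⟨f z, h.trans (pc_map f z.2)⟩, by fun_prop⟩

theorem pc_hom (f g : C(X, X)) (hfg : f.Homotopic g) (x : X) (f' g' : C(pathComponent x, pathComponent x))
    (hf : ∀ z, (f' z : X) = f z) (hg : ∀ z, (g' z : X) = g z) : f'.Homotopic g' := by
  obtain ⟨H⟩ := hfg
  have hm : ∀ q : I × pathComponent x, H (q.1, q.2.1) ∈ pathComponent x := by
    rintro ⟨s, z⟩
    have h1 : Joined x (f z) := by rw [← hf]; exact (f' z).2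
    refine h1.trans ?_
    have : Joined (0 : I) s := joined_I _ _
    have h2 := this.map (f := fun s => H (s, z.1)) (by fun_prop)
    simpa using h2
  refine ⟨⟨⟨fun q => ⟨_, hm q⟩, by fun_prop⟩, fun z => ?_, fun z => ?_⟩⟩
  · refine Subtype.ext ?_
    change H (0, z.1) = _
    rw [H.apply_zero, hf]
  · refine Subtype.ext ?_
    change H (1, z.1) = _
    rw [H.apply_one, hg]

/-- equivalence of path components -/
def he_pc (h : ContinuousMap.HomotopyEquiv X Y) (x : X) (y : Y) (hy : h.toFun x = y) :
    ContinuousMap.HomotopyEquiv (pathComponent x) (pathComponent y) where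
  toFun := rP h.toFun x y (by rw [hy])
  invFun := rP h.invFun y x (by
    obtain ⟨H⟩ := h.left_inv
    have : Joined (0 : I) 1 := joined_I _ _
    have h2 := this.map (f := fun s => H (s, x)) (by fun_prop)
    rw [← hy]
    simpa using h2.symm)
  left_inv := pc_hom _ _ h.left_inv x _ _ (fun z => rfl) (fun z => rfl)
  right_inv := pc_hom _ _ h.right_inv y _ _ (fun z => rfl) (fun z => rfl)

end pc
end
end Oka


open WeakDual
set_option linter.all false
set_option linter.deprecated false
set_option linter.unusedSectionVars false
namespace Oka
noncomputable section
universe uB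
open unitInterval

section orb
variable {A : Type uB} [NormedCommRing A] [NormedAlgebra ℂ A] [CompleteSpace A] {d : Type} [Fintype d] [DecidableEq d]

theorem unimod {w : d → A} (hw : w ∈ UU A d) : ∃ y : d → A, ∑ i, y i * w i = 1 := by
  have htop : Ideal.span (Set.range w) = ⊤ := by
    by_contra hne
    obtain ⟨M, hM, hle⟩ := Ideal.exists_le_maximal _ hne
    haveI := hM
    obtain ⟨i, hi⟩ := hw (Ideal.toCharacterSpace M)
    exact hi (Ideal.toCharacterSpace_apply_eq_zero_of_mem M (hle (Ideal.subset_span ⟨i, rfl⟩)))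
  have h1 : (1 : A) ∈ Ideal.span (Set.range w) := by rw [htop]; trivial
  obtain ⟨c, hc⟩ := (Ideal.mem_span_range_iff_exists_fun).1 h1
  exact ⟨c, hc⟩

/-- orbit of a vector -/
def Lc (e : d → A) : Set (d → A) := {x | ∃ u : Matrix d d A, IsUnit u ∧ u.mulVec e = x}

theorem Lc_sub {e : d → A} (he : e ∈ UU A d) : Lc e ⊆ UU A d := by
  rintro x ⟨u, hu, rfl⟩ χ
  obtain ⟨v, hv⟩ := hu.exists_left_inv
  by_contra! hcon
  obtain ⟨i, hi⟩ := he χ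
  apply hi
  have : e = v.mulVec (u.mulVec e) := by rw [Matrix.mulVec_mulVec, hv, Matrix.one_mulVec]
  rw [this]
  change χ (∑ j, v i j * (u.mulVec e) j) = 0
  rw [map_sum]
  exact Finset.sum_eq_zero fun j _ => by rw [map_mul, hcon j, mul_zero]

theorem Lc_near {e : d → A} {w : d → A} (hw : w ∈ UU A d) : ∀ᶠ w' in nhds w, (w ∈ Lc e ↔ w' ∈ Lc e) := by
  obtain ⟨y, hy⟩ := unimod hw
  have hc : Continuous fun w' : d → A => 1 + ∑ i, y i * (w' i - w i) := by fun_prop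
  have hn : ∀ᶠ w' in nhds w, IsUnit (1 + ∑ i, y i * (w' i - w i)) := by
    refine hc.continuousAt.eventually (Units.isOpen.mem_nhds ?_)
    simp
  filter_upwards [hn] with w' hw'
  let T : Matrix d d A := 1 + Matrix.vecMulVec (w' - w) y
  have hT : T.det = 1 + ∑ i, y i * (w' i - w i) := by
    simp only [T]
    rw [Matrix.vecMulVec_eq Unit, Matrix.det_one_add_replicateCol_mul_replicateRow]
    rfl
  have hTu : IsUnit T := by rw [Matrix.isUnit_iff_isUnit_det, hT]; exact hw'
  have hTw : T.mulVec w = w' := by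
    simp only [T]
    rw [Matrix.add_mulVec, Matrix.one_mulVec, Matrix.vecMulVec_mulVec]
    have : y ⬝ᵥ w = 1 := hy
    rw [this]
    funext i
    simp
  constructor
  · rintro ⟨u, hu, h⟩
    exact ⟨T * u, hTu.mul hu, by rw [← Matrix.mulVec_mulVec, h, hTw]⟩
  · rintro ⟨u, hu, h⟩
    obtain ⟨t, ht⟩ := hTu
    refine ⟨(t⁻¹ : (Matrix d d A)ˣ) * u, (Units.isUnit _).mul hu, ?_⟩
    rw [← Matrix.mulVec_mulVec, h, ← hTw, ← ht, Matrix.mulVec_mulVec, Units.inv_mul, Matrix.one_mulVec]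

theorem path_Lc {e : d → A} {a b : UU A d} (γ : Path a b) (ha : a.1 ∈ Lc e) (t : I) : (γ t).1 ∈ Lc e := by
  let S : Set I := {t | (γ t).1 ∈ Lc e}
  have hc : Continuous fun t => (γ t).1 := continuous_subtype_val.comp γ.continuous
  have hcl : IsClopen S := by
    constructor
    · rw [← isOpen_compl_iff, isOpen_iff_mem_nhds]
      intro t ht
      filter_upwards [hc.continuousAt.eventually (Lc_near (e := e) (γ t).2)] with t' h' h''
      exact ht (h'.2 h'')
    · rw [isOpen_iff_mem_nhds]
      intro t ht
      filter_upwards [hc.continuousAt.eventually (Lc_near (e := e) (γ t).2)] with t' h'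
      exact h'.1 ht
  have : S = Set.univ := hcl.eq_univ ⟨0, by change (γ 0).1 ∈ Lc e; rw [γ.source]; exact ha⟩
  have h : t ∈ S := by rw [this]; trivial
  exact h

/-- comparison of path components -/
def homeoLc (e : d → A) (he : e ∈ UU A d) (h1 : e ∈ Lc e) :
    pathComponent (⟨e, h1⟩ : Lc e) ≃ₜ pathComponent (⟨e, he⟩ : UU A d) where
  toFun z := ⟨⟨z.1.1, Lc_sub he z.1.2⟩, by
    have : Continuous fun z : Lc e => (⟨z.1, Lc_sub he z.2⟩ : UU A d) := by fun_prop
    exact Joined.map (f := fun z : Lc e => (⟨z.1, Lc_sub he z.2⟩ : UU A d)) z.2 this⟩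
  invFun z := ⟨⟨z.1.1, by
    obtain ⟨γ⟩ := z.2
    have := path_Lc γ h1 1
    rwa [γ.target] at this⟩, by
    obtain ⟨γ⟩ := z.2
    exact ⟨⟨⟨fun t => ⟨(γ t).1, path_Lc γ h1 t⟩, by fun_prop⟩, Subtype.ext (show (γ 0).1 = e by rw [γ.source]),
      Subtype.ext (show (γ 1).1 = z.1.1 by rw [γ.target])⟩⟩⟩
  left_inv z := rfl
  right_inv z := rfl
  continuous_toFun := by fun_prop
  continuous_invFun := by fun_prop

theorem final (A : Type uB) [NormedCommRing A] [NormedAlgebra ℂ A] [CompleteSpace A] (d : Type) [Fintype d] [DecidableEq d]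
    (i0 : d) (e : d → A) (hee : e = Pi.single i0 1) (h1 : e ∈ Lc e)
    (s₀ : Metric.sphere (0 : EuclideanSpace ℂ d) 1) (hs : (s₀ : EuclideanSpace ℂ d) = EuclideanSpace.single i0 1) :
    Nonempty (ContinuousMap.HomotopyEquiv (pathComponent (⟨e, h1⟩ : Lc e))
      (pathComponent (ContinuousMap.const (characterSpace ℂ A) s₀))) := by
  haveI : Nonempty d := ⟨i0⟩
  have hval : ∀ (x : characterSpace ℂ A) i, x (e i) = (EuclideanSpace.single i0 (1 : ℂ) : EuclideanSpace ℂ d) i := by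
    intro x i
    rw [hee]
    by_cases h : i = i0
    · subst h; simp
    · simp [h]
  have he : e ∈ UU A d := fun x => ⟨i0, by rw [hval]; simp⟩
  obtain ⟨h, hh⟩ := he_EW A d
  refine ⟨(homeoLc e he h1).toHomotopyEquiv.trans
    (he_pc (((he_UE A d).trans h).trans (he_WS A d)) ⟨e, he⟩ _ ?_)⟩
  refine ContinuousMap.ext fun x => Subtype.ext ?_
  change (nrm A d (h (jU A d ⟨e, he⟩), x)).1 = s₀.1
  have : euc A d (h (jU A d ⟨e, he⟩)).1 x = EuclideanSpace.single i0 1 := by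
    rw [hh]
    ext i
    rw [euc_apply, piR_apply, bt_apply]
    change fn (jj (e i)) (0, x) = _
    rw [fn_jj, hval]
  change ((‖euc A d (h (jU A d ⟨e, he⟩)).1 x‖⁻¹ : ℝ) : ℂ) • euc A d (h (jU A d ⟨e, he⟩)).1 x = s₀.1
  rw [this, hs]
  simp
end orb
end
end Oka




open WeakDual Matrix

/-- Let `A` be a commutative unital complex Banach algebra and `n ≥ 1`
(size `n + 1 ≥ 1`).  There is a homotopy equivalence between `Lcₙ(A)₀`, the path component of
`eₙ` in the space of last columns, and the path component of the constant map with value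
`(0, …, 0, 1)` in `C(Max(A), S^{2n−1})`, where `S^{2n−1}` is the unit sphere of `ℂⁿ`. -/
theorem stmt_13
    (A : Type*) [NormedCommRing A] [NormedAlgebra ℂ A] [CompleteSpace A] (n : ℕ) :
    -- the last standard basis vector and the space of last columns
    let eA : Fin (n + 1) → A := Pi.single (Fin.last n) 1
    let LcA : Type _ := {x : Fin (n + 1) → A //
      ∃ u : Matrix (Fin (n + 1)) (Fin (n + 1)) A, IsUnit u ∧ u.mulVec eA = x}
    let a₀ : LcA := ⟨eA, 1, isUnit_one, Matrix.one_mulVec eA⟩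
    -- the basepoint `(0, …, 0, 1)` of the unit sphere `S^{2n−1} ⊆ ℂⁿ`
    let s₀ : ↥(Metric.sphere (0 : EuclideanSpace ℂ (Fin (n + 1))) 1) :=
      ⟨EuclideanSpace.single (Fin.last n) (1 : ℂ), by simp⟩
    -- the constant map `Max(A) → S^{2n−1}` with value `(0, …, 0, 1)`
    let c₀ : C(characterSpace ℂ A, ↥(Metric.sphere (0 : EuclideanSpace ℂ (Fin (n + 1))) 1)) :=
      ContinuousMap.const _ s₀
    -- there is a homotopy equivalence `Lcₙ(A)₀ ≃ₕ C(Max(A), S^{2n−1})₀`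
    Nonempty (ContinuousMap.HomotopyEquiv (pathComponent a₀) (pathComponent c₀)) := by
  intro eA LcA a₀ s₀ c₀
  exact Oka.final A (Fin (n + 1)) (Fin.last n) eA rfl ⟨1, isUnit_one, Matrix.one_mulVec eA⟩ s₀ rfl
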